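/- Let n ≥ 3 and let d be an odd composite square-free integer all of whose prime divisors are ≡ 9 (mod 16), with q such divisors. Then rank_2(Cl(Q(ζ_{2^n}, √d))) = 4q − 3 if there exist prime divisors p₁, p₂ of d with (2/p₁)_4 = 1 and (2/p₂)_4 = −1, and rank_2(Cl(Q(ζ_{2^n}, √d))) = 4q − 2 otherwise. -/

import Mathlib

open NumberField IntermediateField

/-- The 2-rank of the class group: dim_{F₂} Cl(K)/Cl(K)². -/
noncomputable def rank2 (K : Type*) [Field K] [NumberField K] : ℕ :=
  Nat.log 2 (Nat.card
    (ClassGroup (𝓞 K) ⧸ Subgroup.closure {x : ClassGroup (𝓞 K) | ∃ y, x = y ^ 2}))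

/-- The homomorphism `x ↦ x * σ x`. -/
abbrev twistMul {M : Type*} [CommGroup M] (σ : M →* M) : M →* M := MonoidHom.id M * σ

/-- The homomorphism `x ↦ x / σ x`. -/
abbrev twistDiv {M : Type*} [CommGroup M] (σ : M →* M) : M →* M := MonoidHom.id M / σ

section AmbiguousIndex

variable {M I : Type*} [CommGroup M] [CommGroup I]

theorem Subgroup.mem_of_sq_mem_of_odd_pow_mem {G : Type*} [Group G] (P : Subgroup G) {a : G}
    {h : ℕ} (hh : Odd h) (h2 : a ^ 2 ∈ P) (hah : a ^ h ∈ P) : a ∈ P := by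
  obtain ⟨j, rfl⟩ := hh
  rw [pow_succ, pow_mul] at hah
  exact (P.mul_mem_cancel_left (P.pow_mem h2 j)).1 hah

theorem card_sq_eq_one_quotient (P : Subgroup I) :
    Nat.card {c : I ⧸ P // c ^ 2 = 1} = P.relIndex (P.comap (powMonoidHom 2)) := by
  have h1 : Nat.card {c : I ⧸ P // c ^ 2 = 1}
      = Nat.card ((P.comap (powMonoidHom 2)).map (QuotientGroup.mk' P)) := by
    apply Nat.card_congr
    apply Equiv.subtypeEquivRight
    intro c
    induction c using QuotientGroup.induction_on with
    | H a =>
      rw [← QuotientGroup.mk_pow, QuotientGroup.eq_one_iff, Subgroup.mem_map]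
      constructor
      · intro h
        exact ⟨a, h, rfl⟩
      · rintro ⟨b, hb, hba⟩
        have : (b ^ 2 : I) ∈ P := hb
        rw [← QuotientGroup.eq_one_iff, QuotientGroup.mk_pow] at this ⊢
        rw [← this, ← hba]
        rfl
  rw [h1, ← Subgroup.relIndex_bot_left, ← Subgroup.relIndex_comap, MonoidHom.comap_bot,
    QuotientGroup.ker_mk']

variable (div : M →* I) (σ : M →* M) (τ : I →* I) (J : Subgroup I) (h : ℕ)

theorem relIndex_ambiguous_principal (hcomm : ∀ x, div (σ x) = τ (div x))
    (hN : ∀ a, a * τ a ∈ J) (hJτ : ∀ a ∈ J, τ a = a) (hh : Odd h)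
    (hJh : ∀ a ∈ J, ∃ y, σ y = y ∧ div y = a ^ h) :
    Nat.card {c : I ⧸ div.range // c ^ 2 = 1} =
      (J ⊔ div.range).relIndex (div.range.comap (twistDiv τ)) := by
  set P := div.range
  have hPτ : ∀ a ∈ P, τ a ∈ P := by
    rintro _ ⟨x, rfl⟩
    exact ⟨σ x, hcomm x⟩
  have hJP : ∀ a ∈ J, a ^ h ∈ P := fun a ha => by
    obtain ⟨y, -, hy⟩ := hJh a ha
    exact ⟨y, hy⟩
  set A' := P.comap (powMonoidHom 2)
  have memA' : ∀ a, a ∈ A' ↔ a ^ 2 ∈ P := fun a => Iff.rfl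
  set A := P.comap (twistDiv τ)
  have memA : ∀ a, a ∈ A ↔ a / τ a ∈ P := fun a => Iff.rfl
  have sqeq : ∀ a, a ^ 2 = (a * τ a) * (a / τ a) := fun a => by
    rw [mul_div_assoc', mul_right_comm, mul_div_assoc, div_self', mul_one, sq]
  have hA : A = A' ⊔ (J ⊔ P) := by
    apply le_antisymm
    · intro a ha
      rw [memA] at ha
      obtain ⟨j, rfl⟩ := hh
      have h1 : a ^ (2 * j + 1) ∈ A' := by
        rw [memA', ← pow_mul, mul_comm, pow_mul, sqeq, mul_pow]
        exact P.mul_mem (hJP _ (hN a)) (P.pow_mem ha _)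
      have h2 : (a ^ 2) ^ j ∈ J ⊔ P := by
        apply Subgroup.pow_mem
        rw [sqeq]
        exact Subgroup.mul_mem_sup (hN a) ha
      have h3 : a = a ^ (2 * j + 1) * ((a ^ 2) ^ j)⁻¹ := by
        rw [pow_succ, pow_mul]; group
      rw [h3]
      exact Subgroup.mul_mem_sup h1 (inv_mem h2)
    · refine sup_le ?_ (sup_le ?_ ?_)
      · intro a ha
        rw [memA'] at ha
        have h1 : a * τ a ∈ P := by
          refine P.mem_of_sq_mem_of_odd_pow_mem hh ?_ (hJP _ (hN a))
          rw [mul_pow, ← map_pow]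
          exact P.mul_mem ha (hPτ _ ha)
        rw [memA]
        rw [sqeq] at ha
        exact (P.mul_mem_cancel_left h1).1 ha
      · intro a ha
        rw [memA, hJτ a ha, div_self']
        exact one_mem _
      · intro a ha
        rw [memA]
        exact div_mem ha (hPτ a ha)
  have hinf : (J ⊔ P) ⊓ A' = P := by
    apply le_antisymm
    · rintro a ⟨ha, ha'⟩
      obtain ⟨b, hb, p, hp, rfl⟩ := Subgroup.mem_sup.1 ha
      refine P.mul_mem (P.mem_of_sq_mem_of_odd_pow_mem hh ?_ (hJP b hb)) hp
      have := (memA' _).1 ha'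
      rw [mul_pow] at this
      exact (P.mul_mem_cancel_right (P.pow_mem hp 2)).1 this
    · exact le_inf le_sup_right fun a ha => P.pow_mem ha 2
  rw [card_sq_eq_one_quotient, hA, Subgroup.relIndex_sup_right,
    ← Subgroup.inf_relIndex_right (J ⊔ P), hinf]

theorem relIndex_ambiguous_fixed (hcomm : ∀ x, div (σ x) = τ (div x))
    (hσ : ∀ x, σ (σ x) = x) (hτ : ∀ a, τ (τ a) = a)
    (h90 : ∀ x, x * σ x = 1 → ∃ y, x = y / σ y)
    (h90I : ∀ a, a * τ a = 1 → ∃ b, a = b / τ b) :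
    ((twistDiv τ).ker ⊔ div.range).relIndex (div.range.comap (twistDiv τ)) =
      (div.ker.map (twistMul σ)).relIndex (div.ker ⊓ (twistMul σ).range) := by
  have e1 : (twistDiv τ).ker ⊔ div.range
      = (div.range.map (twistDiv τ)).comap (twistDiv τ) := by
    rw [Subgroup.comap_map_eq, sup_comm]
  have e2 : (div.range.comap (twistDiv τ)).map (twistDiv τ)
      = (div.ker.comap (twistMul σ)).map div := by
    ext a
    constructor
    · rintro ⟨b, ⟨x, hx⟩, rfl⟩
      refine ⟨x, ?_, hx⟩
      change div (x * σ x) = 1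
      rw [map_mul, hcomm, hx]
      change b / τ b * τ (b / τ b) = 1
      rw [map_div, hτ]
      simp
    · rintro ⟨x, hx, rfl⟩
      have hx' : div (x * σ x) = 1 := hx
      rw [map_mul, hcomm] at hx'
      obtain ⟨b, hb⟩ := h90I _ hx'
      exact ⟨b, ⟨x, hb⟩, hb.symm⟩
  have e3 : div.ker ⊓ (twistMul σ).range = (div.ker.comap (twistMul σ)).map (twistMul σ) := by
    rw [Subgroup.map_comap_eq, inf_comm]
  have e4 : (div.range.map (twistDiv τ)).comap div
      = (div.ker.map (twistMul σ)).comap (twistMul σ) := by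
    ext x
    constructor
    · rintro ⟨_, ⟨y, rfl⟩, hy⟩
      have hy' : div y / τ (div y) = div x := hy
      refine ⟨x / (y / σ y), ?_, ?_⟩
      · change div _ = 1
        rw [map_div, map_div, hcomm, hy', div_self']
      · change x / (y / σ y) * σ (x / (y / σ y)) = x * σ x
        rw [map_div, map_div, hσ, div_mul_div_comm]
        simp
    · rintro ⟨e, he, hex⟩
      have hex' : e * σ e = x * σ x := hex
      have he' : div e = 1 := he
      obtain ⟨y, hy⟩ := h90 (x / e) (by
        rw [map_div, div_mul_div_comm, hex', div_self'])
      refine ⟨div y, ⟨y, rfl⟩, ?_⟩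
      change div y / τ (div y) = div x
      rw [← hcomm, ← map_div, ← hy, map_div, he', div_one]
  rw [e1, Subgroup.relIndex_comap, e2, e3, ← Subgroup.relIndex_comap, e4, Subgroup.relIndex_comap]

theorem relIndex_fixed_principal (hcomm : ∀ x, div (σ x) = τ (div x))
    (hσ : ∀ x, σ (σ x) = x)
    (hJτ : ∀ a ∈ J, τ a = a) (hh : Odd h)
    (hJh : ∀ a ∈ J, ∃ y, σ y = y ∧ div y = a ^ h)
    (hfix : ∀ y, σ y = y → div y ∈ J)
    (h90 : ∀ x, x * σ x = 1 → ∃ y, x = y / σ y) :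
    J.relIndex (div.range ⊓ (twistDiv τ).ker) =
      (div.ker.map (twistDiv σ)).relIndex (div.ker ⊓ (twistMul σ).ker) := by
  have e1 : div.range ⊓ (twistDiv τ).ker = ((twistDiv τ).ker.comap div).map div := by
    rw [Subgroup.map_comap_eq]
  have e2 : div.ker ⊓ (twistMul σ).ker = ((twistDiv τ).ker.comap div).map (twistDiv σ) := by
    ext v
    constructor
    · rintro ⟨hv, hv'⟩
      obtain ⟨y, rfl⟩ := h90 v hv'
      refine ⟨y, ?_, rfl⟩
      change div y / τ (div y) = 1
      rw [← hcomm, ← map_div]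
      exact hv
    · rintro ⟨y, hy, rfl⟩
      have hy' : div y / τ (div y) = 1 := hy
      constructor
      · change div (y / σ y) = 1
        rw [map_div, hcomm, hy']
      · change y / σ y * σ (y / σ y) = 1
        rw [map_div, hσ]
        simp
  have e3 : J.comap div = (div.ker.map (twistDiv σ)).comap (twistDiv σ) := by
    ext y
    constructor
    · intro hy
      have hy' : div y ∈ J := hy
      obtain ⟨β, hβ, hβy⟩ := hJh _ hy'
      have hD : div (y / σ y) = 1 := by
        rw [map_div, hcomm, hJτ _ hy', div_self']
      obtain ⟨j, rfl⟩ := hh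
      have hσD : twistDiv σ (y * σ y) = 1 := by
        change y * σ y / σ (y * σ y) = 1
        rw [map_mul, hσ, mul_comm, div_self']
      have hσβ : twistDiv σ β = 1 := by
        change β / σ β = 1
        rw [hβ, div_self']
      refine ⟨y ^ (2 * j + 1) / β / (y / σ y) ^ j, ?_, ?_⟩
      · change div _ = 1
        rw [map_div, map_div, map_pow, map_pow, hβy, hD]
        simp
      · have : y ^ (2 * j + 1) = y * (y * σ y) ^ j * (y / σ y) ^ j := by
          rw [mul_assoc, ← mul_pow, mul_div_assoc', mul_right_comm, mul_div_assoc, div_self',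
            mul_one, ← sq, ← pow_mul, pow_succ, mul_comm]
        rw [this, map_div, map_div, map_mul, map_mul, map_pow, hσD, hσβ]
        simp
    · rintro ⟨e, he, hey⟩
      have hey' : e / σ e = y / σ y := hey
      have he' : div e = 1 := he
      have := hfix (y / e) (by
        rw [map_div, div_eq_div_iff_mul_eq_mul]
        rw [div_eq_div_iff_mul_eq_mul] at hey'
        rw [mul_comm, hey', mul_comm])
      rwa [map_div, he', div_one] at this
  rw [e1, e2, ← Subgroup.relIndex_comap, e3, Subgroup.relIndex_comap]

/-- The ambiguous class number formula, for an abstract module `M` with an involution, mapping to a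
group `I` of ideals. -/
theorem card_sq_eq_one_mul_relIndex (hcomm : ∀ x, div (σ x) = τ (div x))
    (hσ : ∀ x, σ (σ x) = x) (hτ : ∀ a, τ (τ a) = a)
    (hN : ∀ a, a * τ a ∈ J) (hJτ : ∀ a ∈ J, τ a = a) (hh : Odd h)
    (hJh : ∀ a ∈ J, ∃ y, σ y = y ∧ div y = a ^ h)
    (hfix : ∀ y, σ y = y → div y ∈ J)
    (h90 : ∀ x, x * σ x = 1 → ∃ y, x = y / σ y)
    (h90I : ∀ a, a * τ a = 1 → ∃ b, a = b / τ b) :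
    Nat.card {c : I ⧸ div.range // c ^ 2 = 1} *
        (div.ker.map (twistDiv σ)).relIndex (div.ker ⊓ (twistMul σ).ker) =
      (div.ker.map (twistMul σ)).relIndex (div.ker ⊓ (twistMul σ).range) *
        J.relIndex (twistDiv τ).ker := by
  have hJF : J ≤ (twistDiv τ).ker := fun a ha => by
    change a / τ a = 1
    rw [hJτ a ha, div_self']
  have hA : (twistDiv τ).ker ⊔ div.range ≤ div.range.comap (twistDiv τ) := by
    refine sup_le (fun a ha => ?_) ?_
    · rw [Subgroup.mem_comap, MonoidHom.mem_ker.1 ha]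
      exact one_mem _
    · rintro _ ⟨x, rfl⟩
      exact ⟨x / σ x, by rw [map_div, hcomm]; rfl⟩
  rw [relIndex_ambiguous_principal div σ τ J h hcomm hN hJτ hh hJh,
    ← relIndex_ambiguous_fixed div σ τ hcomm hσ hτ h90 h90I,
    ← relIndex_fixed_principal div σ τ J h hcomm hσ hJτ hh hJh hfix h90]
  have s1 : (J ⊔ div.range).relIndex ((twistDiv τ).ker ⊔ div.range)
      = (J ⊔ (div.range ⊓ (twistDiv τ).ker)).relIndex (twistDiv τ).ker := by
    have : (twistDiv τ).ker ⊔ div.range = (twistDiv τ).ker ⊔ (J ⊔ div.range) := by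
      rw [← sup_assoc, sup_eq_left.2 hJF]
    rw [this, Subgroup.relIndex_sup_right, ← Subgroup.inf_relIndex_right, sup_inf_assoc_of_le _ hJF]
  have s2 : J.relIndex (div.range ⊓ (twistDiv τ).ker)
      = J.relIndex (J ⊔ (div.range ⊓ (twistDiv τ).ker)) := by
    rw [sup_comm, Subgroup.relIndex_sup_right]
  have s3 := Subgroup.relIndex_mul_relIndex (J ⊔ div.range) _ _
    (sup_le (hJF.trans le_sup_left) le_sup_right) hA
  have s4 := Subgroup.relIndex_mul_relIndex J (J ⊔ (div.range ⊓ (twistDiv τ).ker))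
    (twistDiv τ).ker le_sup_left (sup_le hJF inf_le_right)
  rw [← s3, s1, s2, ← s4]
  ring

end AmbiguousIndex

section Herbrand

open Module

theorem finrank_eq_zero_of_nsmul_eq_zero {A : Type*} [AddCommGroup A] [Module.Finite ℤ A] {n : ℕ}
    (hn : n ≠ 0) (h : ∀ x : A, n • x = 0) : finrank ℤ A = 0 := by
  rw [Module.finrank_eq_zero_iff_isTorsion]
  intro x
  refine ⟨⟨(n : ℤ), mem_nonZeroDivisors_of_ne_zero (by exact_mod_cast hn)⟩, ?_⟩
  rw [Submonoid.mk_smul, natCast_zsmul, h]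

theorem finrank_eq_of_ker_torsion_of_coker_torsion {A B : Type*} [AddCommGroup A] [AddCommGroup B]
    [Module.Finite ℤ A] [Module.Finite ℤ B] (f : A →+ B) {n : ℕ} (hn : n ≠ 0)
    (hker : ∀ x, f x = 0 → n • x = 0) (hcoker : ∀ y, ∃ x, f x = n • y) :
    finrank ℤ A = finrank ℤ B := by
  set g : A →ₗ[ℤ] B := f.toIntLinearMap
  have h1 := Submodule.finrank_quotient_add_finrank (LinearMap.ker g)
  rw [g.quotKerEquivRange.finrank_eq] at h1
  have h2 := Submodule.finrank_quotient_add_finrank (LinearMap.range g)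
  have h3 : finrank ℤ (LinearMap.ker g) = 0 :=
    finrank_eq_zero_of_nsmul_eq_zero hn fun x => Subtype.ext (hker x x.2)
  have h4 : finrank ℤ (B ⧸ LinearMap.range g) = 0 := by
    refine finrank_eq_zero_of_nsmul_eq_zero hn fun y => ?_
    obtain ⟨y, rfl⟩ := Submodule.mkQ_surjective _ y
    rw [← map_nsmul]
    exact (Submodule.Quotient.mk_eq_zero _).2 (hcoker y)
  omega

theorem finrank_prod_int (A B : Type*) [AddCommGroup A] [AddCommGroup B]
    [Module.Finite ℤ A] [Module.Finite ℤ B] :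
    finrank ℤ (A × B) = finrank ℤ A + finrank ℤ B := by
  have h := Submodule.finrank_quotient_add_finrank (LinearMap.ker (LinearMap.fst ℤ A B))
  rw [((LinearMap.fst ℤ A B).quotKerEquivOfSurjective LinearMap.fst_surjective).finrank_eq,
    ← LinearMap.range_inr] at h
  rw [← h, (LinearEquiv.ofInjective (LinearMap.inr ℤ A B) LinearMap.inr_injective).finrank_eq]

theorem AddSubgroup.index_range_nsmul_eq_pow_mul_card (M : Type*) [AddCommGroup M]
    [Module.Finite ℤ M] {n : ℕ} (hn : n ≠ 0) :
    (nsmulAddMonoidHom n : M →+ M).range.index =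
      n ^ finrank ℤ M * Nat.card (nsmulAddMonoidHom n : M →+ M).ker := by
  set f : M →+ M := nsmulAddMonoidHom n
  set T : AddSubgroup M := (Submodule.torsion ℤ M).toAddSubgroup
  have hT : Finite T := by
    have : Module.Finite ℤ (Submodule.torsion ℤ M) := inferInstance
    exact Module.finite_of_fg_torsion (Submodule.torsion ℤ M) Submodule.torsion_isTorsion
  have memT : ∀ {x : M}, n • x ∈ T → x ∈ T := by
    intro x hx
    obtain ⟨a, ha⟩ := (Submodule.mem_torsion_iff _).1 hx
    refine (Submodule.mem_torsion_iff _).2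
      ⟨⟨(a : ℤ) * n, mul_mem a.2 (mem_nonZeroDivisors_of_ne_zero (by exact_mod_cast hn))⟩, ?_⟩
    rw [Submonoid.mk_smul, mul_smul, natCast_zsmul]
    exact ha
  have hker : f.ker ≤ T := fun x hx => memT (by
    rw [show n • x = 0 from hx]; exact zero_mem _)
  have h1 : (f.range ⊔ T).index = n ^ finrank ℤ M := by
    have hQ : finrank ℤ (M ⧸ Submodule.torsion ℤ M) = finrank ℤ M :=
      finrank_quotient_eq_of_le_torsion le_rfl
    have := AddSubgroup.index_range_nsmul (M ⧸ Submodule.torsion ℤ M) n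
    rw [hQ] at this
    rw [← this]
    set π : M →+ M ⧸ Submodule.torsion ℤ M := (Submodule.mkQ (Submodule.torsion ℤ M)).toAddMonoidHom
    have hπ : Function.Surjective π := Submodule.mkQ_surjective _
    have hmap : f.range.map π = (nsmulAddMonoidHom n).range := by
      ext y
      constructor
      · rintro ⟨_, ⟨x, rfl⟩, rfl⟩
        exact ⟨π x, (map_nsmul π n x).symm⟩
      · rintro ⟨z, rfl⟩
        obtain ⟨x, rfl⟩ := hπ z
        exact ⟨f x, ⟨x, rfl⟩, map_nsmul π n x⟩
    have hk : π.ker = T := by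
      ext x
      exact Submodule.Quotient.mk_eq_zero _
    rw [← hmap, AddSubgroup.index_map, AddMonoidHom.range_eq_top_of_surjective π hπ,
      AddSubgroup.index_top, mul_one, hk]
  have h2 : f.range ⊓ T = T.map f := by
    ext y
    constructor
    · rintro ⟨⟨x, rfl⟩, hy⟩
      exact ⟨x, memT hy, rfl⟩
    · rintro ⟨x, hx, rfl⟩
      exact ⟨⟨x, rfl⟩, T.nsmul_mem hx n⟩
  have h3 : f.range.relIndex T = Nat.card f.ker := by
    rw [← AddSubgroup.inf_relIndex_right, h2]
    have a1 := AddSubgroup.relIndex_mul_relIndex ⊥ (T.map f) T bot_le (h2 ▸ inf_le_right)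
    have a2 := AddSubgroup.relIndex_mul_relIndex ⊥ f.ker T bot_le hker
    rw [AddSubgroup.relIndex_bot_left, AddSubgroup.relIndex_bot_left] at a1 a2
    rw [AddSubgroup.relIndex_ker] at a2
    have hpos : 0 < Nat.card (T.map f) :=
      Nat.card_pos_iff.2 ⟨⟨0⟩, Set.Finite.image f (Set.toFinite _)⟩
    rw [← a2, mul_comm] at a1
    exact Nat.eq_of_mul_eq_mul_right hpos a1
  rw [← AddSubgroup.relIndex_mul_index (le_sup_left : f.range ≤ f.range ⊔ T), h1, sup_comm,
    AddSubgroup.relIndex_sup_right, h3, mul_comm]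

theorem Subgroup.relIndex_map_pow_eq {M : Type*} [CommGroup M] (E : Subgroup M)
    [Module.Finite ℤ (Additive E)] {n : ℕ} (hn : n ≠ 0) :
    (E.map (powMonoidHom n)).relIndex E =
      n ^ finrank ℤ (Additive E) * Nat.card {x : E // x ^ n = 1} := by
  have h := AddSubgroup.index_range_nsmul_eq_pow_mul_card (Additive E) hn
  have e1 : (nsmulAddMonoidHom n : Additive E →+ Additive E).range.index
      = (powMonoidHom n : E →* E).range.index := rfl
  have e2 : Nat.card (nsmulAddMonoidHom n : Additive E →+ Additive E).ker
      = Nat.card {x : E // x ^ n = 1} := rfl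
  rw [e1, e2] at h
  rw [← h, Subgroup.relIndex]
  congr 1
  ext x
  constructor
  · rintro ⟨y, hy, hyx⟩
    exact ⟨⟨y, hy⟩, Subtype.ext hyx⟩
  · rintro ⟨y, rfl⟩
    exact ⟨y, y.2, rfl⟩

variable {M : Type*} [CommGroup M] (σ : M →* M) (E : Subgroup M)

theorem relIndex_map_twistMul_mul (hσ : ∀ x, σ (σ x) = x) (hE : ∀ x ∈ E, σ x ∈ E) :
    ((E ⊓ (twistDiv σ).ker) ⊔ (E ⊓ (twistMul σ).ker)).relIndex E *
        (E.map (twistMul σ)).relIndex (E ⊓ (twistDiv σ).ker) =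
      ((E ⊓ (twistDiv σ).ker).map (powMonoidHom 2)).relIndex (E ⊓ (twistDiv σ).ker) := by
  set P := E ⊓ (twistDiv σ).ker
  set Q := E ⊓ (twistMul σ).ker
  have hPσ : ∀ x ∈ P, σ x = x := fun x hx => by
    have : x / σ x = 1 := hx.2
    exact (div_eq_one.1 this).symm
  have e1 : P.map (powMonoidHom 2) = (P ⊔ Q).map (twistMul σ) := by
    ext y
    constructor
    · rintro ⟨x, hx, rfl⟩
      refine ⟨x, Subgroup.mem_sup_left hx, ?_⟩
      change x * σ x = x ^ 2
      rw [hPσ x hx, sq]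
    · rintro ⟨x, hx, rfl⟩
      obtain ⟨a, ha, b, hb, rfl⟩ := Subgroup.mem_sup.1 hx
      refine ⟨a, ha, ?_⟩
      rw [map_mul, MonoidHom.mem_ker.1 hb.2, mul_one]
      change a ^ 2 = a * σ a
      rw [hPσ a ha, sq]
  have e2 : E.map (twistMul σ) ≤ P := by
    rintro _ ⟨x, hx, rfl⟩
    refine ⟨E.mul_mem hx (hE x hx), ?_⟩
    change x * σ x / σ (x * σ x) = 1
    rw [map_mul, hσ, mul_comm, div_self']
  have e3 : ((P ⊔ Q).map (twistMul σ)).relIndex (E.map (twistMul σ)) = (P ⊔ Q).relIndex E := by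
    rw [← Subgroup.relIndex_comap, Subgroup.comap_map_eq, ← Subgroup.inf_relIndex_right,
      sup_inf_assoc_of_le _ (sup_le inf_le_left inf_le_left : P ⊔ Q ≤ E), inf_comm, sup_assoc]
    congr 1
    rw [sup_idem]
  have := Subgroup.relIndex_mul_relIndex ((P ⊔ Q).map (twistMul σ)) (E.map (twistMul σ)) P
    (Subgroup.map_mono (sup_le inf_le_left inf_le_left)) e2
  rw [e1, ← this, e3]

theorem relIndex_map_twistDiv_mul (hσ : ∀ x, σ (σ x) = x) (hE : ∀ x ∈ E, σ x ∈ E) :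
    ((E ⊓ (twistDiv σ).ker) ⊔ (E ⊓ (twistMul σ).ker)).relIndex E *
        (E.map (twistDiv σ)).relIndex (E ⊓ (twistMul σ).ker) =
      ((E ⊓ (twistMul σ).ker).map (powMonoidHom 2)).relIndex (E ⊓ (twistMul σ).ker) := by
  have key := relIndex_map_twistMul_mul (invMonoidHom.comp σ) E (by simp [hσ])
    (fun x hx => inv_mem (hE x hx))
  have h1 : twistMul (invMonoidHom.comp σ) = twistDiv σ := by
    ext x
    exact (div_eq_mul_inv x (σ x)).symm
  have h2 : twistDiv (invMonoidHom.comp σ) = twistMul σ := by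
    ext x
    exact div_inv_eq_mul x (σ x)
  rw [h1, h2] at key
  rwa [sup_comm]

theorem finite_additive_of_le {E F : Subgroup M} [Module.Finite ℤ (Additive E)] (h : F ≤ E) :
    Module.Finite ℤ (Additive F) :=
  Module.Finite.of_injective (Subgroup.inclusion h).toAdditive.toIntLinearMap
    (Subgroup.inclusion_injective h)

/-- Rank computation behind the Herbrand quotient of a finitely generated group with involution. -/
theorem finrank_fixed_add_finrank_antifixed [Module.Finite ℤ (Additive E)]
    (hσ : ∀ x, σ (σ x) = x) (hE : ∀ x ∈ E, σ x ∈ E) :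
    finrank ℤ (Additive ↥(E ⊓ (twistDiv σ).ker)) + finrank ℤ (Additive ↥(E ⊓ (twistMul σ).ker)) =
      finrank ℤ (Additive E) := by
  have i1 : Module.Finite ℤ (Additive ↥(E ⊓ (twistDiv σ).ker)) := finite_additive_of_le inf_le_left
  have i2 : Module.Finite ℤ (Additive ↥(E ⊓ (twistMul σ).ker)) := finite_additive_of_le inf_le_left
  rw [← finrank_prod_int]
  let f : Additive ↥(E ⊓ (twistDiv σ).ker) × Additive ↥(E ⊓ (twistMul σ).ker) →+ Additive E :=
    AddMonoidHom.coprod (Subgroup.inclusion inf_le_left).toAdditive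
      (Subgroup.inclusion inf_le_left).toAdditive
  refine finrank_eq_of_ker_torsion_of_coker_torsion f two_ne_zero ?_ ?_
  · rintro ⟨⟨a, ha, ha'⟩, ⟨b, hb, hb'⟩⟩ hab
    have hab : a * b = 1 := congrArg Subtype.val hab
    have ha' : a / σ a = 1 := ha'
    have hb' : b * σ b = 1 := hb'
    have h1 : σ a * σ b = 1 := by rw [← map_mul, hab, map_one]
    have h2 : σ a = a := (div_eq_one.1 ha').symm
    have h3 : σ b = b := by
      rw [h2] at h1
      exact mul_left_cancel (h1.trans hab.symm)
    refine Prod.ext (Subtype.ext ?_) (Subtype.ext ?_)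
    · have : b ^ 2 = 1 := by rw [sq]; nth_rw 2 [← h3]; exact hb'
      change a ^ 2 = 1
      rw [← mul_one (a ^ 2), ← this, ← mul_pow, hab, one_pow, this]
    · change b ^ 2 = 1
      rw [sq]; nth_rw 2 [← h3]; exact hb'
  · rintro ⟨y, hy⟩
    refine ⟨⟨⟨y * σ y, E.mul_mem hy (hE y hy), ?_⟩, ⟨y / σ y, E.div_mem hy (hE y hy), ?_⟩⟩, ?_⟩
    · change y * σ y / σ (y * σ y) = 1
      rw [map_mul, hσ, mul_comm, div_self']
    · change y / σ y * σ (y / σ y) = 1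
      rw [map_div, hσ]
      simp
    · apply Subtype.ext
      change y * σ y * (y / σ y) = y ^ 2
      rw [mul_div_assoc', mul_right_comm, mul_div_assoc, div_self', mul_one, sq]

theorem two_mul_relIndex_map_twistMul [Module.Finite ℤ (Additive E)]
    (hσ : ∀ x, σ (σ x) = x) (hE : ∀ x ∈ E, σ x ∈ E) {c : ℕ} (hc : c ≠ 0)
    (h1 : Nat.card {x : ↥(E ⊓ (twistDiv σ).ker) // x ^ 2 = 1} = c)
    (h2 : Nat.card {x : ↥(E ⊓ (twistMul σ).ker) // x ^ 2 = 1} = c)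
    (hrank : finrank ℤ (Additive E) =
      2 * finrank ℤ (Additive ↥(E ⊓ (twistDiv σ).ker)) + 1) :
    (E.map (twistMul σ)).relIndex (E ⊓ (twistDiv σ).ker) * 2 =
      (E.map (twistDiv σ)).relIndex (E ⊓ (twistMul σ).ker) ∧
    (E.map (twistMul σ)).relIndex (E ⊓ (twistDiv σ).ker) ≠ 0 := by
  have i1 : Module.Finite ℤ (Additive ↥(E ⊓ (twistDiv σ).ker)) := finite_additive_of_le inf_le_left
  have i2 : Module.Finite ℤ (Additive ↥(E ⊓ (twistMul σ).ker)) := finite_additive_of_le inf_le_left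
  have e1 := relIndex_map_twistMul_mul σ E hσ hE
  have e2 := relIndex_map_twistDiv_mul σ E hσ hE
  rw [Subgroup.relIndex_map_pow_eq _ two_ne_zero, h1] at e1
  rw [Subgroup.relIndex_map_pow_eq _ two_ne_zero, h2] at e2
  have hr : finrank ℤ (Additive ↥(E ⊓ (twistMul σ).ker)) =
      finrank ℤ (Additive ↥(E ⊓ (twistDiv σ).ker)) + 1 := by
    have := finrank_fixed_add_finrank_antifixed σ E hσ hE
    omega
  rw [hr, pow_succ] at e2
  set i := ((E ⊓ (twistDiv σ).ker) ⊔ (E ⊓ (twistMul σ).ker)).relIndex E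
  have hne : i * (E.map (twistMul σ)).relIndex (E ⊓ (twistDiv σ).ker) ≠ 0 := by
    rw [e1]; positivity
  refine ⟨?_, right_ne_zero_of_mul hne⟩
  apply Nat.eq_of_mul_eq_mul_left (Nat.pos_of_ne_zero (left_ne_zero_of_mul hne))
  rw [← mul_assoc, e1, e2]
  ring

theorem card_sq_eq_one_mul_relIndex_mul_two {I : Type*} [CommGroup I]
    (div : M →* I) (τ : I →* I) (J : Subgroup I) (h : ℕ)
    (hcomm : ∀ x, div (σ x) = τ (div x))
    (hσ : ∀ x, σ (σ x) = x) (hτ : ∀ a, τ (τ a) = a)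
    (hN : ∀ a, a * τ a ∈ J) (hJτ : ∀ a ∈ J, τ a = a) (hh : Odd h)
    (hJh : ∀ a ∈ J, ∃ y, σ y = y ∧ div y = a ^ h)
    (hfix : ∀ y, σ y = y → div y ∈ J)
    (h90 : ∀ x, x * σ x = 1 → ∃ y, x = y / σ y)
    (h90I : ∀ a, a * τ a = 1 → ∃ b, a = b / τ b)
    [Module.Finite ℤ (Additive div.ker)] {c : ℕ} (hc : c ≠ 0)
    (h1 : Nat.card {x : ↥(div.ker ⊓ (twistDiv σ).ker) // x ^ 2 = 1} = c)
    (h2 : Nat.card {x : ↥(div.ker ⊓ (twistMul σ).ker) // x ^ 2 = 1} = c)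
    (hrank : finrank ℤ (Additive div.ker) =
      2 * finrank ℤ (Additive ↥(div.ker ⊓ (twistDiv σ).ker)) + 1) :
    Nat.card {c : I ⧸ div.range // c ^ 2 = 1} *
        (twistMul σ).range.relIndex (div.ker ⊓ (twistDiv σ).ker) * 2 =
      J.relIndex (twistDiv τ).ker := by
  have hE : ∀ x ∈ div.ker, σ x ∈ div.ker := fun x hx => by
    rw [MonoidHom.mem_ker, hcomm, MonoidHom.mem_ker.1 hx, map_one]
  obtain ⟨g1, g2⟩ := two_mul_relIndex_map_twistMul σ div.ker hσ hE hc h1 h2 hrank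
  have key := card_sq_eq_one_mul_relIndex div σ τ J h hcomm hσ hτ hN hJτ hh hJh hfix h90 h90I
  have hNfix : (twistMul σ).range ≤ (twistDiv σ).ker := by
    rintro _ ⟨x, rfl⟩
    change x * σ x / σ (x * σ x) = 1
    rw [map_mul, hσ, mul_comm, div_self']
  have tower := Subgroup.relIndex_mul_relIndex (div.ker.map (twistMul σ))
    (div.ker ⊓ (twistMul σ).range) (div.ker ⊓ (twistDiv σ).ker)
    (le_inf (by rintro _ ⟨x, hx, rfl⟩; exact mul_mem hx (hE x hx)) (Subgroup.map_le_range _ _))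
    (inf_le_inf_left _ hNfix)
  have e : (div.ker ⊓ (twistMul σ).range).relIndex (div.ker ⊓ (twistDiv σ).ker)
      = (twistMul σ).range.relIndex (div.ker ⊓ (twistDiv σ).ker) := by
    rw [← Subgroup.inf_relIndex_right, ← Subgroup.inf_relIndex_right (twistMul σ).range]
    congr 1
    rw [inf_inf_distrib_left, inf_comm div.ker, ← inf_assoc]
    ext x
    simp only [Subgroup.mem_inf]
    tauto
  rw [e] at tower
  rw [← g1] at key
  apply Nat.eq_of_mul_eq_mul_right (Nat.pos_of_ne_zero g2)
  calc _ = Nat.card {c : I ⧸ div.range // c ^ 2 = 1} *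
        ((div.ker.map (twistMul σ)).relIndex (div.ker ⊓ (twistDiv σ).ker) * 2) *
        (twistMul σ).range.relIndex (div.ker ⊓ (twistDiv σ).ker) := by ring
    _ = _ := by rw [key, ← tower]; ring

end Herbrand

section QuadraticAut

open Module

variable {k K : Type*} [Field k] [Field K] [Algebra k K] [IsGalois k K]

theorem AlgEquiv.eq_one_or_eq_of_finrank_two (hdeg : finrank k K = 2) {σ : K ≃ₐ[k] K}
    (hσ : σ ≠ 1) (g : K ≃ₐ[k] K) : g = 1 ∨ g = σ := by
  have : FiniteDimensional k K := FiniteDimensional.of_finrank_pos (by lia)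
  have hc : Nat.card (K ≃ₐ[k] K) = 2 := by rw [IsGalois.card_aut_eq_finrank, hdeg]
  classical
  by_contra! h
  have h3 : ({1, σ, g} : Finset (K ≃ₐ[k] K)).card ≤ 2 := by
    rw [← hc, Nat.card_eq_fintype_card]
    exact Finset.card_le_univ _
  rw [Finset.card_eq_three.2 ⟨1, σ, g, hσ.symm, h.1.symm, h.2.symm, rfl⟩] at h3
  lia

theorem AlgEquiv.apply_apply_of_finrank_two (hdeg : finrank k K = 2) {σ : K ≃ₐ[k] K}
    (hσ : σ ≠ 1) (x : K) : σ (σ x) = x := by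
  rcases AlgEquiv.eq_one_or_eq_of_finrank_two hdeg hσ (σ * σ) with h | h
  · exact congr($h x)
  · exact absurd (mul_left_cancel (h.trans (mul_one σ).symm)) hσ

theorem AlgEquiv.exists_algebraMap_eq_of_apply_eq (hdeg : finrank k K = 2) {σ : K ≃ₐ[k] K}
    (hσ : σ ≠ 1) {x : K} (hx : σ x = x) : ∃ y : k, algebraMap k K y = x := by
  have : FiniteDimensional k K := FiniteDimensional.of_finrank_pos (by lia)
  have h : x ∈ (⊥ : IntermediateField k K) := by
    rw [IsGalois.mem_bot_iff_fixed]
    intro g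
    rcases AlgEquiv.eq_one_or_eq_of_finrank_two hdeg hσ g with rfl | rfl
    · rfl
    · exact hx
  exact IntermediateField.mem_bot.1 h

theorem AlgEquiv.algebraMap_norm_of_finrank_two (hdeg : finrank k K = 2) {σ : K ≃ₐ[k] K}
    (hσ : σ ≠ 1) (x : K) : algebraMap k K (Algebra.norm k x) = x * σ x := by
  have : FiniteDimensional k K := FiniteDimensional.of_finrank_pos (by lia)
  classical
  rw [Algebra.norm_eq_prod_automorphisms]
  have : (Finset.univ : Finset (K ≃ₐ[k] K)) = {1, σ} := by
    ext g
    simpa using AlgEquiv.eq_one_or_eq_of_finrank_two hdeg hσ g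
  rw [this, Finset.prod_pair hσ.symm, AlgEquiv.one_apply]

theorem AlgEquiv.exists_eq_div_of_mul_apply_eq_one (hdeg : finrank k K = 2) {σ : K ≃ₐ[k] K}
    (hσ : σ ≠ 1) {x : K} (hx : x * σ x = 1) : ∃ y : K, y ≠ 0 ∧ x = y / σ y := by
  have hss := AlgEquiv.apply_apply_of_finrank_two hdeg hσ
  by_cases h : 1 + x = 0
  · obtain ⟨z, hz⟩ : ∃ z, σ z ≠ z := by
      by_contra! hz
      exact hσ (AlgEquiv.ext hz)
    have hz' : σ z - z ≠ 0 := sub_ne_zero.2 hz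
    have hz'' : z - σ z ≠ 0 := sub_ne_zero.2 hz.symm
    refine ⟨z - σ z, hz'', ?_⟩
    rw [map_sub, hss, eq_div_iff hz', eq_neg_of_add_eq_zero_right h]
    ring
  · refine ⟨1 + x, h, ?_⟩
    have h' : σ (1 + x) ≠ 0 := (map_ne_zero σ).2 h
    rw [eq_div_iff h', map_add, map_one, mul_add, hx]
    ring

end QuadraticAut

section QuadraticIdeal

open Module Ideal

variable {k K : Type*} [Field k] [Field K] [NumberField k] [NumberField K] [Algebra k K]

/-- The automorphism of `𝓞 K` induced by an automorphism of `K` over `k`. -/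
noncomputable abbrev intAut (σ : K ≃ₐ[k] K) : 𝓞 K ≃ₐ[𝓞 k] 𝓞 K :=
  RingOfIntegers.mapAlgEquiv σ

theorem intAut_intAut [IsGalois k K] (hdeg : finrank k K = 2) {σ : K ≃ₐ[k] K} (hσ : σ ≠ 1)
    (x : 𝓞 K) : intAut σ (intAut σ x) = x := by
  ext
  exact AlgEquiv.apply_apply_of_finrank_two hdeg hσ x

theorem exists_algebraMap_eq_of_intAut_eq [IsGalois k K] (hdeg : finrank k K = 2)
    {σ : K ≃ₐ[k] K} (hσ : σ ≠ 1) {x : 𝓞 K} (hx : intAut σ x = x) :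
    ∃ y : 𝓞 k, algebraMap (𝓞 k) (𝓞 K) y = x := by
  obtain ⟨y, hy⟩ := AlgEquiv.exists_algebraMap_eq_of_apply_eq hdeg hσ (x := (x : K))
    congr(($hx : K))
  have hyi : IsIntegral ℤ y := by
    rw [← isIntegral_algebraMap_iff (FaithfulSMul.algebraMap_injective k K), hy]
    exact x.isIntegral_coe
  refine ⟨⟨y, hyi⟩, ?_⟩
  ext
  exact hy

theorem exists_prime_mul_of_finrank_two (hdeg : finrank k K = 2) (P : Ideal (𝓞 K)) [P.IsPrime]
    (hP : P ≠ ⊥) : P = (P.under (𝓞 k)).map (algebraMap (𝓞 k) (𝓞 K)) ∨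
      ∃ Q : Ideal (𝓞 K), Q.IsPrime ∧ Q.under (𝓞 k) = P.under (𝓞 k) ∧
        P * Q = (P.under (𝓞 k)).map (algebraMap (𝓞 k) (𝓞 K)) := by
  have hPm : P.IsMaximal := Ring.DimensionLEOne.maximalOfPrime hP inferInstance
  set p := P.under (𝓞 k) with hp
  have hp0 : p ≠ ⊥ := mt (Ideal.eq_bot_of_comap_eq_bot (I := P)) hP
  have hpm : p.IsMaximal := Ideal.isMaximal_comap_of_isIntegral_of_isMaximal P
  have hpp : _root_.Prime p := Ideal.prime_of_isPrime hp0 inferInstance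
  have key (Q : Ideal (𝓞 K)) (hQ : Q.IsMaximal) (hQp : Q.under (𝓞 k) = p) :
      p ∣ relNorm (𝓞 k) Q := by
    have : Q.LiesOver p := ⟨hQp.symm⟩
    obtain ⟨s, hs⟩ := exists_relNorm_eq_pow_of_isPrime Q p
    rw [hs]
    refine dvd_pow_self _ ?_
    rintro rfl
    have := relNorm_le_comap (R := 𝓞 k) Q
    rw [hs, pow_zero, Ideal.one_eq_top] at this
    exact hpm.ne_top (hQp ▸ top_le_iff.1 this)
  have hN : relNorm (𝓞 k) (p.map (algebraMap (𝓞 k) (𝓞 K))) = p ^ 2 := by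
    rw [relNorm_algebraMap (𝓞 K) p]
    congr 1
    rw [← hdeg, ← IsFractionRing.finrank_eq (𝓞 k) k (𝓞 K) K]
  obtain ⟨Q, hQ⟩ : P ∣ p.map (algebraMap (𝓞 k) (𝓞 K)) :=
    Ideal.dvd_iff_le.2 (Ideal.map_le_iff_le_comap.2 le_rfl)
  rcases eq_or_ne Q ⊤ with rfl | hQt
  · left
    rw [hQ, Ideal.mul_top]
  right
  obtain ⟨M, hM, hQM⟩ := Ideal.exists_le_maximal Q hQt
  obtain ⟨R, rfl⟩ := Ideal.dvd_iff_le.2 hQM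
  have hMp : M.under (𝓞 k) = p := by
    refine (hpm.eq_of_le (Ideal.comap_ne_top _ hM.ne_top) ?_).symm
    rw [← Ideal.map_le_iff_le_comap, hQ]
    exact Ideal.mul_le_right.trans hQM
  have h1 := congrArg (relNorm (𝓞 k)) hQ
  obtain ⟨a, ha⟩ := key P hPm rfl
  obtain ⟨b, hb⟩ := key M hM hMp
  rw [hN, map_mul, map_mul, ha, hb] at h1
  have h2 : a * b * relNorm (𝓞 k) R = 1 := by
    refine mul_left_cancel₀ (pow_ne_zero 2 hp0) ?_
    rw [mul_one]
    conv_rhs => rw [h1]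
    ring
  have hR : relNorm (𝓞 k) R = 1 := by
    rw [mul_comm] at h2
    exact Ideal.isUnit_iff.1 (IsUnit.of_mul_eq_one _ h2) |>.trans Ideal.one_eq_top.symm
  have hR1 : R = ⊤ := by
    have h3 := relNorm_le_comap (R := 𝓞 k) R
    rw [hR, Ideal.one_eq_top, top_le_iff, Ideal.comap_eq_top_iff] at h3
    exact h3
  refine ⟨M, hM.isPrime, hMp, ?_⟩
  rw [hQ, hR1, Ideal.mul_top]

theorem exists_map_eq_or_mul_intAut_eq (hdeg : finrank k K = 2) {σ : K ≃ₐ[k] K} [IsGalois k K]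
    (hσ : σ ≠ 1) (P : Ideal (𝓞 K)) [P.IsPrime] (hP : P ≠ ⊥) :
    P = (P.under (𝓞 k)).map (algebraMap (𝓞 k) (𝓞 K)) ∨
      P * P.map (intAut σ) = (P.under (𝓞 k)).map (algebraMap (𝓞 k) (𝓞 K)) := by
  rcases exists_prime_mul_of_finrank_two hdeg P hP with h | ⟨Q, hQ, hQp, h⟩
  · exact Or.inl h
  right
  set p := P.under (𝓞 k) with hp
  have hp0 : p ≠ ⊥ := mt (Ideal.eq_bot_of_comap_eq_bot (I := P)) hP
  have hPm : P.IsMaximal := Ring.DimensionLEOne.maximalOfPrime hP inferInstance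
  have hQ0 : Q ≠ ⊥ := by
    rintro rfl
    apply hp0
    rw [← hQp]
    exact Ideal.comap_bot_of_injective _ (FaithfulSMul.algebraMap_injective _ _)
  have hQm : Q.IsMaximal := Ring.DimensionLEOne.maximalOfPrime hQ0 hQ
  have hσm : (P.map (intAut σ)).IsMaximal := Ideal.map_isMaximal_of_equiv (intAut σ)
  have hle : P * Q ≤ P.map (intAut σ) := by
    rw [h, hp, Ideal.map_le_iff_le_comap]
    intro x hx
    have := Ideal.mem_map_of_mem (intAut σ) (Ideal.mem_comap.1 hx)
    rwa [AlgEquiv.commutes] at this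
  rcases (Ideal.IsPrime.mul_le hσm.isPrime).1 hle with h1 | h1
  swap
  · rw [← hQm.eq_of_le hσm.ne_top h1, h]
  have h2 := hPm.eq_of_le hσm.ne_top h1
  rw [← h2]
  by_cases hPQ : P = Q
  · nth_rewrite 2 [hPQ]
    exact h
  exfalso
  obtain ⟨x, hxQ, hxP⟩ : ∃ x ∈ Q, x ∉ P := by
    by_contra! hc
    exact hPQ (hQm.eq_of_le hPm.ne_top hc).symm
  obtain ⟨y, hy⟩ := exists_algebraMap_eq_of_intAut_eq hdeg hσ (x := x * intAut σ x) (by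
    rw [map_mul, intAut_intAut hdeg hσ, mul_comm])
  have hyp : y ∈ p := by
    rw [← hQp, Ideal.mem_comap, hy]
    exact Q.mul_mem_right _ hxQ
  rw [hp, Ideal.mem_comap, hy] at hyp
  rcases Ideal.IsPrime.mem_or_mem inferInstance hyp with h3 | h3
  · exact hxP h3
  · rw [h2] at h3
    obtain ⟨z, hz, hzx⟩ := (Ideal.mem_map_of_equiv (intAut σ) _).1 h3
    exact hxP ((intAut σ).injective hzx ▸ hz)

end QuadraticIdeal

section FractionalIdealAction

open Module FractionalIdeal
open scoped nonZeroDivisors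

variable {k K : Type*} [Field k] [Field K] [NumberField k] [NumberField K] [Algebra k K]

theorem intAut_nonZeroDivisors_le (σ : K ≃ₐ[k] K) :
    (𝓞 K)⁰ ≤ (𝓞 K)⁰.comap (intAut σ : 𝓞 K →+* 𝓞 K) :=
  nonZeroDivisors_le_comap_nonZeroDivisors_of_injective _ (intAut σ).injective

/-- The action of an automorphism on the group of fractional ideals. -/
noncomputable def idealAut (σ : K ≃ₐ[k] K) :
    (FractionalIdeal (𝓞 K)⁰ K)ˣ →* (FractionalIdeal (𝓞 K)⁰ K)ˣ :=
  Units.map (extendedHom' (M := (𝓞 K)⁰) (N := (𝓞 K)⁰) K (f := (intAut σ : 𝓞 K →+* 𝓞 K))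
    (intAut_nonZeroDivisors_le σ)).toMonoidHom

variable (k K) in
/-- Extension of fractional ideals from `k` to `K`. -/
noncomputable def idealExt : (FractionalIdeal (𝓞 k)⁰ k)ˣ →* (FractionalIdeal (𝓞 K)⁰ K)ˣ :=
  Units.map (extendedHom K (𝓞 K)).toMonoidHom

theorem coe_idealAut (σ : K ≃ₐ[k] K) (a : (FractionalIdeal (𝓞 K)⁰ K)ˣ) :
    (idealAut σ a : FractionalIdeal (𝓞 K)⁰ K) = (a : FractionalIdeal (𝓞 K)⁰ K).extended K
      (intAut_nonZeroDivisors_le σ) :=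
  rfl

theorem coe_idealExt (a : (FractionalIdeal (𝓞 k)⁰ k)ˣ) :
    (idealExt k K a : FractionalIdeal (𝓞 K)⁰ K) =
      (a : FractionalIdeal (𝓞 k)⁰ k).extendedHom K (𝓞 K) :=
  rfl

theorem idealAut_toPrincipalIdeal (σ : K ≃ₐ[k] K) (x : Kˣ) :
    toPrincipalIdeal (𝓞 K) K (Units.map (σ : K →* K) x) =
      idealAut σ (toPrincipalIdeal (𝓞 K) K x) := by
  ext1
  rw [coe_idealAut, coe_toPrincipalIdeal, coe_toPrincipalIdeal, extended_spanSingleton]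
  congr 1
  have : (σ : K →+* K) = IsLocalization.map (S := K) K ((intAut σ : 𝓞 K →+* 𝓞 K))
      (intAut_nonZeroDivisors_le σ) := by
    refine IsLocalization.ringHom_ext (𝓞 K)⁰ ?_
    ext x
    rw [RingHom.comp_apply, RingHom.comp_apply, IsLocalization.map_eq]
    rfl
  exact congr($this x)

theorem idealExt_toPrincipalIdeal (x : kˣ) :
    idealExt k K (toPrincipalIdeal (𝓞 k) k x) =
      toPrincipalIdeal (𝓞 K) K (Units.map (algebraMap k K : k →* K) x) := by
  ext1
  rw [coe_idealExt, coe_toPrincipalIdeal, coe_toPrincipalIdeal, extendedHom_spanSingleton]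
  congr 1
  have : algebraMap k K = IsFractionRing.map (K := k) (L := K)
      (FaithfulSMul.algebraMap_injective (𝓞 k) (𝓞 K)) := by
    refine IsLocalization.ringHom_ext (𝓞 k)⁰ ?_
    ext x
    rw [RingHom.comp_apply, RingHom.comp_apply, IsFractionRing.map, IsLocalization.map_eq]
    rfl
  exact congr($this.symm x)

/-- A nonzero ideal as an element of the group of fractional ideals. -/
noncomputable def unitIdeal (I : Ideal (𝓞 K)) (hI : I ≠ ⊥) : (FractionalIdeal (𝓞 K)⁰ K)ˣ :=
  Units.mk0 (I : FractionalIdeal (𝓞 K)⁰ K) (coeIdeal_ne_zero.2 hI)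

theorem idealAut_unitIdeal (σ : K ≃ₐ[k] K) (I : Ideal (𝓞 K)) (hI : I ≠ ⊥) :
    idealAut σ (unitIdeal I hI) = unitIdeal (I.map (intAut σ))
      (fun h => hI ((Ideal.map_eq_bot_iff_of_injective (intAut σ).injective).1 h)) := by
  ext1
  rw [coe_idealAut]
  exact extended_coeIdeal_eq_map _ _ _

theorem idealExt_unitIdeal (I : Ideal (𝓞 k)) (hI : I ≠ ⊥) :
    idealExt k K (unitIdeal I hI) = unitIdeal (I.map (algebraMap (𝓞 k) (𝓞 K)))
      (fun h => hI ((Ideal.map_eq_bot_iff_of_injective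
        (FaithfulSMul.algebraMap_injective _ _)).1 h)) := by
  ext1
  rw [coe_idealExt]
  exact extendedHom_coeIdeal_eq_map _ _ _

theorem unitIdeal_mul (I J : Ideal (𝓞 K)) (hI : I ≠ ⊥) (hJ : J ≠ ⊥) :
    unitIdeal (I * J) (mul_ne_zero hI hJ) = unitIdeal I hI * unitIdeal J hJ := by
  ext1
  simp [unitIdeal]

theorem exists_eq_unitIdeal_div (a : (FractionalIdeal (𝓞 K)⁰ K)ˣ) :
    ∃ (x : 𝓞 k) (hx : algebraMap k K x ≠ 0) (I : Ideal (𝓞 K)) (hI : I ≠ ⊥),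
      a = unitIdeal I hI / toPrincipalIdeal (𝓞 K) K (Units.mk0 (algebraMap k K x) hx) := by
  obtain ⟨x, I, hx, h⟩ := exists_eq_spanSingleton_mul (a : FractionalIdeal (𝓞 K)⁰ K)
  have h1 : (Ideal.span {x}).comap (algebraMap (𝓞 k) (𝓞 K)) ≠ ⊥ :=
    Ideal.comap_ne_bot_of_integral_mem hx (Ideal.mem_span_singleton_self x)
      (Algebra.IsIntegral.isIntegral x)
  obtain ⟨y, hy, hy0⟩ := Submodule.exists_mem_ne_zero_of_ne_bot h1
  obtain ⟨z, hz⟩ := Ideal.mem_span_singleton.1 (Ideal.mem_comap.1 hy)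
  have hxK : (x : K) ≠ 0 := by simpa using hx
  have hyK : algebraMap k K y ≠ 0 := by simpa using hy0
  have hzy : algebraMap k K y = x * z := congr(($hz : K))
  have hz0 : z ≠ 0 := by
    rintro rfl
    simp [hzy] at hyK
  have hI : I ≠ ⊥ := by
    rintro rfl
    simp at h
  refine ⟨y, hyK, Ideal.span {z} * I, mul_ne_zero (by simpa using hz0) hI, ?_⟩
  rw [eq_div_iff_mul_eq']
  ext1
  rw [Units.val_mul, coe_toPrincipalIdeal, h, Units.val_mk0, unitIdeal, Units.val_mk0,
    coeIdeal_mul, coeIdeal_span_singleton, mul_right_comm, spanSingleton_mul_spanSingleton, hzy,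
    inv_mul_cancel_left₀ hxK]

theorem idealAut_idealAut [IsGalois k K] (hdeg : finrank k K = 2) {σ : K ≃ₐ[k] K} (hσ : σ ≠ 1)
    (a : (FractionalIdeal (𝓞 K)⁰ K)ˣ) : idealAut σ (idealAut σ a) = a := by
  obtain ⟨x, hx, I, hI, rfl⟩ := exists_eq_unitIdeal_div (k := k) a
  rw [map_div, map_div, idealAut_unitIdeal, idealAut_unitIdeal, ← idealAut_toPrincipalIdeal,
    ← idealAut_toPrincipalIdeal]
  congr 2
  · have : ((intAut σ : 𝓞 K →+* 𝓞 K).comp (intAut σ : 𝓞 K →+* 𝓞 K)) = RingHom.id (𝓞 K) :=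
      RingHom.ext fun x => intAut_intAut hdeg hσ x
    have h : (I.map (intAut σ : 𝓞 K →+* 𝓞 K)).map (intAut σ : 𝓞 K →+* 𝓞 K) = I := by
      rw [Ideal.map_map, this, Ideal.map_id]
    simp only [← Ideal.map_coe (intAut σ), h]
  · ext1
    exact AlgEquiv.apply_apply_of_finrank_two hdeg hσ _

theorem idealAut_idealExt (σ : K ≃ₐ[k] K) (b : (FractionalIdeal (𝓞 k)⁰ k)ˣ) :
    idealAut σ (idealExt k K b) = idealExt k K b := by
  obtain ⟨x, hx, I, hI, rfl⟩ := exists_eq_unitIdeal_div (k := k) b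
  rw [map_div, map_div, idealExt_unitIdeal, idealAut_unitIdeal, idealExt_toPrincipalIdeal,
    ← idealAut_toPrincipalIdeal]
  congr 2
  · have : ((intAut σ : 𝓞 K →+* 𝓞 K).comp (algebraMap (𝓞 k) (𝓞 K))) = algebraMap (𝓞 k) (𝓞 K) :=
      RingHom.ext fun x => (intAut σ).commutes x
    have h : (I.map (algebraMap (𝓞 k) (𝓞 K))).map (intAut σ : 𝓞 K →+* 𝓞 K) =
        I.map (algebraMap (𝓞 k) (𝓞 K)) := by
      rw [Ideal.map_map, this]
    simp only [← Ideal.map_coe (intAut σ), h]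
  · ext1
    exact σ.commutes _

theorem exists_eq_div_idealAut {σ : K ≃ₐ[k] K} {a : (FractionalIdeal (𝓞 K)⁰ K)ˣ}
    (ha : a * idealAut σ a = 1) :
    ∃ b, a = b / idealAut σ b := by
  have h0 : (1 + a : FractionalIdeal (𝓞 K)⁰ K) ≠ 0 := by
    intro h
    have h1 : (1 : FractionalIdeal (𝓞 K)⁰ K) ≤ 1 + a := by
      rw [← FractionalIdeal.sup_eq_add]
      exact le_sup_left
    rw [h] at h1
    exact one_ne_zero (le_antisymm h1 (FractionalIdeal.zero_le _))
  refine ⟨Units.mk0 _ h0, ?_⟩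
  rw [eq_div_iff_mul_eq']
  ext1
  have ha' : (a : FractionalIdeal (𝓞 K)⁰ K) * (idealAut σ a : FractionalIdeal (𝓞 K)⁰ K) = 1 := by
    rw [← Units.val_mul, ha, Units.val_one]
  have h2 : (idealAut σ (Units.mk0 _ h0) : FractionalIdeal (𝓞 K)⁰ K) =
      1 + (idealAut σ a : FractionalIdeal (𝓞 K)⁰ K) := by
    rw [coe_idealAut, coe_idealAut, Units.val_mk0, extended_add, extended_one]
  rw [Units.val_mul, h2, mul_add, ha', mul_one, Units.val_mk0, add_comm]

theorem mul_idealAut_mem_range [IsGalois k K] (hdeg : finrank k K = 2) {σ : K ≃ₐ[k] K}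
    (hσ : σ ≠ 1) (a : (FractionalIdeal (𝓞 K)⁰ K)ˣ) : a * idealAut σ a ∈ (idealExt k K).range := by
  have key (I : Ideal (𝓞 K)) : ∀ hI : I ≠ ⊥,
      unitIdeal I hI * idealAut σ (unitIdeal I hI) ∈ (idealExt k K).range := by
    induction I using UniqueFactorizationMonoid.induction_on_prime with
    | h₁ => exact fun hI => absurd rfl hI
    | h₂ I hI =>
      intro hI'
      have : unitIdeal I hI' = 1 := by
        ext1
        simp [unitIdeal, Ideal.isUnit_iff.1 hI]
      rw [this, map_one, mul_one]
      exact one_mem _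
    | h₃ I P hI hP ih =>
      intro h
      rw [unitIdeal_mul P I hP.ne_zero hI, map_mul, mul_mul_mul_comm]
      refine mul_mem ?_ (ih hI)
      have := Ideal.isPrime_of_prime hP
      have h0 (p : Ideal (𝓞 k)) (h : p.map (algebraMap (𝓞 k) (𝓞 K)) ≠ ⊥) : p ≠ ⊥ := by
        rintro rfl
        exact h Ideal.map_bot
      rcases exists_map_eq_or_mul_intAut_eq hdeg hσ P hP.ne_zero with hp | hp
      · have h1 := hP.ne_zero
        rw [hp] at h1
        have h2 : unitIdeal P hP.ne_zero = idealExt k K (unitIdeal _ (h0 _ h1)) := by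
          rw [idealExt_unitIdeal]
          congr 1
        rw [h2, idealAut_idealExt]
        exact mul_mem ⟨_, rfl⟩ ⟨_, rfl⟩
      · rw [idealAut_unitIdeal, ← unitIdeal_mul]
        simp_rw [hp]
        have h1 : P * P.map (intAut σ) ≠ ⊥ := mul_ne_zero hP.ne_zero
          (fun h => hP.ne_zero ((Ideal.map_eq_bot_iff_of_injective (intAut σ).injective).1 h))
        rw [hp] at h1
        rw [← idealExt_unitIdeal _ (h0 _ h1)]
        exact ⟨_, rfl⟩
  obtain ⟨x, hx, I, hI, rfl⟩ := exists_eq_unitIdeal_div (k := k) a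
  rw [map_div, div_mul_div_comm]
  refine div_mem (key I hI) ?_
  have : toPrincipalIdeal (𝓞 K) K (Units.mk0 (algebraMap k K x) hx) =
      idealExt k K (toPrincipalIdeal (𝓞 k) k (Units.mk0 x (by rintro h; simp [h] at hx))) := by
    rw [idealExt_toPrincipalIdeal]
    congr 1
    ext1
    rfl
  rw [this, idealAut_idealExt]
  exact mul_mem ⟨_, rfl⟩ ⟨_, rfl⟩

end FractionalIdealAction

section RamifiedCount

open Module FractionalIdeal IsDedekindDomain
open scoped nonZeroDivisors

variable {k K : Type*} [Field k] [Field K] [NumberField k] [NumberField K] [Algebra k K]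

theorem count_coeIdeal_eq_zero (P : HeightOneSpectrum (𝓞 K)) {J : Ideal (𝓞 K)} (hJ : J ≠ ⊥)
    (hJP : ¬ J ≤ P.asIdeal) : count K P (J : FractionalIdeal (𝓞 K)⁰ K) = 0 := by
  classical
  rw [count_coe K P hJ, Nat.cast_eq_zero]
  by_contra h
  exact hJP (Ideal.dvd_iff_le.1 ((Associates.count_ne_zero_iff_dvd hJ P.irreducible).1 h))

variable (k K) in
/-- The primes `P` of `K` with `P ^ 2` extended from the prime of `k` below `P`. -/
def ramifiedPrimes : Set (HeightOneSpectrum (𝓞 K)) :=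
  {P | P.asIdeal ^ 2 = (P.asIdeal.under (𝓞 k)).map (algebraMap (𝓞 k) (𝓞 K))}

theorem map_intAut_of_mem_ramifiedPrimes (σ : K ≃ₐ[k] K) {P : HeightOneSpectrum (𝓞 K)}
    (hP : P ∈ ramifiedPrimes k K) : P.asIdeal.map (intAut σ) = P.asIdeal := by
  have hPm := P.isMaximal
  have hσm : (P.asIdeal.map (intAut σ)).IsMaximal := Ideal.map_isMaximal_of_equiv (intAut σ)
  refine (hPm.eq_of_le hσm.ne_top (hσm.isPrime.le_of_pow_le (n := 2) ?_)).symm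
  rw [hP, Ideal.map_le_iff_le_comap]
  intro x hx
  have := Ideal.mem_map_of_mem (intAut σ) (Ideal.mem_comap.1 hx)
  rwa [AlgEquiv.commutes] at this

/-- The parity of the exponents of a fractional ideal at the ramified primes. -/
noncomputable def ramifiedParity :
    (FractionalIdeal (𝓞 K)⁰ K)ˣ →* Multiplicative (ramifiedPrimes k K → ZMod 2) where
  toFun a := .ofAdd fun P => (count K P.1 (a : FractionalIdeal (𝓞 K)⁰ K) : ZMod 2)
  map_one' := by
    ext P
    simp [count_one]
  map_mul' a b := by
    ext P
    simp [count_mul]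

theorem ramifiedParity_apply (a : (FractionalIdeal (𝓞 K)⁰ K)ˣ) (P : ramifiedPrimes k K) :
    (ramifiedParity a).toAdd P = (count K P.1 (a : FractionalIdeal (𝓞 K)⁰ K) : ZMod 2) :=
  rfl

theorem ramifiedParity_unitIdeal_self (P : ramifiedPrimes k K) [DecidableEq (ramifiedPrimes k K)] :
    ramifiedParity (unitIdeal P.1.asIdeal P.1.ne_bot) = .ofAdd (Pi.single P (1 : ZMod 2)) := by
  classical
  ext Q
  rw [ramifiedParity_apply, unitIdeal, Units.val_mk0, count_maximal, toAdd_ofAdd, Pi.single_apply]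
  simp only [← Subtype.ext_iff, eq_comm (a := Q)]
  split_ifs <;> simp

theorem ramifiedParity_map_prime (p : Ideal (𝓞 k)) [p.IsPrime]
    (h : p.map (algebraMap (𝓞 k) (𝓞 K)) ≠ ⊥) :
    ramifiedParity (k := k) (unitIdeal _ h) = 1 := by
  ext P
  rw [ramifiedParity_apply, unitIdeal, Units.val_mk0, toAdd_one, Pi.zero_apply]
  by_cases hP : P.1.asIdeal.under (𝓞 k) = p
  · have h1 : P.1.asIdeal ^ 2 = (P.1.asIdeal.under (𝓞 k)).map (algebraMap (𝓞 k) (𝓞 K)) := P.2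
    rw [hP] at h1
    rw [← h1, coeIdeal_pow, count_pow_self]
    rfl
  · rw [count_coeIdeal_eq_zero _ h, Int.cast_zero]
    intro hle
    have hp0 : p ≠ ⊥ := by
      rintro rfl
      exact h Ideal.map_bot
    have hpm : p.IsMaximal := Ring.DimensionLEOne.maximalOfPrime hp0 inferInstance
    exact hP (hpm.eq_of_le (Ideal.comap_ne_top _ P.1.isPrime.ne_top)
      (Ideal.map_le_iff_le_comap.1 hle)).symm

theorem ramifiedParity_idealExt (b : (FractionalIdeal (𝓞 k)⁰ k)ˣ) :
    ramifiedParity (k := k) (idealExt k K b) = 1 := by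
  have key (I : Ideal (𝓞 k)) : ∀ hI : I ≠ ⊥,
      ramifiedParity (k := k) (idealExt k K (unitIdeal I hI)) = 1 := by
    induction I using UniqueFactorizationMonoid.induction_on_prime with
    | h₁ => exact fun hI => absurd rfl hI
    | h₂ I hI =>
      intro hI'
      have : unitIdeal I hI' = 1 := by
        ext1
        simp [unitIdeal, Ideal.isUnit_iff.1 hI]
      rw [this, map_one, map_one]
    | h₃ I P hI hP ih =>
      intro h
      have := Ideal.isPrime_of_prime hP
      rw [unitIdeal_mul P I hP.ne_zero hI, map_mul, map_mul, ih hI, idealExt_unitIdeal,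
        ramifiedParity_map_prime, one_mul]
  obtain ⟨x, hx, I, hI, rfl⟩ := exists_eq_unitIdeal_div (k := k) b
  have h2 : toPrincipalIdeal (𝓞 k) k (Units.mk0 (algebraMap k k x) hx) =
      unitIdeal (Ideal.span {x}) (by simpa using hx) := by
    ext1
    rw [coe_toPrincipalIdeal, unitIdeal, Units.val_mk0, Units.val_mk0, coeIdeal_span_singleton]
    rfl
  rw [map_div, map_div, key, h2, key, _root_.div_one]

theorem map_under_dvd_of_map_intAut_eq [IsGalois k K] (hdeg : finrank k K = 2)
    {σ : K ≃ₐ[k] K} (hσ : σ ≠ 1) {I : Ideal (𝓞 K)} (hI : I ≠ ⊥) (hIσ : I.map (intAut σ) = I)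
    (hpar : ramifiedParity (k := k) (unitIdeal I hI) = 1) {P : Ideal (𝓞 K)} (hP : P.IsMaximal)
    (hP0 : P ≠ ⊥) (hPI : I ≤ P) : (P.under (𝓞 k)).map (algebraMap (𝓞 k) (𝓞 K)) ∣ I := by
  have hσm : (P.map (intAut σ)).IsMaximal := Ideal.map_isMaximal_of_equiv (intAut σ)
  rcases exists_map_eq_or_mul_intAut_eq hdeg hσ P hP0 with hp | hp
  · rw [← hp]
    exact Ideal.dvd_iff_le.2 hPI
  have hPσI : I ≤ P.map (intAut σ) := hIσ ▸ Ideal.map_mono hPI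
  rw [← hp]
  by_cases h : P.map (intAut σ) = P
  · let Q : HeightOneSpectrum (𝓞 K) := ⟨P, hP.isPrime, hP0⟩
    have hQ : Q ∈ ramifiedPrimes k K := by
      change P ^ 2 = _
      rw [← hp, h, sq]
    rw [h]
    obtain ⟨J, rfl⟩ := Ideal.dvd_iff_le.2 hPI
    have hJ : J ≠ ⊥ := right_ne_zero_of_mul hI
    have h1 := congr(($hpar).toAdd ⟨Q, hQ⟩)
    refine mul_dvd_mul_left P (Ideal.dvd_iff_le.2 ?_)
    by_contra hJP
    rw [ramifiedParity_apply, unitIdeal, Units.val_mk0, coeIdeal_mul,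
      count_mul K Q (coeIdeal_ne_zero.2 hP0) (coeIdeal_ne_zero.2 hJ),
      count_coeIdeal_eq_zero Q hJ hJP, count_self K Q] at h1
    simp at h1
  · refine Ideal.dvd_iff_le.2 (le_trans (le_inf hPI hPσI) ?_)
    rw [Ideal.mul_eq_inf_of_isCoprime (Ideal.isCoprime_of_isMaximal (Ne.symm h))]

theorem unitIdeal_mem_range_idealExt [IsGalois k K] (hdeg : finrank k K = 2)
    {σ : K ≃ₐ[k] K} (hσ : σ ≠ 1) (I : Ideal (𝓞 K)) (hI : I ≠ ⊥) (hIσ : I.map (intAut σ) = I)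
    (hpar : ramifiedParity (k := k) (unitIdeal I hI) = 1) :
    unitIdeal I hI ∈ (idealExt k K).range := by
  induction I using IsNoetherian.induction with
  | hgt I ih =>
  by_cases hIt : I = ⊤
  · have : unitIdeal I hI = 1 := by
      ext1
      simp [unitIdeal, hIt]
    rw [this]
    exact one_mem _
  obtain ⟨P, hP, hIP⟩ := Ideal.exists_le_maximal I hIt
  have hP0 : P ≠ ⊥ := fun h => hI (le_bot_iff.1 (h ▸ hIP))
  obtain ⟨J, rfl⟩ := map_under_dvd_of_map_intAut_eq hdeg hσ hI hIσ hpar hP hP0 hIP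
  have hJ : J ≠ ⊥ := right_ne_zero_of_mul hI
  have hp : (P.under (𝓞 k)).map (algebraMap (𝓞 k) (𝓞 K)) ≠ ⊥ := left_ne_zero_of_mul hI
  have hp0 : P.under (𝓞 k) ≠ ⊥ := by
    intro h
    rw [h, Ideal.map_bot] at hp
    exact hp rfl
  have hinv := idealAut_idealExt σ (unitIdeal _ hp0)
  rw [idealExt_unitIdeal, idealAut_unitIdeal] at hinv
  have hinv' := congr_arg (fun a : (FractionalIdeal (𝓞 K)⁰ K)ˣ => (a : FractionalIdeal (𝓞 K)⁰ K))
      hinv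
  simp only [unitIdeal, Units.val_mk0, coeIdeal_inj] at hinv'
  rw [unitIdeal_mul _ _ hp hJ] at hpar ⊢
  rw [map_mul, ramifiedParity_map_prime, one_mul] at hpar
  rw [Ideal.map_mul, hinv'] at hIσ
  refine mul_mem ⟨_, idealExt_unitIdeal _ hp0⟩ (ih J ?_ hJ (mul_left_cancel₀ hp hIσ) hpar)
  refine lt_of_le_of_ne Ideal.mul_le_right fun h => ?_
  have h2 : (P.under (𝓞 k)).map (algebraMap (𝓞 k) (𝓞 K)) = 1 :=
    mul_right_cancel₀ hJ (h.trans (one_mul J).symm)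
  refine hP.ne_top (top_le_iff.1 ?_)
  rw [← Ideal.one_eq_top, ← h2, Ideal.map_le_iff_le_comap]

theorem relIndex_range_idealExt [IsGalois k K] (hdeg : finrank k K = 2) {σ : K ≃ₐ[k] K}
    (hσ : σ ≠ 1) [Finite (ramifiedPrimes k K)] :
    (idealExt k K).range.relIndex (twistDiv (idealAut σ)).ker =
      2 ^ Nat.card (ramifiedPrimes k K) := by
  classical
  have := Fintype.ofFinite (ramifiedPrimes k K)
  have hmem (a : (FractionalIdeal (𝓞 K)⁰ K)ˣ) :
      a ∈ (twistDiv (idealAut σ)).ker ↔ a = idealAut σ a := by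
    rw [MonoidHom.mem_ker, MonoidHom.div_apply, MonoidHom.id_apply, div_eq_one]
  have h1 : (idealExt k K).range = (ramifiedParity (k := k)).ker ⊓ (twistDiv (idealAut σ)).ker := by
    ext a
    rw [Subgroup.mem_inf, hmem]
    constructor
    · rintro ⟨b, rfl⟩
      exact ⟨ramifiedParity_idealExt b, (idealAut_idealExt σ b).symm⟩
    · rintro ⟨ha, haσ⟩
      obtain ⟨x, hx, I, hI, rfl⟩ := exists_eq_unitIdeal_div (k := k) a
      have h3 : toPrincipalIdeal (𝓞 K) K (Units.mk0 (algebraMap k K x) hx) =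
          idealExt k K (toPrincipalIdeal (𝓞 k) k (Units.mk0 x (by rintro h; simp [h] at hx))) := by
        rw [idealExt_toPrincipalIdeal]
        congr 1
        ext1
        rfl
      rw [h3] at ha haσ ⊢
      rw [MonoidHom.mem_ker, map_div, ramifiedParity_idealExt, _root_.div_one] at ha
      rw [map_div, idealAut_idealExt, div_left_inj, idealAut_unitIdeal] at haσ
      have hinv' := congr_arg (fun a : (FractionalIdeal (𝓞 K)⁰ K)ˣ => (a : FractionalIdeal (𝓞 K)⁰ K))
        haσ
      simp only [unitIdeal, Units.val_mk0, coeIdeal_inj] at hinv'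
      exact div_mem (unitIdeal_mem_range_idealExt hdeg hσ I hI hinv'.symm ha) ⟨_, rfl⟩
  rw [h1, Subgroup.inf_relIndex_right, Subgroup.relIndex_ker]
  have h2 : (twistDiv (idealAut σ)).ker.map (ramifiedParity (k := k)) = ⊤ := by
    rw [eq_top_iff]
    rintro v -
    have hv : v = ∏ P, ramifiedParity (unitIdeal P.1.asIdeal P.1.ne_bot) ^ (v.toAdd P).val := by
      simp only [ramifiedParity_unitIdeal_self, ← ofAdd_nsmul, ← ofAdd_sum]
      ext Q
      rw [toAdd_ofAdd, Finset.sum_apply]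
      simp only [Pi.smul_apply, Pi.single_apply, smul_ite, smul_zero, Finset.sum_ite_eq,
        Finset.mem_univ, if_true]
      rw [nsmul_one, ZMod.natCast_zmod_val]
    rw [hv]
    refine prod_mem fun P _ => pow_mem (Subgroup.mem_map_of_mem _ ?_) _
    rw [hmem, idealAut_unitIdeal]
    simp only [map_intAut_of_mem_ramifiedPrimes σ P.2]
  rw [h2, Nat.card_congr Subgroup.topEquiv.toEquiv, Nat.card_congr Multiplicative.toAdd,
    Nat.card_fun, Nat.card_zmod]

end RamifiedCount

section AmbiguousClassNumber

open Module FractionalIdeal IsDedekindDomain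
open scoped nonZeroDivisors

variable {k K : Type*} [Field k] [Field K] [NumberField k] [NumberField K] [Algebra k K]

theorem toPrincipalIdeal_eq_one_iff (x : Kˣ) :
    toPrincipalIdeal (𝓞 K) K x = 1 ↔ ∃ u : (𝓞 K)ˣ, algebraMap (𝓞 K) K u = x := by
  rw [toPrincipalIdeal_eq_iff, Units.val_one, ← spanSingleton_one]
  constructor
  · intro h
    have h1 : ∀ y : Kˣ, spanSingleton (𝓞 K)⁰ (y : K) = spanSingleton (𝓞 K)⁰ 1 →
        ∃ u : 𝓞 K, algebraMap (𝓞 K) K u = y := by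
      intro y hy
      have : (y : K) ∈ spanSingleton (𝓞 K)⁰ (1 : K) := hy ▸ mem_spanSingleton_self _ _
      obtain ⟨z, hz⟩ := (mem_spanSingleton _).1 this
      exact ⟨z, by rw [← hz, Algebra.smul_def, mul_one]⟩
    obtain ⟨u, hu⟩ := h1 x h
    obtain ⟨v, hv⟩ := h1 x⁻¹ (by
      have := congr(spanSingleton (𝓞 K)⁰ ((x⁻¹ : Kˣ) : K) * $h)
      rw [spanSingleton_mul_spanSingleton, spanSingleton_mul_spanSingleton, Units.inv_mul,
        mul_one] at this
      exact this.symm)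
    refine ⟨⟨u, v, ?_, ?_⟩, hu⟩ <;>
    · apply FaithfulSMul.algebraMap_injective (𝓞 K) K
      rw [map_mul, hu, hv]
      simp
  · rintro ⟨u, hu⟩
    rw [← hu, ← coeIdeal_span_singleton, Ideal.span_singleton_eq_top.2 u.isUnit, coeIdeal_top,
      spanSingleton_one]

variable (k K) in
/-- The units of `k` that are norms of elements of `K`. -/
noncomputable def unitNorms : Subgroup (𝓞 k)ˣ :=
  (Units.map (Algebra.norm k : K →* k)).range.comap (Units.map (algebraMap (𝓞 k) k : 𝓞 k →* k))

theorem mem_unitNorms {u : (𝓞 k)ˣ} :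
    u ∈ unitNorms k K ↔ ∃ x : K, Algebra.norm k x = algebraMap (𝓞 k) k u := by
  constructor
  · rintro ⟨x, hx⟩
    exact ⟨x, congr(($hx : k))⟩
  · rintro ⟨x, hx⟩
    have hx0 : x ≠ 0 := by
      rintro rfl
      rw [Algebra.norm_zero] at hx
      exact (u.isUnit.map (algebraMap (𝓞 k) k)).ne_zero hx.symm
    exact ⟨Units.mk0 x hx0, Units.ext hx⟩

theorem card_subgroup_sq_eq_one (H : Subgroup Kˣ) (hH : -1 ∈ H) :
    Nat.card {x : H // x ^ 2 = 1} = 2 := by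
  have : {x : H | x ^ 2 = 1} = {1, ⟨-1, hH⟩} := by
    ext x
    rw [Set.mem_ofPred_eq, ← Subtype.val_inj]
    simp only [SubgroupClass.coe_pow, OneMemClass.coe_one, Set.mem_insert_iff,
      Set.mem_singleton_iff, Subtype.ext_iff, Units.ext_iff, Units.val_pow_eq_pow_val,
      Units.val_one, Units.val_neg]
    rw [← sq_eq_sq_iff_eq_or_eq_neg, one_pow]
  change Nat.card ({x : H | x ^ 2 = 1} : Set H) = 2
  rw [this, Nat.card_coe_set_eq, Set.ncard_pair]
  intro h
  have : (1 : K) = -1 := by simpa using congr(((($h : H) : Kˣ) : K))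
  norm_num [eq_neg_iff_add_eq_zero] at this

/-- The inclusion of the units of `𝓞 K` in `Kˣ`. -/
noncomputable abbrev unitsIncl (K : Type*) [Field K] : (𝓞 K)ˣ →* Kˣ :=
  Units.map (algebraMap (𝓞 K) K : 𝓞 K →* K)

theorem finrank_additive_eq_of_injective {G H : Type*} [CommGroup G] [CommGroup H] (f : G →* H)
    (hf : Function.Injective f) {S : Subgroup H} (hS : S = f.range) :
    finrank ℤ (Additive S) = finrank ℤ (Additive G) := by
  subst hS
  exact (MulEquiv.toAdditive (MonoidHom.ofInjective hf)).toIntLinearEquiv.finrank_eq.symm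

theorem rank_eq_two_mul_rank_add_one (hdeg : finrank k K = 2) [IsTotallyComplex k] :
    Units.rank K = 2 * Units.rank k + 1 := by
  have : IsTotallyComplex K := isTotallyComplex_of_algebra k K
  have h1 := IsTotallyComplex.finrank k
  have h2 := IsTotallyComplex.finrank K
  have h3 := finrank_mul_finrank ℚ k K
  have h5 : 0 < finrank ℚ k := finrank_pos
  rw [Units.rank, Units.rank, InfinitePlace.card_eq_nrRealPlaces_add_nrComplexPlaces,
    InfinitePlace.card_eq_nrRealPlaces_add_nrComplexPlaces,
    IsTotallyComplex.nrRealPlaces_eq_zero k, IsTotallyComplex.nrRealPlaces_eq_zero K]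
  rw [hdeg] at h3
  lia

/-- The **ambiguous class number formula** for a quadratic extension of a totally complex number
field of odd class number. -/
theorem card_sq_eq_one_mul_index_unitNorms (hdeg : finrank k K = 2) [IsTotallyComplex k]
    (hodd : Odd (classNumber k)) [Finite (ramifiedPrimes k K)] :
    Nat.card {c : ClassGroup (𝓞 K) // c ^ 2 = 1} * (unitNorms k K).index * 2 =
      2 ^ Nat.card (ramifiedPrimes k K) := by
  have : Algebra.IsQuadraticExtension k K := ⟨hdeg⟩
  have : FiniteDimensional k K := FiniteDimensional.of_finrank_pos (by lia)
  obtain ⟨σ, hσ⟩ : ∃ σ : K ≃ₐ[k] K, σ ≠ 1 := by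
    have hc : Nat.card (K ≃ₐ[k] K) = 2 := by rw [IsGalois.card_aut_eq_finrank, hdeg]
    have : Nontrivial (K ≃ₐ[k] K) := Finite.one_lt_card_iff_nontrivial.1 (by lia)
    exact exists_ne 1
  have hss := AlgEquiv.apply_apply_of_finrank_two hdeg hσ
  set s : Kˣ →* Kˣ := Units.map (σ : K →* K) with hs
  have hker : (toPrincipalIdeal (𝓞 K) K).ker = (unitsIncl K).range := by
    ext x
    rw [MonoidHom.mem_ker, toPrincipalIdeal_eq_one_iff]
    exact exists_congr fun u => ⟨fun h => Units.ext h, fun h => congr(($h : K))⟩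
  have hinjK : Function.Injective (unitsIncl K) :=
    Units.map_injective (FaithfulSMul.algebraMap_injective _ _)
  set j : kˣ →* Kˣ := Units.map (algebraMap k K : k →* K) with hj
  have hjinj : Function.Injective j := Units.map_injective (FaithfulSMul.algebraMap_injective _ _)
  have hinjk : Function.Injective (j.comp (unitsIncl k)) :=
    hjinj.comp (Units.map_injective (FaithfulSMul.algebraMap_injective _ _))
  have hmem (x : Kˣ) : x ∈ (twistDiv s).ker ↔ s x = x := by
    rw [MonoidHom.mem_ker, MonoidHom.div_apply, MonoidHom.id_apply, div_eq_one, eq_comm]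
  have hfixed (x : Kˣ) (hx : s x = x) : ∃ y, j y = x := by
    obtain ⟨y, hy⟩ := AlgEquiv.exists_algebraMap_eq_of_apply_eq hdeg hσ (x := (x : K))
      congr(($hx : K))
    refine ⟨Units.mk0 y ?_, Units.ext hy⟩
    rintro rfl
    rw [map_zero] at hy
    exact x.ne_zero hy.symm
  have hker' : (toPrincipalIdeal (𝓞 K) K).ker ⊓ (twistDiv s).ker =
      (j.comp (unitsIncl k)).range := by
    ext x
    rw [Subgroup.mem_inf, hmem]
    constructor
    · rintro ⟨hx, hsx⟩
      rw [hker] at hx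
      obtain ⟨u, rfl⟩ := hx
      have hu (v : (𝓞 K)ˣ) (hv : s (unitsIncl K v) = unitsIncl K v) :
          ∃ w : 𝓞 k, algebraMap (𝓞 k) (𝓞 K) w = v :=
        exists_algebraMap_eq_of_intAut_eq hdeg hσ (RingOfIntegers.ext congr(($hv : K)))
      obtain ⟨v, hv⟩ := hu u hsx
      obtain ⟨w, hw⟩ := hu u⁻¹ (by rw [map_inv, map_inv, hsx])
      refine ⟨⟨v, w, ?_, ?_⟩, Units.ext congr(($hv : K))⟩ <;>
      · apply FaithfulSMul.algebraMap_injective (𝓞 k) (𝓞 K)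
        rw [map_mul, hv, hw]
        simp
    · rintro ⟨u, rfl⟩
      refine ⟨?_, Units.ext (σ.commutes _)⟩
      rw [hker]
      exact ⟨Units.map (algebraMap (𝓞 k) (𝓞 K) : 𝓞 k →* 𝓞 K) u, Units.ext rfl⟩
  have hneg : (-1 : Kˣ) ∈ (toPrincipalIdeal (𝓞 K) K).ker := by
    rw [hker]
    exact ⟨-1, by ext; simp⟩
  have hfin : Module.Finite ℤ (Additive (toPrincipalIdeal (𝓞 K) K).ker) := by
    rw [hker]
    exact Module.Finite.equiv (MulEquiv.toAdditive (MonoidHom.ofInjective hinjK)).toIntLinearEquiv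
  have key := card_sq_eq_one_mul_relIndex_mul_two s (toPrincipalIdeal (𝓞 K) K) (idealAut σ)
    (idealExt k K).range (classNumber k) (idealAut_toPrincipalIdeal σ)
    (fun x => Units.ext (hss x)) (idealAut_idealAut hdeg hσ) (mul_idealAut_mem_range hdeg hσ)
    (by rintro _ ⟨b, rfl⟩; exact idealAut_idealExt σ b) hodd
    (by
      rintro _ ⟨b, rfl⟩
      have h1 : (QuotientGroup.mk b : _ ⧸ (toPrincipalIdeal (𝓞 k) k).range) ^ classNumber k =
          1 := by
        apply (ClassGroup.equiv k).symm.injective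
        rw [map_pow, map_one]
        exact pow_card_eq_one
      rw [← QuotientGroup.mk_pow, QuotientGroup.eq_one_iff] at h1
      obtain ⟨y, hy⟩ := h1
      refine ⟨j y, Units.ext (σ.commutes _), ?_⟩
      rw [← idealExt_toPrincipalIdeal, hy, map_pow])
    (by
      intro x hx
      obtain ⟨y, rfl⟩ := hfixed x hx
      exact ⟨_, idealExt_toPrincipalIdeal y⟩)
    (by
      intro x hx
      obtain ⟨y, hy0, hy⟩ := AlgEquiv.exists_eq_div_of_mul_apply_eq_one hdeg hσ (x := (x : K))
        congr(($hx : K))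
      refine ⟨Units.mk0 y hy0, ?_⟩
      ext1
      rw [hy, Units.val_div_eq_div_val]
      rfl)
    (fun a ha => exists_eq_div_idealAut ha) two_ne_zero
    (card_subgroup_sq_eq_one _ ⟨hneg, (hmem _).2 (by ext; simp [hs])⟩)
    (card_subgroup_sq_eq_one _ ⟨hneg, by change -1 * s (-1) = 1; ext; simp [hs]⟩)
    (by
      rw [finrank_additive_eq_of_injective _ hinjK hker,
        finrank_additive_eq_of_injective _ hinjk hker',
        Units.finrank_eq, Units.finrank_eq, rank_eq_two_mul_rank_add_one hdeg])
  rw [relIndex_range_idealExt hdeg hσ] at key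
  rw [← key]
  congr 2
  · apply Nat.card_congr
    exact (ClassGroup.equiv K).toEquiv.subtypeEquiv fun c => by
      change _ ↔ (ClassGroup.equiv K c) ^ 2 = 1
      rw [← map_pow, map_eq_one_iff _ (ClassGroup.equiv K).injective]
  · rw [hker', ← Subgroup.relIndex_top_right, (j.comp (unitsIncl k)).range_eq_map,
      ← Subgroup.relIndex_comap]
    congr 1
    ext u
    rw [mem_unitNorms, Subgroup.mem_comap, MonoidHom.mem_range]
    constructor
    · rintro ⟨x, hx⟩
      have h1 := AlgEquiv.algebraMap_norm_of_finrank_two hdeg hσ x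
      rw [hx] at h1
      have hx0 : x ≠ 0 := by
        rintro rfl
        rw [zero_mul] at h1
        exact (j (unitsIncl k u)).ne_zero h1
      exact ⟨Units.mk0 x hx0, Units.ext h1.symm⟩
    · rintro ⟨x, hx⟩
      refine ⟨x, FaithfulSMul.algebraMap_injective k K ?_⟩
      rw [AlgEquiv.algebraMap_norm_of_finrank_two hdeg hσ]
      exact congr(($hx : K))

end AmbiguousClassNumber

section UniqueRamified

open Module Ideal IsDedekindDomain

variable {k K : Type*} [Field k] [Field K] [NumberField k] [NumberField K] [Algebra k K]

theorem odd_card_of_card_sq_eq_one {G : Type*} [CommGroup G] [Finite G]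
    (h : Nat.card {c : G // c ^ 2 = 1} = 1) : Odd (Nat.card G) := by
  rw [← Nat.not_even_iff_odd]
  intro he
  have : Fact (Nat.Prime 2) := ⟨Nat.prime_two⟩
  obtain ⟨c, hc⟩ := exists_prime_orderOf_dvd_card' 2 he.two_dvd
  have hs := (Nat.card_eq_one_iff_unique.1 h).1
  have h1 : (⟨c, hc ▸ pow_orderOf_eq_one c⟩ : {c : G // c ^ 2 = 1}) = ⟨1, one_pow 2⟩ :=
    Subsingleton.elim _ _
  rw [Subtype.mk.injEq] at h1
  rw [h1, orderOf_one] at hc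
  lia

theorem odd_classNumber_and_unitNorms_eq_top (hdeg : finrank k K = 2) [IsTotallyComplex k]
    (hodd : Odd (classNumber k)) (hsub : (ramifiedPrimes k K).Subsingleton) :
    Odd (classNumber K) ∧ unitNorms k K = ⊤ := by
  have : Finite (ramifiedPrimes k K) := hsub.finite
  have h := card_sq_eq_one_mul_index_unitNorms hdeg hodd
  have hle : Nat.card (ramifiedPrimes k K) ≤ 1 := by
    have : Subsingleton (ramifiedPrimes k K) := hsub.coe_sort
    exact Finite.card_le_one_iff_subsingleton.2 this
  have h1 : Nat.card {c : ClassGroup (𝓞 K) // c ^ 2 = 1} * (unitNorms k K).index = 1 := by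
    interval_cases h2 : Nat.card (ramifiedPrimes k K) <;> lia
  rw [mul_eq_one] at h1
  refine ⟨?_, Subgroup.index_eq_one.1 h1.2⟩
  rw [classNumber, ← Nat.card_eq_fintype_card]
  exact odd_card_of_card_sq_eq_one h1.1

theorem relNorm_of_mem_ramifiedPrimes (hdeg : finrank k K = 2) {P : HeightOneSpectrum (𝓞 K)}
    (hP : P ∈ ramifiedPrimes k K) : relNorm (𝓞 k) P.asIdeal = P.asIdeal.under (𝓞 k) := by
  have h := congrArg (relNorm (𝓞 k)) hP
  rw [map_pow, relNorm_algebraMap, ← IsFractionRing.finrank_eq (𝓞 k) k (𝓞 K) K, hdeg] at h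
  exact pow_left_injective two_ne_zero h

theorem exists_sub_mem_of_mem_ramifiedPrimes (hdeg : finrank k K = 2)
    {P : HeightOneSpectrum (𝓞 K)} (hP : P ∈ ramifiedPrimes k K) (x : 𝓞 K) :
    ∃ y : 𝓞 k, x - algebraMap (𝓞 k) (𝓞 K) y ∈ P.asIdeal := by
  have hn := congrArg absNorm (relNorm_of_mem_ramifiedPrimes hdeg hP)
  rw [absNorm_relNorm] at hn
  have hPm := P.isMaximal
  have hp0 : P.asIdeal.under (𝓞 k) ≠ ⊥ := mt (Ideal.eq_bot_of_comap_eq_bot) P.ne_bot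
  have := Ideal.finiteQuotientOfFreeOfNeBot _ P.ne_bot
  have := Ideal.finiteQuotientOfFreeOfNeBot _ hp0
  let f : 𝓞 k ⧸ P.asIdeal.under (𝓞 k) →+* 𝓞 K ⧸ P.asIdeal :=
    Ideal.quotientMap P.asIdeal (algebraMap (𝓞 k) (𝓞 K)) le_rfl
  have hf : Function.Injective f := Ideal.quotientMap_injective
  have hfb := (Nat.bijective_iff_injective_and_card f).2 ⟨hf, hn.symm⟩
  obtain ⟨y, hy⟩ := hfb.2 (Ideal.Quotient.mk _ x)
  obtain ⟨y, rfl⟩ := Ideal.Quotient.mk_surjective y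
  refine ⟨y, ?_⟩
  rw [← Ideal.Quotient.eq, ← hy]
  rfl

theorem intAut_sub_mem_of_mem_ramifiedPrimes (hdeg : finrank k K = 2) (σ : K ≃ₐ[k] K)
    {P : HeightOneSpectrum (𝓞 K)} (hP : P ∈ ramifiedPrimes k K) (x : 𝓞 K) :
    intAut σ x - x ∈ P.asIdeal := by
  obtain ⟨y, hy⟩ := exists_sub_mem_of_mem_ramifiedPrimes hdeg hP x
  have h := Ideal.mem_map_of_mem (intAut σ) hy
  rw [map_intAut_of_mem_ramifiedPrimes σ hP, map_sub, AlgEquiv.commutes] at h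
  have := sub_mem h hy
  rwa [sub_sub_sub_cancel_right] at this

theorem ramifiedPrimes_subset_of_injOn {S : Set (Ideal (𝓞 k))} (hS : S.Subsingleton)
    (h : ∀ P ∈ ramifiedPrimes k K, P.asIdeal.under (𝓞 k) ∈ S) :
    (ramifiedPrimes k K).Subsingleton := by
  intro P hP Q hQ
  have h1 := hS (h P hP) (h Q hQ)
  have h2 : P.asIdeal ^ 2 = Q.asIdeal ^ 2 := by rw [hP, hQ, h1]
  exact HeightOneSpectrum.ext (pow_left_injective two_ne_zero h2)

end UniqueRamified

section QuadraticGenerator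

open Module Ideal IsDedekindDomain

variable {k K : Type*} [Field k] [Field K] [NumberField k] [NumberField K] [Algebra k K]

theorem exists_aut_apply_eq_neg [IsGalois k K] (hdeg : finrank k K = 2) {α : K} {a : k}
    (hα : α ^ 2 = algebraMap k K a) (ha : ¬ IsSquare a) : ∃ σ : K ≃ₐ[k] K, σ ≠ 1 ∧ σ α = -α := by
  have : FiniteDimensional k K := FiniteDimensional.of_finrank_pos (by lia)
  have : Nontrivial (K ≃ₐ[k] K) := by
    rw [← Finite.one_lt_card_iff_nontrivial, IsGalois.card_aut_eq_finrank, hdeg]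
    exact one_lt_two
  obtain ⟨σ, hσ⟩ := exists_ne (1 : K ≃ₐ[k] K)
  refine ⟨σ, hσ, ?_⟩
  have h : σ α ^ 2 = α ^ 2 := by rw [← map_pow, hα, AlgEquiv.commutes]
  refine (sq_eq_sq_iff_eq_or_eq_neg.1 h).resolve_left fun h1 => ha ?_
  obtain ⟨y, hy⟩ := AlgEquiv.exists_algebraMap_eq_of_apply_eq hdeg hσ h1
  refine ⟨y, FaithfulSMul.algebraMap_injective k K ?_⟩
  rw [← hα, map_mul, hy, sq]

theorem exists_eq_add_mul_of_finrank_two [IsGalois k K] (hdeg : finrank k K = 2) {σ : K ≃ₐ[k] K}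
    (hσ : σ ≠ 1) {α : K} (hα : α ≠ 0) (hσα : σ α = -α) (x : K) :
    ∃ y z : k, x = algebraMap k K y + algebraMap k K z * α := by
  have hss := AlgEquiv.apply_apply_of_finrank_two hdeg hσ x
  obtain ⟨y, hy⟩ := AlgEquiv.exists_algebraMap_eq_of_apply_eq hdeg hσ (x := (x + σ x) / 2) (by
    rw [map_div₀, map_add, hss, map_ofNat, add_comm])
  obtain ⟨z, hz⟩ := AlgEquiv.exists_algebraMap_eq_of_apply_eq hdeg hσ (x := (x - σ x) / 2 / α) (by
    rw [map_div₀, map_div₀, map_sub, hss, hσα, map_ofNat, div_neg, ← neg_div, ← neg_div, neg_sub])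
  refine ⟨y, z, ?_⟩
  rw [hy, hz, div_mul_cancel₀ _ hα]
  ring

theorem algebraMap_norm_add_mul [IsGalois k K] (hdeg : finrank k K = 2) {σ : K ≃ₐ[k] K}
    (hσ : σ ≠ 1) {α : K} {a : k} (hα : α ^ 2 = algebraMap k K a) (hσα : σ α = -α) (y z : k) :
    Algebra.norm k (algebraMap k K y + algebraMap k K z * α) = y ^ 2 - a * z ^ 2 := by
  apply FaithfulSMul.algebraMap_injective k K
  rw [AlgEquiv.algebraMap_norm_of_finrank_two hdeg hσ, map_add, map_mul, hσα,
    AlgEquiv.commutes, AlgEquiv.commutes, map_sub, map_mul, map_pow, map_pow, ← hα]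
  ring

/-- If every prime above `2` coincides, a quadratic extension obtained by adjoining the square root
of a unit is ramified in at most one prime. -/
theorem ramifiedPrimes_subsingleton_of_sq_eq_unit [IsGalois k K] (hdeg : finrank k K = 2)
    (h2 : {p : Ideal (𝓞 k) | p.IsPrime ∧ 2 ∈ p}.Subsingleton) {α : K} {u : (𝓞 k)ˣ}
    (hα : α ^ 2 = algebraMap k K u) (hu : ¬ IsSquare ((u : 𝓞 k) : k)) :
    (ramifiedPrimes k K).Subsingleton := by
  refine ramifiedPrimes_subset_of_injOn h2 fun P hP => ⟨inferInstance, ?_⟩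
  obtain ⟨σ, hσ, hσα⟩ := exists_aut_apply_eq_neg hdeg hα hu
  have hαi : IsIntegral ℤ α := by
    refine IsIntegral.of_pow two_pos ?_
    rw [hα]
    exact ((u : 𝓞 k).isIntegral_coe).algebraMap
  let β : 𝓞 K := ⟨α, hαi⟩
  have hβ : β ^ 2 = algebraMap (𝓞 k) (𝓞 K) u := by
    ext
    exact hα
  have hβu : IsUnit β := by
    rw [← isUnit_pow_iff two_ne_zero, hβ]
    exact u.isUnit.map _
  have h1 := intAut_sub_mem_of_mem_ramifiedPrimes hdeg σ hP β
  have h3 : intAut σ β - β = -(2 * β) := by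
    ext
    change σ α - α = -(2 * α)
    rw [hσα]
    ring
  rw [h3, neg_mem_iff] at h1
  have h4 := (P.isPrime.mem_or_mem h1).resolve_right fun h =>
    P.isPrime.ne_top (Ideal.eq_top_of_isUnit_mem _ h hβu)
  rw [Ideal.mem_comap, map_ofNat]
  exact h4

end QuadraticGenerator

section TwoPowerCyclotomic

open Module Ideal

theorem liesOver_span_of_natCast_mem {k : Type*} [Field k] [NumberField k] {p : ℕ} (hp : p.Prime)
    {P : Ideal (𝓞 k)} (hP : P ≠ ⊤) (h : (p : 𝓞 k) ∈ P) : P.LiesOver (span {(p : ℤ)}) := by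
  have hm : (span {(p : ℤ)}).IsMaximal :=
    PrincipalIdealRing.isMaximal_of_irreducible (Nat.prime_iff_prime_int.1 hp).irreducible
  refine ⟨hm.eq_of_le (Ideal.comap_ne_top _ hP) ?_⟩
  rw [span_singleton_le_iff_mem, Ideal.mem_comap]
  simpa using h

variable (k : Type*) [Field k] [NumberField k]

theorem subsingleton_primes_over_two (n : ℕ) [IsCyclotomicExtension {2 ^ (n + 1)} ℚ k] :
    {p : Ideal (𝓞 k) | p.IsPrime ∧ 2 ∈ p}.Subsingleton := by
  have : Fact (Nat.Prime 2) := ⟨Nat.prime_two⟩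
  have h (p : Ideal (𝓞 k)) (hp : p.IsPrime ∧ 2 ∈ p) : p =
      span {(IsCyclotomicExtension.zeta_spec (2 ^ (n + 1)) ℚ k).toInteger - 1} := by
    have := hp.1
    have := liesOver_span_of_natCast_mem Nat.prime_two hp.1.ne_top (mod_cast hp.2)
    exact IsCyclotomicExtension.Rat.eq_span_zeta_sub_one_of_liesOver 2 n k _ p
  intro p hp q hq
  rw [h p hp, h q hq]

theorem isTotallyComplex_of_two_pow {n : ℕ} (hn : 2 ≤ n) [IsCyclotomicExtension {2 ^ n} ℚ k] :
    IsTotallyComplex k :=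
  IsCyclotomicExtension.Rat.isTotallyComplex (n := 2 ^ n) k
    (lt_of_lt_of_le (by norm_num : 2 < 2 ^ 2) (Nat.pow_le_pow_right two_pos hn))

theorem classNumber_of_four [IsCyclotomicExtension {2 ^ 2} ℚ k] : classNumber k = 1 := by
  rw [classNumber_eq_one_iff]
  apply RingOfIntegers.isPrincipalIdealRing_of_abs_discr_lt
  have : Fact (Nat.Prime 2) := ⟨Nat.prime_two⟩
  have ht : Nat.totient (2 ^ 2) = 2 := by decide
  have h1 : discr k = _ := IsCyclotomicExtension.Rat.discr_prime_pow 2 2 k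
  have h2 : finrank ℚ k = _ := IsCyclotomicExtension.finrank (n := 2 ^ 2) k
    (Polynomial.cyclotomic.irreducible_rat (by simp))
  have h3 : InfinitePlace.nrComplexPlaces k = _ :=
    IsCyclotomicExtension.Rat.nrComplexPlaces_eq_totient_div_two (2 ^ 2) k
  rw [h1, h2, h3, ht]
  have := Real.pi_gt_three
  norm_num
  nlinarith

theorem finrank_of_two_pow (n : ℕ) [IsCyclotomicExtension {2 ^ (n + 1)} ℚ k] :
    finrank ℚ k = 2 ^ n := by
  rw [IsCyclotomicExtension.finrank (n := 2 ^ (n + 1)) k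
    (Polynomial.cyclotomic.irreducible_rat (by simp)), Nat.totient_prime_pow_succ Nat.prime_two,
    Nat.add_one_sub_one, mul_one]

theorem two_pow_le_finrank_of_isPrimitiveRoot {n : ℕ} {ζ : k}
    (hζ : IsPrimitiveRoot ζ (2 ^ (n + 1))) : 2 ^ n ≤ finrank ℚ k := by
  let F : IntermediateField ℚ k := ℚ⟮ζ⟯
  have : IsCyclotomicExtension {2 ^ (n + 1)} ℚ F :=
    hζ.intermediateField_adjoin_isCyclotomicExtension ℚ
  rw [← finrank_of_two_pow F n, ← finrank_mul_finrank ℚ F k]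
  exact Nat.le_mul_of_pos_right _ finrank_pos

variable {k}

theorem unit_generates_of_odd_classNumber [IsTotallyComplex k] (hodd : Odd (classNumber k))
    (h2 : {p : Ideal (𝓞 k) | p.IsPrime ∧ 2 ∈ p}.Subsingleton)
    {K : Type*} [Field K] [NumberField K] [Algebra k K] (hdeg : finrank k K = 2)
    {α : K} {u : (𝓞 k)ˣ} (hα : α ^ 2 = algebraMap k K u) (hu : ¬ IsSquare ((u : 𝓞 k) : k)) :
    Odd (classNumber K) ∧ unitNorms k K = ⊤ := by
  have : IsGalois k K := by
    have := Algebra.IsQuadraticExtension.mk (R := k) (S := K) hdeg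
    infer_instance
  exact odd_classNumber_and_unitNorms_eq_top hdeg hodd
    (ramifiedPrimes_subsingleton_of_sq_eq_unit hdeg h2 hα hu)

end TwoPowerCyclotomic

section OddClassNumber

open Module

universe u

theorem odd_classNumber_of_two_pow (n : ℕ) (k : Type u) [Field k] [NumberField k]
    [IsCyclotomicExtension {2 ^ (n + 2)} ℚ k] : Odd (classNumber k) := by
  induction n generalizing k with
  | zero =>
    have : IsCyclotomicExtension {2 ^ 2} ℚ k := ‹_›
    rw [classNumber_of_four]
    exact odd_one
  | succ n ih =>
    have hζ := IsCyclotomicExtension.zeta_spec (2 ^ (n + 1 + 2)) ℚ k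
    set ζ := IsCyclotomicExtension.zeta (2 ^ (n + 1 + 2)) ℚ k with hζdef
    have hζ2 : IsPrimitiveRoot (ζ ^ 2) (2 ^ (n + 2)) := hζ.pow (by positivity) (by ring)
    let F : IntermediateField ℚ k := ℚ⟮ζ ^ 2⟯
    have : IsCyclotomicExtension {2 ^ (n + 2)} ℚ F :=
      hζ2.intermediateField_adjoin_isCyclotomicExtension ℚ
    have hF := finrank_of_two_pow F (n + 1)
    have hk := finrank_of_two_pow k (n + 2)
    have hmul := finrank_mul_finrank ℚ F k
    rw [hF, hk, pow_succ] at hmul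
    have hdeg : finrank F k = 2 := Nat.eq_of_mul_eq_mul_left (by positivity) hmul
    have := isTotallyComplex_of_two_pow F (n := n + 2) (by lia)
    have hz : IsPrimitiveRoot (⟨ζ ^ 2, mem_adjoin_simple_self ℚ _⟩ : F) (2 ^ (n + 2)) :=
      IsPrimitiveRoot.of_map_of_injective (f := algebraMap F k) hζ2
        (FaithfulSMul.algebraMap_injective F k)
    refine (unit_generates_of_odd_classNumber (ih F)
      (subsingleton_primes_over_two F (n + 1)) hdeg (α := ζ)
      (u := hz.toInteger_isPrimitiveRoot.isUnit (by positivity) |>.unit) ?_ ?_).1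
    · rfl
    · rintro ⟨x, hx⟩
      have hx' : ζ ^ 2 = algebraMap F k x ^ 2 := by
        rw [sq (algebraMap F k x), ← map_mul, ← hx]
        rfl
      have hmem : ζ ∈ F := by
        rcases sq_eq_sq_iff_eq_or_eq_neg.1 hx' with h | h
        · rw [h]; exact x.2
        · rw [h]; exact neg_mem x.2
      have := two_pow_le_finrank_of_isPrimitiveRoot F (n := n + 2) (ζ := ⟨ζ, hmem⟩)
        (IsPrimitiveRoot.of_map_of_injective (f := algebraMap F k) hζ
          (FaithfulSMul.algebraMap_injective F k))
      rw [hF, Nat.pow_le_pow_iff_right one_lt_two] at this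
      lia

end OddClassNumber

section NormCriterion

open Module Ideal IsDedekindDomain

universe u

theorem exists_numberField_sq_eq {k : Type u} [Field k] [NumberField k] {a : k}
    (ha : ¬ IsSquare a) :
    ∃ (K : Type u) (_ : Field K) (_ : NumberField K) (_ : Algebra k K) (α : K),
      finrank k K = 2 ∧ α ^ 2 = algebraMap k K a := by
  have hirr : Irreducible (Polynomial.X ^ 2 - Polynomial.C a) :=
    X_pow_sub_C_irreducible_of_prime Nat.prime_two fun b hb => ha ⟨b, by rw [← hb, sq]⟩
  have : Fact (Irreducible (Polynomial.X ^ 2 - Polynomial.C a)) := ⟨hirr⟩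
  let K := AdjoinRoot (Polynomial.X ^ 2 - Polynomial.C a)
  have hfin : finrank k K = 2 := by
    rw [(AdjoinRoot.powerBasis hirr.ne_zero).finrank, AdjoinRoot.powerBasis_dim,
      Polynomial.natDegree_X_pow_sub_C]
  have : FiniteDimensional k K := FiniteDimensional.of_finrank_pos (by lia)
  have : NumberField K := NumberField.of_module_finite k K
  refine ⟨K, inferInstance, this, inferInstance, AdjoinRoot.root _, hfin, ?_⟩
  have := AdjoinRoot.eval₂_root (Polynomial.X ^ 2 - Polynomial.C a)
  rw [Polynomial.eval₂_sub, Polynomial.eval₂_X_pow, Polynomial.eval₂_C, sub_eq_zero] at this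
  exact this

variable {k K : Type*} [Field k] [Field K] [NumberField k] [NumberField K] [Algebra k K]

theorem exists_relNorm_eq_of_sq_sub_mem (hdeg : finrank k K = 2) [IsGalois k K] {α : 𝓞 K}
    {a : 𝓞 k} (hα : α ^ 2 = algebraMap (𝓞 k) (𝓞 K) a) (ha : ¬ IsSquare (a : k))
    {p : Ideal (𝓞 k)} [p.IsPrime] (hp : p ≠ ⊥) (h2 : 2 ∉ p) {c : 𝓞 k}
    (hc : a - c ^ 2 ∈ p) (hap : a ∉ p) : ∃ J : Ideal (𝓞 K), relNorm (𝓞 k) J = p := by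
  obtain ⟨σ, hσ, hσα⟩ := exists_aut_apply_eq_neg hdeg (α := (α : K)) (a := (a : k))
    congr(($hα : K)) ha
  have hpm : p.IsMaximal := Ring.DimensionLEOne.maximalOfPrime hp inferInstance
  obtain ⟨P, hPm, hPp⟩ := exists_maximal_ideal_liesOver_of_isIntegral p (S := 𝓞 K)
  have hPp' : P.under (𝓞 k) = p := hPp.over.symm
  have hP0 : P ≠ ⊥ := by
    rintro rfl
    apply hp
    rw [← hPp']
    exact Ideal.comap_bot_of_injective _ (FaithfulSMul.algebraMap_injective _ _)
  have hα' : intAut σ α = -α := by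
    ext
    exact hσα
  have key (Q : Ideal (𝓞 K)) (hQ : Q.IsPrime) (hQp : Q.under (𝓞 k) = p) :
      ∃ s, 1 ≤ s ∧ relNorm (𝓞 k) Q = p ^ s := by
    have : Q.LiesOver p := ⟨hQp.symm⟩
    obtain ⟨s, hs⟩ := exists_relNorm_eq_pow_of_isPrime Q p
    refine ⟨s, Nat.one_le_iff_ne_zero.2 ?_, hs⟩
    rintro rfl
    have h := relNorm_le_comap (R := 𝓞 k) Q
    rw [hs, pow_zero, Ideal.one_eq_top] at h
    exact hpm.ne_top (hQp ▸ top_le_iff.1 h)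
  rcases exists_prime_mul_of_finrank_two hdeg P hP0 with h | ⟨Q, hQ, hQp, h⟩
  · exfalso
    have h1 : (α - algebraMap (𝓞 k) (𝓞 K) c) * (α + algebraMap (𝓞 k) (𝓞 K) c) ∈ P := by
      have h3 : algebraMap (𝓞 k) (𝓞 K) (a - c ^ 2) ∈ P := by
        exact Ideal.mem_comap.1 (hPp'.symm ▸ hc : a - c ^ 2 ∈ P.under (𝓞 k))
      convert h3 using 1
      rw [map_sub, map_pow, ← hα]
      ring
    have hPσ : P.map (intAut σ) ≤ P := by
      rw [Ideal.map_le_iff_le_comap]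
      conv_lhs => rw [h]
      rw [Ideal.map_le_iff_le_comap]
      intro x hx
      rw [Ideal.mem_comap, Ideal.mem_comap, AlgEquiv.commutes]
      exact hx
    have h4 (e : 𝓞 k) (he : α + algebraMap (𝓞 k) (𝓞 K) e ∈ P) : False := by
      have h5 := hPσ (Ideal.mem_map_of_mem (intAut σ) he)
      rw [map_add, AlgEquiv.commutes, hα'] at h5
      have h6 : 2 * α ∈ P := by
        convert sub_mem he h5 using 1
        ring
      rcases hPm.isPrime.mem_or_mem h6 with h7 | h7
      · apply h2
        rw [← hPp', Ideal.mem_comap, map_ofNat]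
        exact h7
      · apply hap
        rw [← hPp', Ideal.mem_comap, ← hα]
        exact P.pow_mem_of_mem h7 2 two_pos
    rcases hPm.isPrime.mem_or_mem h1 with h3 | h3
    · exact h4 (-c) (by rwa [map_neg, ← sub_eq_add_neg])
    · exact h4 c h3
  · obtain ⟨s, hs1, hs⟩ := key P hPm.isPrime hPp'
    obtain ⟨t, ht1, ht⟩ := key Q hQ (hQp.trans hPp')
    refine ⟨P, ?_⟩
    have h3 := congrArg (relNorm (𝓞 k)) h
    rw [hPp', map_mul, relNorm_algebraMap, ← IsFractionRing.finrank_eq (𝓞 k) k (𝓞 K) K, hdeg,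
      hs, ht, ← pow_add] at h3
    have h4 : s + t = 2 := 
      (pow_inj_of_not_isUnit (mt Ideal.isUnit_iff.1 hpm.ne_top) hp).1 h3
    rw [hs, show s = 1 by lia, pow_one]

theorem exists_relNorm_eq (I : Ideal (𝓞 k)) (hI : I ≠ ⊥)
    (h : ∀ p : Ideal (𝓞 k), p.IsPrime → p ≠ ⊥ → I ≤ p →
      ∃ J : Ideal (𝓞 K), relNorm (𝓞 k) J = p) : ∃ J : Ideal (𝓞 K), relNorm (𝓞 k) J = I := by
  induction I using UniqueFactorizationMonoid.induction_on_prime with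
  | h₁ => exact absurd rfl hI
  | h₂ I hI' =>
    rw [Ideal.isUnit_iff.1 hI']
    exact ⟨⊤, by rw [← Ideal.one_eq_top, map_one, Ideal.one_eq_top]⟩
  | h₃ I p hI0 hp ih =>
    obtain ⟨J, hJ⟩ := ih hI0 fun q hq hq0 hIq => h q hq hq0 (Ideal.mul_le_right.trans hIq)
    obtain ⟨J', hJ'⟩ := h p (Ideal.isPrime_of_prime hp) hp.ne_zero Ideal.mul_le_left
    exact ⟨J' * J, by rw [map_mul, hJ, hJ']⟩

theorem exists_norm_eq_of_odd_classNumber (hodd : Odd (classNumber K)) (hU : unitNorms k K = ⊤)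
    (hdeg : finrank k K = 2) [IsGalois k K]
    {d : 𝓞 k} (hd : d ≠ 0) (h : ∃ J : Ideal (𝓞 K), relNorm (𝓞 k) J = span {d}) :
    ∃ x : K, Algebra.norm k x = d := by
  obtain ⟨J, hJ⟩ := h
  obtain ⟨m, hm⟩ := hodd
  have hpr : (J ^ classNumber K).IsPrincipal := by
    have hJ0 : J ≠ ⊥ := by
      rintro rfl
      rw [relNorm_bot, eq_comm, span_singleton_eq_bot] at hJ
      exact hd hJ
    have hJ' : J ∈ nonZeroDivisors (Ideal (𝓞 K)) := mem_nonZeroDivisors_of_ne_zero hJ0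
    have h1 := ClassGroup.mk0_eq_one_iff (pow_mem hJ' (classNumber K))
    refine h1.1 ?_
    have : ClassGroup.mk0 ⟨J ^ classNumber K, pow_mem hJ' _⟩ =
      ClassGroup.mk0 ⟨J, hJ'⟩ ^ classNumber K := by rw [← map_pow]; rfl
    rw [this, classNumber, pow_card_eq_one]
  obtain ⟨y, hy⟩ := hpr
  have h2 := congrArg (relNorm (𝓞 k)) hy
  rw [map_pow, hJ, span_singleton_pow, ← Ideal.span, relNorm_singleton,
    span_singleton_eq_span_singleton] at h2
  obtain ⟨v, hv⟩ := h2
  obtain ⟨w, hw⟩ := mem_unitNorms.1 (hU ▸ Subgroup.mem_top v⁻¹ : v⁻¹ ∈ unitNorms k K)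
  have hd' : (d : k) ≠ 0 := by simpa using hd
  refine ⟨algebraMap (𝓞 K) K y * w * algebraMap k K ((d : k) ^ m)⁻¹, ?_⟩
  have hvk := congrArg (algebraMap (𝓞 k) k) hv
  rw [map_mul, map_pow, Algebra.algebraMap_intNorm (A := 𝓞 k) (K := k) (L := K) (B := 𝓞 K)] at hvk
  have hv0 : algebraMap (𝓞 k) k v * algebraMap (𝓞 k) k (v⁻¹ : (𝓞 k)ˣ) = 1 := by
    rw [← map_mul, Units.mul_inv, map_one]
  rw [map_mul, map_mul, hw, ← hvk, Algebra.norm_algebraMap, hdeg, mul_assoc (_ ^ _), hv0, hm]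
  field_simp
  exact (by ring : (d : k) ^ (2 * m + 1) = ((d : k) ^ m) ^ 2 * d)

end NormCriterion

section UnitNormCriterion

open Module Ideal IsDedekindDomain

theorem exists_mul_eq_and_notMem {L : Type*} [Field L] [NumberField L]
    (P : HeightOneSpectrum (𝓞 L)) (z : L) : ∃ a b : 𝓞 L, z * b = a ∧
      (a ∉ P.asIdeal ∨ b ∉ P.asIdeal) := by
  obtain ⟨a, b, hb, rfl⟩ := IsFractionRing.div_surjective (A := 𝓞 L) z
  have hb0 := nonZeroDivisors.ne_zero hb
  have hbL : algebraMap (𝓞 L) L b ≠ 0 := by simpa using hb0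
  obtain ⟨J, hJ⟩ : span {a, b} ∣ span {b} :=
    Ideal.dvd_iff_le.2 (span_mono (by simp))
  by_contra! hcon
  have hle : span {a, b} * J ≤ span {b} * P.asIdeal := by
    rw [Ideal.mul_le]
    intro x hx j hj
    have h1 : b ∣ a * j := by
      rw [← mem_span_singleton, hJ]
      exact mul_mem_mul (subset_span (by simp)) hj
    obtain ⟨e, he⟩ := h1
    have h2 := hcon e j (by
      rw [div_mul_eq_mul_div, div_eq_iff hbL]
      have := congrArg (algebraMap (𝓞 L) L) he
      rw [map_mul, map_mul] at this
      rw [this, mul_comm])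
    obtain ⟨x', x'', rfl⟩ := mem_span_pair.1 hx
    rw [mem_span_singleton_mul]
    refine ⟨x' * e + x'' * j, add_mem (P.asIdeal.mul_mem_left _ h2.1)
      (P.asIdeal.mul_mem_left _ h2.2), ?_⟩
    linear_combination -x' * he
  rw [← hJ] at hle
  have h3 : span {b} * P.asIdeal = span {b} * ⊤ :=
    le_antisymm (mul_mono_right le_top) (by rwa [Ideal.mul_top])
  exact P.isPrime.ne_top (mul_left_cancel₀ (by simpa using hb0) h3)

variable {k L : Type*} [Field k] [Field L] [NumberField k] [NumberField L] [Algebra k L]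

theorem mem_unitNorms_of_forall_sq_sub_mem [IsTotallyComplex k] (hodd : Odd (classNumber k))
    (h2 : {p : Ideal (𝓞 k) | p.IsPrime ∧ 2 ∈ p}.Subsingleton) (hdeg : finrank k L = 2)
    [IsGalois k L] {s : L} {d : 𝓞 k} (hs : s ^ 2 = algebraMap k L d) (hd : ¬ IsSquare (d : k))
    {u : (𝓞 k)ˣ} (hu : ∀ p : Ideal (𝓞 k), p.IsPrime → d ∈ p →
      2 ∉ p ∧ ∃ c : 𝓞 k, (u : 𝓞 k) - c ^ 2 ∈ p) : u ∈ unitNorms k L := by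
  rw [mem_unitNorms]
  by_cases hsq : IsSquare ((u : 𝓞 k) : k)
  · obtain ⟨v, hv⟩ := hsq
    refine ⟨algebraMap k L v, ?_⟩
    rw [Algebra.norm_algebraMap, hdeg, sq]
    exact hv.symm
  obtain ⟨K, _, _, _, α, hKdeg, hα⟩ := exists_numberField_sq_eq hsq
  obtain ⟨hKodd, hKU⟩ := unit_generates_of_odd_classNumber hodd h2 hKdeg hα hsq
  have : IsGalois k K := by
    have := Algebra.IsQuadraticExtension.mk (R := k) (S := K) hKdeg
    infer_instance
  have hd0 : d ≠ 0 := by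
    rintro rfl
    exact hd ⟨0, by simp⟩
  have hαi : IsIntegral ℤ α := by
    refine IsIntegral.of_pow two_pos ?_
    rw [hα]
    exact ((u : 𝓞 k).isIntegral_coe).algebraMap
  obtain ⟨x, hx⟩ := exists_norm_eq_of_odd_classNumber hKodd hKU hKdeg hd0
    (exists_relNorm_eq (span {d}) (by simpa using hd0) fun p hp hp0 hdp => by
      obtain ⟨h2p, c, hc⟩ := hu p hp (hdp (mem_span_singleton_self d))
      refine exists_relNorm_eq_of_sq_sub_mem hKdeg (α := ⟨α, hαi⟩) ?_ hsq hp0 h2p hc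
        fun h => hp.ne_top (Ideal.eq_top_of_isUnit_mem _ h u.isUnit)
      ext
      exact hα)
  obtain ⟨τ, hτ, hτα⟩ := exists_aut_apply_eq_neg hKdeg hα hsq
  obtain ⟨σ, hσ, hσs⟩ := exists_aut_apply_eq_neg hdeg hs hd
  have hα0 : α ≠ 0 := by
    rintro rfl
    rw [zero_pow two_ne_zero, eq_comm, map_eq_zero] at hα
    exact hsq ⟨0, by rw [mul_zero]; exact hα⟩
  obtain ⟨y, z, rfl⟩ := exists_eq_add_mul_of_finrank_two hKdeg hτ hα0 hτα x
  rw [algebraMap_norm_add_mul hKdeg hτ hα hτα] at hx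
  have hz : z ≠ 0 := by
    rintro rfl
    exact hd ⟨y, by rw [← hx]; ring⟩
  refine ⟨algebraMap k L (y / z) + algebraMap k L (1 / z) * s, ?_⟩
  rw [algebraMap_norm_add_mul hdeg hσ hs hσs, ← hx]
  field_simp
  ring

theorem exists_sq_sub_mem_of_mem_unitNorms [IsGalois k L] (hdeg : finrank k L = 2)
    {P : HeightOneSpectrum (𝓞 L)} (hP : P ∈ ramifiedPrimes k L) {u : (𝓞 k)ˣ}
    (hu : u ∈ unitNorms k L) : ∃ c : 𝓞 k, (u : 𝓞 k) - c ^ 2 ∈ P.asIdeal.under (𝓞 k) := by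
  have hnt : Nontrivial (L ≃ₐ[k] L) := by
    have : FiniteDimensional k L := FiniteDimensional.of_finrank_pos (by lia)
    rw [← Finite.one_lt_card_iff_nontrivial, IsGalois.card_aut_eq_finrank, hdeg]
    exact one_lt_two
  obtain ⟨σ, hσ⟩ := exists_ne (1 : L ≃ₐ[k] L)
  obtain ⟨z, hz⟩ := mem_unitNorms.1 hu
  have hu0 : algebraMap (𝓞 k) k u ≠ 0 := (u.isUnit.map (algebraMap (𝓞 k) k)).ne_zero
  have hzσ : z * σ z = algebraMap k L (u : 𝓞 k) := by
    rw [← AlgEquiv.algebraMap_norm_of_finrank_two hdeg hσ, hz]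
  have hz0 : z ≠ 0 := by
    rintro rfl
    rw [Algebra.norm_zero] at hz
    exact hu0 hz.symm
  obtain ⟨a, b, hab, hP'⟩ := exists_mul_eq_and_notMem P z
  have hab' : a * intAut σ a = algebraMap (𝓞 k) (𝓞 L) u * (b * intAut σ b) := by
    ext
    change (a : L) * σ a = algebraMap k L (u : 𝓞 k) * (b * σ b)
    rw [← hab, map_mul, ← hzσ]
    ring
  have hσP (x : 𝓞 L) := intAut_sub_mem_of_mem_ramifiedPrimes hdeg σ hP x
  have hP2 : a ^ 2 - algebraMap (𝓞 k) (𝓞 L) u * b ^ 2 ∈ P.asIdeal := by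
    have h1 := P.asIdeal.mul_mem_left a (hσP a)
    have h2 := P.asIdeal.mul_mem_left (algebraMap (𝓞 k) (𝓞 L) u * b) (hσP b)
    have h3 := sub_mem h2 h1
    have : algebraMap (𝓞 k) (𝓞 L) u * b * (intAut σ b - b) - a * (intAut σ a - a) =
        a ^ 2 - algebraMap (𝓞 k) (𝓞 L) u * b ^ 2 := by
      linear_combination -hab'
    rwa [this] at h3
  have hbP : b ∉ P.asIdeal := by
    intro hb
    have h1 : a ^ 2 ∈ P.asIdeal := by
      have := add_mem hP2 (P.asIdeal.mul_mem_left (algebraMap (𝓞 k) (𝓞 L) u)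
        (P.asIdeal.pow_mem_of_mem hb 2 two_pos))
      rwa [sub_add_cancel] at this
    exact hP'.elim (fun h => h (P.isPrime.mem_of_pow_mem 2 h1)) fun h => h hb
  obtain ⟨f, hf⟩ := P.isMaximal.exists_inv hbP
  obtain ⟨c, hc⟩ := exists_sub_mem_of_mem_ramifiedPrimes hdeg hP (f * a)
  refine ⟨c, ?_⟩
  rw [Ideal.mem_comap, map_sub, map_pow]
  obtain ⟨i, hi, hfi⟩ := hf
  have h1 := P.asIdeal.mul_mem_left (f ^ 2) hP2
  have h2 := P.asIdeal.mul_mem_left (f * a + algebraMap (𝓞 k) (𝓞 L) c) hc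
  have h3 := P.asIdeal.mul_mem_left (algebraMap (𝓞 k) (𝓞 L) u * (f * b + 1)) hi
  have h4 := sub_mem (add_mem h2 h3) h1
  convert h4 using 1
  linear_combination (-algebraMap (𝓞 k) (𝓞 L) u * (f * b + 1)) * hfi

end UnitNormCriterion

section QuadraticRamification

open Module Ideal IsDedekindDomain

variable {k K : Type*} [Field k] [Field K] [NumberField k] [NumberField K] [Algebra k K]

theorem mem_under_of_mem_ramifiedPrimes (hdeg : finrank k K = 2) {s : K} {σ : K ≃ₐ[k] K}
    {d t : 𝓞 k} (hs : s ^ 2 = algebraMap k K d) (hσ : σ s = -s) (ht : d = 1 + 4 * t)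
    {P : HeightOneSpectrum (𝓞 K)} (hP : P ∈ ramifiedPrimes k K) :
    d ∈ P.asIdeal.under (𝓞 k) := by
  have hsi : IsIntegral ℤ s := by
    refine IsIntegral.of_pow two_pos ?_
    rw [hs]
    exact (d.isIntegral_coe).algebraMap
  have hx : ((1 + s) / 2) * ((1 + s) / 2 - 1) = algebraMap k K t := by
    have h : s ^ 2 = 1 + 4 * algebraMap k K t := by
      rw [hs, ht]
      simp [map_ofNat]
    linear_combination h / 4
  have hxi : IsIntegral ℤ ((1 + s) / 2) := by
    have h1 : IsIntegral (𝓞 k) ((1 + s) / 2) := by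
      refine ⟨Polynomial.X * (Polynomial.X - 1) - Polynomial.C t, ?_, ?_⟩
      · monicity!
      · simp only [Polynomial.eval₂_sub, Polynomial.eval₂_mul, Polynomial.eval₂_X,
          Polynomial.eval₂_one, Polynomial.eval₂_C, hx]
        exact sub_self _
    exact isIntegral_trans _ h1
  let β : 𝓞 K := ⟨s, hsi⟩
  let x : 𝓞 K := ⟨(1 + s) / 2, hxi⟩
  have h1 := intAut_sub_mem_of_mem_ramifiedPrimes hdeg σ hP x
  have h2 : intAut σ x - x = -β := by
    ext
    change σ ((1 + s) / 2) - (1 + s) / 2 = -s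
    rw [map_div₀, map_add, hσ, map_one, map_ofNat]
    ring
  rw [h2, neg_mem_iff] at h1
  have h3 : algebraMap (𝓞 k) (𝓞 K) d = β ^ 2 := by
    ext
    exact hs.symm
  rw [Ideal.mem_comap, h3]
  exact P.asIdeal.pow_mem_of_mem h1 2 two_pos

theorem exists_mem_ramifiedPrimes_under_eq [IsGalois k K] (hdeg : finrank k K = 2) {s : K}
    {σ : K ≃ₐ[k] K} {d : 𝓞 k} (hs : s ^ 2 = algebraMap k K d) (hσ1 : σ ≠ 1) (hσ : σ s = -s)
    {p : Ideal (𝓞 k)} (hp : p.IsPrime) (hdp : d ∈ p) (hdp2 : d ∉ p ^ 2) :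
    ∃ P ∈ ramifiedPrimes k K, P.asIdeal.under (𝓞 k) = p := by
  have hp0 : p ≠ ⊥ := by
    rintro rfl
    exact hdp2 (by rw [(mem_bot.1 hdp : d = 0)]; exact zero_mem _)
  have hsi : IsIntegral ℤ s := by
    refine IsIntegral.of_pow two_pos ?_
    rw [hs]
    exact (d.isIntegral_coe).algebraMap
  let β : 𝓞 K := ⟨s, hsi⟩
  have hβ : algebraMap (𝓞 k) (𝓞 K) d = β ^ 2 := by
    ext
    exact hs.symm
  have hmax : p.IsMaximal := hp.isMaximal hp0
  obtain ⟨P, hPm, hPp⟩ := exists_maximal_ideal_liesOver_of_isIntegral (S := 𝓞 K) p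
  have hP0 : P ≠ ⊥ := ne_bot_of_liesOver_of_ne_bot hp0 P
  have hu : P.under (𝓞 k) = p := hPp.over.symm
  have hβP : β ∈ P := by
    refine hPm.isPrime.mem_of_pow_mem 2 ?_
    rw [← hβ]
    exact (hu ▸ hdp : d ∈ P.under (𝓞 k))
  have hnot : β ∉ p.map (algebraMap (𝓞 k) (𝓞 K)) := by
    intro h
    have h1 := Ideal.pow_mem_pow h 2
    rw [← hβ, ← Ideal.map_pow, ← Ideal.mem_comap,
      Ideal.comap_map_eq_self_of_faithfullyFlat] at h1
    exact hdp2 h1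
  rcases exists_map_eq_or_mul_intAut_eq hdeg hσ1 P hP0 with h | h
  · rw [hu] at h
    exact absurd (h ▸ hβP) hnot
  · rw [hu] at h
    have hQ : (P.map (intAut σ)).IsMaximal := by
      have := Ideal.map_isPrime_of_equiv (intAut σ) (I := P)
      refine this.isMaximal ?_
      rw [Ne, Ideal.map_eq_bot_iff_of_injective (intAut σ).injective]
      exact hP0
    have hβQ : β ∈ P.map (intAut σ) := by
      have h1 := Ideal.mem_map_of_mem (intAut σ) hβP
      have h2 : intAut σ β = -β := by
        ext
        exact hσ
      rwa [h2, neg_mem_iff] at h1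
    have hPQ : P.map (intAut σ) = P := by
      by_contra hne
      have hco : IsCoprime P (P.map (intAut σ)) :=
        Ideal.isCoprime_iff_sup_eq.2 (hPm.coprime_of_ne hQ (Ne.symm hne))
      rw [Ideal.mul_eq_inf_of_isCoprime hco] at h
      exact hnot (h ▸ ⟨hβP, hβQ⟩)
    refine ⟨⟨P, hPm.isPrime, hP0⟩, ?_, hu⟩
    change P ^ 2 = (P.under (𝓞 k)).map _
    rw [hu, ← h, hPQ, sq]

theorem card_ramifiedPrimes [IsGalois k K] (hdeg : finrank k K = 2) {s : K}
    {d t : 𝓞 k} (hs : s ^ 2 = algebraMap k K d) (hd : ¬ IsSquare (d : k)) (ht : d = 1 + 4 * t)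
    (hsf : ∀ p : Ideal (𝓞 k), p.IsPrime → d ∈ p → d ∉ p ^ 2) :
    Nat.card (ramifiedPrimes k K) = {p : Ideal (𝓞 k) | p.IsPrime ∧ d ∈ p}.ncard := by
  obtain ⟨σ, hσ1, hσ⟩ := exists_aut_apply_eq_neg hdeg hs hd
  rw [← Nat.card_coe_set_eq]
  refine Nat.card_congr (Equiv.ofBijective
    (fun P => ⟨P.1.asIdeal.under (𝓞 k), inferInstance,
      mem_under_of_mem_ramifiedPrimes hdeg hs hσ ht P.2⟩) ⟨?_, ?_⟩)
  · rintro ⟨P, hP⟩ ⟨Q, hQ⟩ h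
    simp only [Subtype.mk.injEq] at h ⊢
    have h2 : P.asIdeal ^ 2 = Q.asIdeal ^ 2 := by rw [hP, hQ, h]
    exact HeightOneSpectrum.ext (pow_left_injective two_ne_zero h2)
  · rintro ⟨p, hp, hdp⟩
    obtain ⟨P, hP, hPp⟩ := exists_mem_ramifiedPrimes_under_eq hdeg hs hσ1 hσ hp hdp (hsf p hp hdp)
    exact ⟨⟨P, hP⟩, Subtype.ext hPp⟩

end QuadraticRamification

section PrimesOverNine

open Module Ideal

theorem orderOf_of_mod_sixteen {l : ℕ} (hl : l % 16 = 9) (m : ℕ) :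
    orderOf (l : ZMod (2 ^ (m + 3))) = 2 ^ m := by
  obtain ⟨a, ha⟩ : ∃ a : ℕ, l = 1 + 2 ^ 3 * (2 * a + 1) := ⟨l / 16, by lia⟩
  have h := ZMod.orderOf_one_add_mul_prime_pow Nat.prime_two 3 (by simp) (by simp)
    (2 * (a : ℤ) + 1) (by lia) m
  rw [← h, ha]
  push_cast
  norm_num

variable (k : Type*) [Field k] [NumberField k]

theorem ncard_primes_of_mod_sixteen (m : ℕ) [IsCyclotomicExtension {2 ^ (m + 3)} ℚ k]
    {l : ℕ} (hl : l.Prime) (hl9 : l % 16 = 9) :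
    {p : Ideal (𝓞 k) | p.IsPrime ∧ (l : 𝓞 k) ∈ p}.ncard = 4 := by
  have : Fact l.Prime := ⟨hl⟩
  have : IsGalois ℚ k := IsCyclotomicExtension.isGalois {2 ^ (m + 3)} ℚ k
  have hn : ¬ l ∣ 2 ^ (m + 3) := fun h => by
    have := (Nat.prime_dvd_prime_iff_eq hl Nat.prime_two).1 (hl.dvd_of_dvd_pow h)
    lia
  have h0 : span {(l : ℤ)} ≠ ⊥ := by simpa using hl.ne_zero
  have hm : (span {(l : ℤ)}).IsMaximal := Int.ideal_span_isMaximal_of_prime l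
  have h := ncard_primesOver_mul_ramificationIdxIn_mul_inertiaDegIn (span {(l : ℤ)}) (𝓞 k) Gal(k/ℚ)
  rw [IsCyclotomicExtension.Rat.ramificationIdxIn_eq_of_not_dvd (m := 2 ^ (m + 3)) l k hn,
    IsCyclotomicExtension.Rat.inertiaDegIn_eq_of_not_dvd (m := 2 ^ (m + 3)) l k hn, one_mul,
    orderOf_of_mod_sixteen hl9, IsGaloisGroup.card_eq_finrank Gal(k/ℚ) ℚ k,
    finrank_of_two_pow k (m + 2)] at h
  have hset : {p : Ideal (𝓞 k) | p.IsPrime ∧ (l : 𝓞 k) ∈ p} =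
      primesOver (span {(l : ℤ)}) (𝓞 k) := by
    ext p
    refine ⟨fun hp => ⟨hp.1, liesOver_span_of_natCast_mem hl hp.1.ne_top hp.2⟩,
      fun hp => ⟨hp.1, ?_⟩⟩
    have h1 : (l : ℤ) ∈ p.under ℤ := hp.2.over ▸ mem_span_singleton_self _
    simpa using h1
  rw [hset]
  have : (2 : ℕ) ^ (m + 2) = 4 * 2 ^ m := by ring
  rw [this] at h
  exact Nat.eq_of_mul_eq_mul_right (by positivity) h

theorem natCast_notMem_sq_of_mod_sixteen (m : ℕ) [IsCyclotomicExtension {2 ^ (m + 3)} ℚ k]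
    {l : ℕ} (hl : l.Prime) (hl9 : l % 16 = 9)
    {p : Ideal (𝓞 k)} (hp : p.IsPrime) (hlp : (l : 𝓞 k) ∈ p) : (l : 𝓞 k) ∉ p ^ 2 := by
  have : Fact l.Prime := ⟨hl⟩
  have hn : ¬ l ∣ 2 ^ (m + 3) := fun h => by
    have := (Nat.prime_dvd_prime_iff_eq hl Nat.prime_two).1 (hl.dvd_of_dvd_pow h)
    lia
  have h0 : (span {(l : ℤ)}).map (algebraMap ℤ (𝓞 k)) ≠ ⊥ :=
    Ideal.map_ne_bot_of_ne_bot (by simpa using hl.ne_zero)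
  have := liesOver_span_of_natCast_mem hl hp.ne_top hlp
  have h := IsCyclotomicExtension.Rat.ramificationIdx_eq_of_not_dvd (m := 2 ^ (m + 3)) l k p hn
  rw [IsDedekindDomain.ramificationIdx_eq_multiplicity (span {(l : ℤ)}) p h0] at h
  intro h2
  have hp0 : p ≠ ⊥ := by
    rintro rfl
    simp [hl.ne_zero] at hlp
  have hfin : FiniteMultiplicity p ((span {(l : ℤ)}).map (algebraMap ℤ (𝓞 k))) :=
    FiniteMultiplicity.of_prime_left (Ideal.prime_of_isPrime hp0 hp) h0
  have h3 : p ^ 2 ∣ (span {(l : ℤ)}).map (algebraMap ℤ (𝓞 k)) := by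
    rw [Ideal.dvd_iff_le, Ideal.map_span, Set.image_singleton, span_singleton_le_iff_mem]
    simpa using h2
  have := hfin.le_multiplicity_of_pow_dvd h3
  lia

theorem exists_prime_natCast_mem {R : Type*} [CommRing R] {d : ℕ} (hd0 : d ≠ 0) {p : Ideal R}
    (hp : p.IsPrime) (hdp : (d : R) ∈ p) : ∃ l : ℕ, l.Prime ∧ l ∣ d ∧ (l : R) ∈ p := by
  induction d using Nat.recOnMul with
  | zero => exact absurd rfl hd0
  | one => exact absurd (Ideal.eq_top_of_isUnit_mem _ hdp (by simp)) hp.ne_top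
  | prime l hl => exact ⟨l, hl, dvd_rfl, hdp⟩
  | mul a b iha ihb =>
    rw [Nat.cast_mul] at hdp
    rcases hp.mem_or_mem hdp with h | h
    · obtain ⟨l, hl, hla, hlp⟩ := iha (left_ne_zero_of_mul hd0) h
      exact ⟨l, hl, hla.mul_right _, hlp⟩
    · obtain ⟨l, hl, hla, hlp⟩ := ihb (right_ne_zero_of_mul hd0) h
      exact ⟨l, hl, hla.mul_left _, hlp⟩

theorem eq_top_of_coprime_natCast_mem {R : Type*} [CommRing R] {a b : ℕ} (hab : a.Coprime b)
    {p : Ideal R} (ha : (a : R) ∈ p) (hb : (b : R) ∈ p) : p = ⊤ := by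
  obtain ⟨x, y, hxy⟩ := (Nat.isCoprime_iff_coprime.2 hab).map (Int.castRingHom R)
  rw [Ideal.eq_top_iff_one, ← hxy]
  exact add_mem (p.mul_mem_left _ (by simpa using ha)) (p.mul_mem_left _ (by simpa using hb))

variable {d : ℕ}

theorem natCast_notMem_sq (m : ℕ) [IsCyclotomicExtension {2 ^ (m + 3)} ℚ k]
    (hsf : Squarefree d) (hall : ∀ l : ℕ, l.Prime → l ∣ d → l % 16 = 9)
    {p : Ideal (𝓞 k)} (hp : p.IsPrime) (hdp : (d : 𝓞 k) ∈ p) : (d : 𝓞 k) ∉ p ^ 2 := by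
  obtain ⟨l, hl, ⟨e, rfl⟩, hlp⟩ := exists_prime_natCast_mem hsf.ne_zero hp hdp
  intro h2
  refine natCast_notMem_sq_of_mod_sixteen k m hl (hall l hl (dvd_mul_right _ _)) hp hlp ?_
  have hco : l.Coprime e := Nat.coprime_of_squarefree_mul hsf
  have he : (e : 𝓞 k) ∉ p := fun h => hp.ne_top (eq_top_of_coprime_natCast_mem hco hlp h)
  obtain ⟨x, y, hxy⟩ := (Nat.isCoprime_iff_coprime.2 hco).map (Int.castRingHom (𝓞 k))
  have : (l : 𝓞 k) = (x * l) * l + y * ((l * e : ℕ) : 𝓞 k) := by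
    have : x * (l : 𝓞 k) + y * (e : 𝓞 k) = 1 := by simpa using hxy
    push_cast
    linear_combination -(l : 𝓞 k) * this
  rw [this]
  refine add_mem ?_ (Ideal.mul_mem_left _ _ h2)
  rw [sq]
  exact Ideal.mul_mem_mul (p.mul_mem_left _ hlp) hlp

theorem ncard_primes_natCast_mem (m : ℕ) [IsCyclotomicExtension {2 ^ (m + 3)} ℚ k]
    (hsf : Squarefree d)
    (hall : ∀ l : ℕ, l.Prime → l ∣ d → l % 16 = 9) :
    {p : Ideal (𝓞 k) | p.IsPrime ∧ (d : 𝓞 k) ∈ p}.ncard = 4 * d.primeFactors.card := by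
  have hset : {p : Ideal (𝓞 k) | p.IsPrime ∧ (d : 𝓞 k) ∈ p} =
      ⋃ l ∈ d.primeFactors, {p : Ideal (𝓞 k) | p.IsPrime ∧ (l : 𝓞 k) ∈ p} := by
    ext p
    simp only [Set.mem_ofPred_eq, Set.mem_iUnion, exists_prop]
    constructor
    · rintro ⟨hp, h⟩
      obtain ⟨l, hl, hld, hlp⟩ := exists_prime_natCast_mem hsf.ne_zero hp h
      exact ⟨l, Nat.mem_primeFactors.2 ⟨hl, hld, hsf.ne_zero⟩, hp, hlp⟩
    · rintro ⟨l, hl, hp, hlp⟩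
      obtain ⟨e, rfl⟩ := Nat.dvd_of_mem_primeFactors hl
      refine ⟨hp, ?_⟩
      push_cast
      exact p.mul_mem_right _ hlp
  have h4 (l : ℕ) (hl : l ∈ d.primeFactors) :=
    ncard_primes_of_mod_sixteen k m (Nat.prime_of_mem_primeFactors hl)
      (hall l (Nat.prime_of_mem_primeFactors hl) (Nat.dvd_of_mem_primeFactors hl))
  rw [hset, ← Finset.set_biUnion_coe, d.primeFactors.finite_toSet.ncard_biUnion]
  · rw [finsum_mem_coe_finset, Finset.sum_congr rfl h4, Finset.sum_const, smul_eq_mul, mul_comm]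
  · exact fun l hl => Set.finite_of_ncard_pos (by rw [h4 l hl]; exact four_pos)
  · intro a ha b hb hab
    rw [Function.onFun, Set.disjoint_left]
    rintro p ⟨hp, hpa⟩ ⟨-, hpb⟩
    exact hp.ne_top (eq_top_of_coprime_natCast_mem ((Nat.coprime_primes
      (Nat.prime_of_mem_primeFactors ha) (Nat.prime_of_mem_primeFactors hb)).2 hab) hpa hpb)

theorem not_isSquare_natCast (hsf : Squarefree d) (hd1 : d ≠ 1) (m : ℕ)
    [IsCyclotomicExtension {2 ^ (m + 3)} ℚ k]
    (hall : ∀ l : ℕ, l.Prime → l ∣ d → l % 16 = 9) : ¬ IsSquare ((d : 𝓞 k) : k) := by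
  rintro ⟨s, hs⟩
  have hsi : IsIntegral ℤ s := by
    refine IsIntegral.of_pow two_pos ?_
    rw [sq, ← hs]
    exact (d : 𝓞 k).isIntegral_coe
  let β : 𝓞 k := ⟨s, hsi⟩
  have hβ : (d : 𝓞 k) = β ^ 2 := by
    ext
    rw [hs, sq]
    rfl
  obtain ⟨l, hl, hld⟩ := Nat.exists_prime_and_dvd hd1
  have h4 := ncard_primes_of_mod_sixteen k m hl (hall l hl hld)
  obtain ⟨p, hp, hlp⟩ := Set.nonempty_of_ncard_ne_zero (h4.trans_ne four_ne_zero)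
  have hdp : (d : 𝓞 k) ∈ p := by
    obtain ⟨e, rfl⟩ := hld
    push_cast
    exact p.mul_mem_right _ hlp
  refine natCast_notMem_sq k m hsf hall hp hdp ?_
  rw [hβ] at hdp ⊢
  exact Ideal.pow_mem_pow (hp.mem_of_pow_mem 2 hdp) 2

end PrimesOverNine

section ResidueSymbols

theorem exists_pow_two_pow_eq {l : ℕ} (hl : l % 16 = 9) (j : ℕ) :
    ∃ c, l ^ 2 ^ j = 1 + 2 ^ (j + 3) * (2 * c + 1) := by
  induction j with
  | zero => exact ⟨l / 16, by lia⟩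
  | succ j ih =>
    obtain ⟨c, hc⟩ := ih
    refine ⟨c + 2 ^ (j + 1) * (2 * c + 1) ^ 2, ?_⟩
    rw [pow_succ 2 j, pow_mul, hc]
    ring

theorem prod_one_sub_pow {R : Type*} [CommRing R] {l : ℕ} (hl : l % 16 = 9) (j : ℕ) {x : R}
    (hx : x ^ 2 ^ (j + 2) = -1) :
    ∏ i ∈ Finset.range (2 ^ j), (1 - x ^ l ^ i) = 1 - x ^ 2 ^ j := by
  induction j generalizing x with
  | zero => simp
  | succ j ih =>
    obtain ⟨c, hc⟩ := exists_pow_two_pow_eq hl j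
    have h1 : x ^ l ^ 2 ^ j = -x := by
      rw [hc, pow_add, pow_one, pow_mul, hx, Odd.neg_one_pow ⟨c, rfl⟩, mul_neg_one]
    have h2 (i : ℕ) : x ^ l ^ (2 ^ j + i) = -x ^ l ^ i := by
      rw [pow_add, pow_mul, h1, Odd.neg_pow (Odd.pow (Nat.odd_iff.2 (by lia)))]
    have h3 : (x ^ 2) ^ 2 ^ (j + 2) = -1 := by
      rw [← pow_mul, ← pow_succ']
      exact hx
    rw [pow_succ, mul_two, Finset.prod_range_add, ← Finset.prod_mul_distrib]
    simp only [h2]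
    rw [← mul_two, mul_comm (2 ^ j) 2, pow_mul, ← ih h3]
    refine Finset.prod_congr rfl fun i _ => ?_
    rw [← pow_mul, mul_comm 2, pow_mul]
    ring

theorem geom_sum_mul_half {l : ℕ} (hl : Odd l) (M : ℕ) :
    (∑ i ∈ Finset.range M, l ^ i) * (l / 2) = l ^ M / 2 := by
  obtain ⟨c, rfl⟩ := hl
  have h := geom_sum_mul (2 * (c : ℤ) + 1) M
  have h2 : (∑ i ∈ Finset.range M, (2 * c + 1) ^ i) * (2 * c) + 1 = (2 * c + 1) ^ M := by
    zify
    linear_combination h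
  rw [← h2, show (2 * c + 1) / 2 = c by lia]
  rw [show (∑ i ∈ Finset.range M, (2 * c + 1) ^ i) * (2 * c) =
    2 * ((∑ i ∈ Finset.range M, (2 * c + 1) ^ i) * c) by ring]
  lia

variable {F : Type*} [Field F] {l : ℕ}

theorem pow_half_eq_neg_one (hl : l % 16 = 9) (m : ℕ) {x : F} (hx : x ^ 2 ^ (m + 2) = -1) :
    x ^ (l ^ 2 ^ m / 2) = -1 := by
  obtain ⟨c, hc⟩ := exists_pow_two_pow_eq hl m
  have : l ^ 2 ^ m / 2 = 2 ^ (m + 2) * (2 * c + 1) := by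
    rw [hc, show 1 + 2 ^ (m + 3) * (2 * c + 1) = 1 + 2 * (2 ^ (m + 2) * (2 * c + 1)) by ring]
    lia
  rw [this, pow_mul, hx, Odd.neg_one_pow ⟨c, rfl⟩]

theorem pow_eq_self_of_pow_four (hl : l % 16 = 9) {z : F} (hz : z ^ 4 = -1) : z ^ l = z := by
  have : l = 8 * (l / 8) + 1 := by lia
  rw [this, pow_succ, pow_mul, show z ^ 8 = (z ^ 4) ^ 2 by ring, hz]
  simp

variable [CharP F l]

theorem two_ne_zero_of_mod_sixteen (hl : l % 16 = 9) : (2 : F) ≠ 0 := by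
  intro h
  have : l ∣ 2 := (CharP.cast_eq_zero_iff F l 2).1 (mod_cast h)
  have := Nat.le_of_dvd two_pos this
  lia

variable [Fact l.Prime]

theorem two_pow_quarter_sq (hl : l % 16 = 9) {z : F} (hz : z ^ 4 = -1) :
    ((2 : F) ^ ((l - 1) / 4)) ^ 2 = 1 := by
  have h2 := two_ne_zero_of_mod_sixteen (F := F) hl
  have hr : (z - z ^ 3) ^ 2 = 2 := by linear_combination (z ^ 2 - 2) * hz
  have hr0 : z - z ^ 3 ≠ 0 := fun h => h2 (by rw [← hr, h]; simp)
  have hrl : (z - z ^ 3) ^ l = z - z ^ 3 := by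
    rw [sub_pow_char, ← pow_mul, mul_comm 3, pow_mul, pow_eq_self_of_pow_four hl hz]
  have hl1 : l = 2 * ((l - 1) / 4 * 2) + 1 := by lia
  rw [← pow_mul, ← hr, ← pow_mul]
  rw [hl1, pow_succ] at hrl
  exact mul_right_cancel₀ hr0 (by rw [hrl, one_mul])

theorem one_add_add_sq_pow_half_of_pow_four (hl : l % 16 = 9) {z : F} (hz : z ^ 4 = -1) :
    (1 + z + z ^ 2) ^ (l / 2) = 2 ^ ((l - 1) / 4) := by
  have h2 := two_ne_zero_of_mod_sixteen (F := F) hl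
  have hzl := pow_eq_self_of_pow_four hl hz
  have hr : (z - z ^ 3) ^ 2 = 2 := by linear_combination (z ^ 2 - 2) * hz
  have hη : (1 + z + z ^ 2) * (z - z ^ 3) = (1 + z) ^ 2 := by linear_combination (-1 - z) * hz
  have h1z : 1 + z ≠ 0 := by
    intro h
    refine h2 ?_
    have : z - z ^ 3 = z * (1 - z) * (1 + z) := by ring
    rw [← hr, this, h]
    simp
  have h1 : (1 + z) ^ l = 1 + z := by
    rw [add_pow_char, one_pow, hzl]
  have hl1 : l = 2 * (l / 2) + 1 := by lia
  have h3 : (1 + z) ^ (2 * (l / 2)) = 1 := by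
    rw [hl1, pow_succ] at h1
    exact mul_right_cancel₀ h1z (by rw [h1, one_mul])
  rw [pow_mul, ← hη, mul_pow, show l / 2 = 2 * ((l - 1) / 4) by lia, pow_mul (z - z ^ 3), hr] at h3
  have h4 := two_pow_quarter_sq hl hz
  rw [show l / 2 = 2 * ((l - 1) / 4) by lia]
  linear_combination 2 ^ ((l - 1) / 4) * h3 - (1 + z + z ^ 2) ^ (2 * ((l - 1) / 4)) * h4

theorem one_sub_pow_geom_sum (hl : l % 16 = 9) (m : ℕ) {x : F} (hx : x ^ 2 ^ (m + 2) = -1) :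
    (1 - x) ^ (∑ i ∈ Finset.range (2 ^ m), l ^ i) = 1 - x ^ 2 ^ m := by
  rw [← prod_one_sub_pow hl m hx, ← Finset.prod_pow_eq_pow_sum]
  refine Finset.prod_congr rfl fun i _ => ?_
  rw [sub_pow_char_pow, one_pow]

theorem one_add_add_sq_pow_half (hl : l % 16 = 9) (m : ℕ) {x : F} (hx : x ^ 2 ^ (m + 2) = -1) :
    (1 + x + x ^ 2) ^ (l ^ 2 ^ m / 2) = 2 ^ ((l - 1) / 4) := by
  have h2 := two_ne_zero_of_mod_sixteen (F := F) hl
  have hz : (x ^ 2 ^ m) ^ 4 = -1 := by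
    rw [← hx, ← pow_mul]
    ring
  have hx3 : (x ^ 3) ^ 2 ^ (m + 2) = -1 := by
    rw [← pow_mul, mul_comm, pow_mul, hx]
    ring
  have h1 := one_sub_pow_geom_sum hl m hx
  have h3 := one_sub_pow_geom_sum hl m hx3
  have hz1 : 1 - x ^ 2 ^ m ≠ 0 := by
    intro h
    rw [← sub_eq_zero.1 h] at hz
    exact h2 (by linear_combination hz)
  rw [show 1 - x ^ 3 = (1 + x + x ^ 2) * (1 - x) by ring, mul_pow, h1] at h3
  have h4 : (1 + x + x ^ 2) ^ (∑ i ∈ Finset.range (2 ^ m), l ^ i) =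
      1 + x ^ 2 ^ m + (x ^ 2 ^ m) ^ 2 := by
    refine mul_right_cancel₀ hz1 ?_
    rw [h3]
    ring
  rw [← geom_sum_mul_half (Nat.odd_iff.2 (by lia)), pow_mul, h4,
    one_add_add_sq_pow_half_of_pow_four hl hz]

theorem two_pow_quarter_eq_one_iff (R : Type*) [CommRing R] [Nontrivial R] [CharP R l] :
    (2 : R) ^ ((l - 1) / 4) = 1 ↔ (2 : ZMod l) ^ ((l - 1) / 4) = 1 := by
  rw [← (ZMod.castHom (dvd_refl l) R).injective.eq_iff, map_pow, map_ofNat, map_one]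

theorem two_pow_quarter_eq_neg_one_iff (R : Type*) [CommRing R] [Nontrivial R] [CharP R l] :
    (2 : R) ^ ((l - 1) / 4) = -1 ↔ (2 : ZMod l) ^ ((l - 1) / 4) = -1 := by
  rw [← (ZMod.castHom (dvd_refl l) R).injective.eq_iff, map_pow, map_ofNat, map_neg, map_one]

end ResidueSymbols

section NormToEighth

open Module Ideal

theorem card_quotient_of_mod_sixteen {k : Type*} [Field k] [NumberField k] (m : ℕ)
    [IsCyclotomicExtension {2 ^ (m + 3)} ℚ k] {l : ℕ} (hl : l.Prime) (hl9 : l % 16 = 9)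
    {p : Ideal (𝓞 k)} (hp : p.IsPrime) (hlp : (l : 𝓞 k) ∈ p) :
    Nat.card (𝓞 k ⧸ p) = l ^ 2 ^ m := by
  have : Fact l.Prime := ⟨hl⟩
  have hn : ¬ l ∣ 2 ^ (m + 3) := fun h => by
    have := (Nat.prime_dvd_prime_iff_eq hl Nat.prime_two).1 (hl.dvd_of_dvd_pow h)
    lia
  have := liesOver_span_of_natCast_mem hl hp.ne_top hlp
  have h1 := IsCyclotomicExtension.Rat.inertiaDeg_eq_of_not_dvd (m := 2 ^ (m + 3)) l k p hn
  rw [orderOf_of_mod_sixteen hl9] at h1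
  have h0 : p ≠ ⊥ := by
    rintro rfl
    simp [hl.ne_zero] at hlp
  have hm := hp.isMaximal h0
  have h2 := pow_inertiaDeg (p := l) (P := p)
  rw [h1] at h2
  exact h2.symm

theorem charP_quotient_of_natCast_mem {R : Type*} [CommRing R] {l : ℕ} (hl : l.Prime)
    {p : Ideal R} (hp : p ≠ ⊤) (hlp : (l : R) ∈ p) : CharP (R ⧸ p) l := by
  have : Nontrivial (R ⧸ p) := Ideal.Quotient.nontrivial_iff.2 hp
  have h : ((l : ℕ) : R ⧸ p) = 0 := by
    rwa [← map_natCast (Ideal.Quotient.mk p), Ideal.Quotient.eq_zero_iff_mem]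
  exact ringChar.of_eq (CharP.ringChar_of_prime_eq_zero hl h)

theorem exists_algEquiv_apply_eq_pow (k₀ : Type*) {k : Type*} [Field k] [Field k₀] [NumberField k]
    [NumberField k₀] [Algebra k₀ k] (m : ℕ) [IsCyclotomicExtension {2 ^ (m + 3)} ℚ k]
    [IsCyclotomicExtension {2 ^ 3} ℚ k₀] {ζ : k} (hζ : IsPrimitiveRoot ζ (2 ^ (m + 3)))
    {l : ℕ} (hl9 : l % 16 = 9) : ∃ τ : k ≃ₐ[k₀] k, τ ζ = ζ ^ l := by
  have hco : l.Coprime (2 ^ (m + 3)) :=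
    Nat.Coprime.pow_right _ (Nat.odd_iff.2 (by lia)).coprime_two_right
  obtain ⟨τ, hτ⟩ : ∃ τ : k ≃ₐ[ℚ] k, τ ζ = ζ ^ l := by
    have h := Polynomial.cyclotomic.irreducible_rat (n := 2 ^ (m + 3)) (by positivity)
    have hζl := hζ.pow_of_coprime l hco
    have hmin : minpoly ℚ (hζ.powerBasis ℚ).gen = minpoly ℚ (hζl.powerBasis ℚ).gen := by
      rw [hζ.powerBasis_gen ℚ, hζl.powerBasis_gen ℚ,
        ← IsPrimitiveRoot.minpoly_eq_cyclotomic_of_irreducible hζ h,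
        ← IsPrimitiveRoot.minpoly_eq_cyclotomic_of_irreducible hζl h]
    refine ⟨(hζ.powerBasis ℚ).equivOfMinpoly (hζl.powerBasis ℚ) hmin, ?_⟩
    have h1 := (hζ.powerBasis ℚ).equivOfMinpoly_gen (hζl.powerBasis ℚ) hmin
    exact (congrArg _ (hζ.powerBasis_gen ℚ).symm).trans (h1.trans (hζl.powerBasis_gen ℚ))
  have hz := IsCyclotomicExtension.zeta_spec (2 ^ 3) ℚ k₀
  set z := IsCyclotomicExtension.zeta (2 ^ 3) ℚ k₀
  have hτz : τ (algebraMap k₀ k z) = algebraMap k₀ k z := by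
    obtain ⟨i, -, hi⟩ := hζ.eq_pow_of_pow_eq_one (ξ := algebraMap k₀ k z) (by
      rw [← map_pow, pow_add, mul_comm, pow_mul, hz.pow_eq_one, one_pow, map_one])
    rw [← hi, map_pow, hτ, ← pow_mul, mul_comm, pow_mul, hi, ← map_pow,
      show l = 2 ^ 3 * (l / 8) + 1 by lia, pow_succ, pow_mul, hz.pow_eq_one, one_pow, one_mul]
  have hfix : (τ.toAlgHom.comp (IsScalarTower.toAlgHom ℚ k₀ k)) = IsScalarTower.toAlgHom ℚ k₀ k :=
    (hz.powerBasis ℚ).algHom_ext (by simpa using hτz)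
  exact ⟨AlgEquiv.ofRingEquiv (f := τ.toRingEquiv) fun x => DFunLike.congr_fun hfix x, hτ⟩

variable {k₀ k : Type*} [Field k] [Field k₀] [NumberField k]
    [NumberField k₀] [Algebra k₀ k] (m : ℕ) [IsCyclotomicExtension {2 ^ (m + 3)} ℚ k]
    [IsCyclotomicExtension {2 ^ 3} ℚ k₀]

theorem algebraMap_norm_eq_prod_pow {ζ : k} (hζ : IsPrimitiveRoot ζ (2 ^ (m + 3)))
    {l : ℕ} (hl9 : l % 16 = 9) {τ : k ≃ₐ[k₀] k} (hτ : τ ζ = ζ ^ l) (x : k) :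
    algebraMap k₀ k (Algebra.norm k₀ x) = ∏ i ∈ Finset.range (2 ^ m), (τ ^ i) x := by
  have : IsGalois ℚ k := IsCyclotomicExtension.isGalois {2 ^ (m + 3)} ℚ k
  have : IsGalois k₀ k := IsGalois.tower_top_of_isGalois ℚ k₀ k
  have hpow (i : ℕ) : (τ ^ i) ζ = ζ ^ l ^ i := by
    induction i with
    | zero => simp
    | succ i ih => rw [pow_succ', AlgEquiv.mul_apply, ih, map_pow, hτ, ← pow_mul, pow_succ']
  have hord : orderOf τ = 2 ^ m := by
    rw [← orderOf_of_mod_sixteen hl9, orderOf_eq_orderOf_iff]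
    intro i
    have hfin : IsOfFinOrder ζ := hζ.isOfFinOrder (by positivity)
    have h1 : (l : ZMod (2 ^ (m + 3))) ^ i = 1 ↔ ζ ^ l ^ i = ζ := by
      rw [← Nat.cast_pow, ← Nat.cast_one, ZMod.natCast_eq_natCast_iff, hζ.eq_orderOf,
        ← IsOfFinOrder.pow_eq_pow_iff_modEq hfin, pow_one]
    rw [h1, ← hpow]
    refine ⟨fun h => by rw [h]; rfl, fun h => ?_⟩
    have h2 : ((τ ^ i).toAlgHom.restrictScalars ℚ) = AlgHom.id ℚ k :=
      (hζ.powerBasis ℚ).algHom_ext (by simpa using h)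
    ext x
    exact DFunLike.congr_fun h2 x
  have hcard : Nat.card (k ≃ₐ[k₀] k) = 2 ^ m := by
    rw [IsGalois.card_aut_eq_finrank]
    have h := finrank_mul_finrank ℚ k₀ k
    rw [finrank_of_two_pow k₀ 2, finrank_of_two_pow k (m + 2), add_comm, pow_add] at h
    exact Nat.eq_of_mul_eq_mul_left (by positivity) h
  classical
  have hgen (σ : k ≃ₐ[k₀] k) : σ ∈ Subgroup.zpowers τ := by
    have : Subgroup.zpowers τ = ⊤ := Subgroup.eq_top_of_card_eq _ (by
      rw [Nat.card_zpowers, hord, hcard])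
    rw [this]
    trivial
  rw [Algebra.norm_eq_prod_automorphisms, ← hord, ← IsCyclic.image_range_orderOf hgen,
    Finset.prod_image]
  intro i hi j hj hij
  exact pow_injOn_Iio_orderOf (by simpa using hi) (by simpa using hj) hij

end NormToEighth

section ResidueOfNorm

open Module Ideal

variable {k₀ k : Type*} [Field k] [Field k₀] [NumberField k] [Algebra k₀ k]

theorem mk_intAut_eq_pow (m : ℕ) [IsCyclotomicExtension {2 ^ (m + 3)} ℚ k]
    {ζ : k} (hζ : IsPrimitiveRoot ζ (2 ^ (m + 3))) {l : ℕ} (hl : l.Prime)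
    {τ : k ≃ₐ[k₀] k} (hτ : τ ζ = ζ ^ l) {p : Ideal (𝓞 k)} (hp : p ≠ ⊤) (hlp : (l : 𝓞 k) ∈ p)
    (x : 𝓞 k) : Ideal.Quotient.mk p (intAut τ x) = Ideal.Quotient.mk p x ^ l := by
  have : Fact l.Prime := ⟨hl⟩
  have := charP_quotient_of_natCast_mem hl hp hlp
  let f : 𝓞 k →ₐ[ℤ] 𝓞 k ⧸ p :=
    ((Ideal.Quotient.mk p).comp (intAut τ : 𝓞 k →+* 𝓞 k)).toIntAlgHom
  let g : 𝓞 k →ₐ[ℤ] 𝓞 k ⧸ p :=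
    ((frobenius (𝓞 k ⧸ p) l).comp (Ideal.Quotient.mk p)).toIntAlgHom
  have hfg : f = g := by
    refine AlgHom.ext_of_adjoin_eq_top
      (IsCyclotomicExtension.Rat.adjoin_singleton_eq_top (n := 2 ^ (m + 3)) hζ) ?_
    rintro _ rfl
    change Ideal.Quotient.mk p (intAut τ hζ.toInteger) = Ideal.Quotient.mk p hζ.toInteger ^ l
    rw [← map_pow]
    congr 1
    ext
    exact hτ
  exact DFunLike.congr_fun hfg x

theorem mk_intAut_pow_eq_pow (m : ℕ) [IsCyclotomicExtension {2 ^ (m + 3)} ℚ k]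
    {ζ : k} (hζ : IsPrimitiveRoot ζ (2 ^ (m + 3))) {l : ℕ} (hl : l.Prime)
    {τ : k ≃ₐ[k₀] k} (hτ : τ ζ = ζ ^ l) {p : Ideal (𝓞 k)} (hp : p ≠ ⊤) (hlp : (l : 𝓞 k) ∈ p)
    (x : 𝓞 k) (i : ℕ) :
    Ideal.Quotient.mk p (intAut (τ ^ i) x) = Ideal.Quotient.mk p x ^ l ^ i := by
  induction i with
  | zero =>
    rw [pow_zero, pow_zero, pow_one]
    congr 1
  | succ i ih =>
    have h : intAut (τ ^ (i + 1)) x = intAut τ (intAut (τ ^ i) x) := by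
      ext
      change (τ ^ (i + 1)) (x : k) = τ ((τ ^ i) (x : k))
      rw [pow_succ', AlgEquiv.mul_apply]
    rw [h, mk_intAut_eq_pow m hζ hl hτ hp hlp, ih, ← pow_mul, pow_succ]

theorem mk_norm_eq_pow [NumberField k₀] (m : ℕ) [IsCyclotomicExtension {2 ^ (m + 3)} ℚ k]
    [IsCyclotomicExtension {2 ^ 3} ℚ k₀]
    {l : ℕ} (hl : l.Prime) (hl9 : l % 16 = 9) {p : Ideal (𝓞 k)} (hp : p ≠ ⊤)
    (hlp : (l : 𝓞 k) ∈ p) (x : 𝓞 k) :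
    Ideal.Quotient.mk p (algebraMap (𝓞 k₀) (𝓞 k) (RingOfIntegers.norm k₀ x)) =
      Ideal.Quotient.mk p x ^ (∑ i ∈ Finset.range (2 ^ m), l ^ i) := by
  have hζ := IsCyclotomicExtension.zeta_spec (2 ^ (m + 3)) ℚ k
  obtain ⟨τ, hτ⟩ := exists_algEquiv_apply_eq_pow k₀ m hζ hl9
  have h : algebraMap (𝓞 k₀) (𝓞 k) (RingOfIntegers.norm k₀ x) =
      ∏ i ∈ Finset.range (2 ^ m), intAut (τ ^ i) x := by
    ext
    have h1 := algebraMap_norm_eq_prod_pow m hζ hl9 hτ (x : k)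
    refine h1.trans ?_
    exact (map_prod (algebraMap (𝓞 k) k) (fun i => intAut (τ ^ i) x) _).symm
  rw [h, map_prod, ← Finset.prod_pow_eq_pow_sum]
  exact Finset.prod_congr rfl fun i _ => mk_intAut_pow_eq_pow m hζ hl hτ hp hlp x i

theorem mk_algebraMap_pow_eq [NumberField k₀] (m : ℕ) [IsCyclotomicExtension {2 ^ (m + 3)} ℚ k]
    [IsCyclotomicExtension {2 ^ 3} ℚ k₀]
    {l : ℕ} (hl : l.Prime) (hl9 : l % 16 = 9) {p : Ideal (𝓞 k)}
    (hp : p ≠ ⊤) (hlp : (l : 𝓞 k) ∈ p) (v : 𝓞 k₀) :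
    Ideal.Quotient.mk p (algebraMap (𝓞 k₀) (𝓞 k) v) ^ l =
      Ideal.Quotient.mk p (algebraMap (𝓞 k₀) (𝓞 k) v) := by
  have hζ := IsCyclotomicExtension.zeta_spec (2 ^ (m + 3)) ℚ k
  obtain ⟨τ, hτ⟩ := exists_algEquiv_apply_eq_pow k₀ m hζ hl9
  rw [← mk_intAut_eq_pow m hζ hl hτ hp hlp, AlgEquiv.commutes]

theorem mk_sq_pow_half_eq_one [NumberField k₀] (m : ℕ) [IsCyclotomicExtension {2 ^ (m + 3)} ℚ k]
    [IsCyclotomicExtension {2 ^ 3} ℚ k₀]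
    {l : ℕ} (hl : l.Prime) (hl9 : l % 16 = 9) {p : Ideal (𝓞 k)}
    (hp : p.IsPrime) (hlp : (l : 𝓞 k) ∈ p) (v : (𝓞 k₀)ˣ) :
    Ideal.Quotient.mk p (algebraMap (𝓞 k₀) (𝓞 k) (v ^ 2 : (𝓞 k₀)ˣ)) ^ (l / 2) = 1 := by
  have h := mk_algebraMap_pow_eq (k₀ := k₀) m hl hl9 hp.ne_top hlp v
  have hu : IsUnit (Ideal.Quotient.mk p (algebraMap (𝓞 k₀) (𝓞 k) v)) :=
    (v.isUnit.map _).map _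
  have hl1 : l = 2 * (l / 2) + 1 := by lia
  rw [Units.val_pow_eq_pow_val, map_pow, map_pow, ← pow_mul]
  rw [hl1, pow_succ] at h
  exact hu.mul_right_cancel (by rw [h, one_mul])

end ResidueOfNorm

section Klein

variable {Q : Type*} [CommGroup Q] {x y : Q}

open scoped Classical in
theorem card_finset_klein (hx : x ≠ 1) (hy : y ≠ 1) (hxy : x * y ≠ 1) (hx2 : x ^ 2 = 1) :
    ({1, x, y, x * y} : Finset Q).card = 4 := by
  have hne : x ≠ y := fun h => hxy (by rw [← h, ← sq, hx2])
  rw [Finset.card_insert_of_notMem, Finset.card_insert_of_notMem, Finset.card_insert_of_notMem,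
    Finset.card_singleton]
  · simpa using hx
  · simpa [hne] using hy
  · simp only [Finset.mem_insert, Finset.mem_singleton, not_or]
    exact ⟨hx.symm, hy.symm, hxy.symm⟩

theorem eq_or_eq_of_card_eq_four (hx : x ≠ 1) (hy : y ≠ 1) (hxy : x * y ≠ 1) (hx2 : x ^ 2 = 1)
    (hQ : Nat.card Q = 4) (g : Q) : g = 1 ∨ g = x ∨ g = y ∨ g = x * y := by
  classical
  have : Finite Q := Nat.finite_of_card_ne_zero (by lia)
  have : Fintype Q := Fintype.ofFinite Q
  have h : ({1, x, y, x * y} : Finset Q) = Finset.univ := by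
    rw [← Finset.card_eq_iff_eq_univ, card_finset_klein hx hy hxy hx2, ← hQ,
      Nat.card_eq_fintype_card]
  have hg := Finset.mem_univ g
  rw [← h] at hg
  simpa using hg

theorem card_eq_four_of_forall (hx : x ≠ 1) (hy : y ≠ 1) (hxy : x * y ≠ 1) (hx2 : x ^ 2 = 1)
    (hQ : ∀ g : Q, g = 1 ∨ g = x ∨ g = y ∨ g = x * y) : Nat.card Q = 4 := by
  classical
  rw [← card_finset_klein hx hy hxy hx2, ← Nat.card_eq_finsetCard]
  exact Nat.card_congr (Equiv.subtypeUnivEquiv fun g => by simpa using hQ g).symm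

theorem card_eq_two_of_forall (hx : x ≠ 1) (hx2 : x ^ 2 = 1) (hy : y = 1 ∨ x * y = 1)
    (hQ : ∀ g : Q, g = 1 ∨ g = x ∨ g = y ∨ g = x * y) : Nat.card Q = 2 := by
  refine (Nat.card_eq_two_iff' (1 : Q)).2 ⟨x, hx, fun g hg => ?_⟩
  have h := hQ g
  rcases hy with rfl | hy
  · rw [mul_one] at h
    tauto
  · have hyx : y = x := mul_left_cancel (a := x) (by rw [hy, ← sq, hx2])
    rw [hy, hyx] at h
    tauto

end Klein

section UnitsModSquares

open Module Ideal

theorem IsPrimitiveRoot.pow_two_pow_eq_neg_one {R : Type*} [CommRing R] [IsDomain R] {x : R} {i : ℕ}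
    (hx : IsPrimitiveRoot x (2 ^ (i + 1))) : x ^ 2 ^ i = -1 := by
  have h : IsPrimitiveRoot (x ^ 2 ^ i) 2 := hx.pow (by positivity) (by rw [pow_succ])
  exact h.eq_neg_one_of_two_right

theorem index_range_sq_units (k₀ : Type*) [Field k₀] [NumberField k₀]
    [IsCyclotomicExtension {2 ^ 3} ℚ k₀] :
    (powMonoidHom 2 : (𝓞 k₀)ˣ →* (𝓞 k₀)ˣ).range.index = 4 := by
  have hinj : Function.Injective (unitsIncl k₀) :=
    Units.map_injective (FaithfulSMul.algebraMap_injective _ _)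
  have h := AddSubgroup.index_range_nsmul_eq_pow_mul_card (Additive (𝓞 k₀)ˣ) two_ne_zero
  have e1 : (nsmulAddMonoidHom 2 : Additive (𝓞 k₀)ˣ →+ Additive (𝓞 k₀)ˣ).range.index
      = (powMonoidHom 2 : (𝓞 k₀)ˣ →* (𝓞 k₀)ˣ).range.index := rfl
  have e2 : Nat.card (nsmulAddMonoidHom 2 : Additive (𝓞 k₀)ˣ →+ Additive (𝓞 k₀)ˣ).ker = 2 := by
    refine Eq.trans ?_ (card_subgroup_sq_eq_one (unitsIncl k₀).range ⟨-1, by ext; simp⟩)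
    refine Nat.card_congr ((MonoidHom.ofInjective hinj).toEquiv.subtypeEquiv fun u => ?_)
    change u ^ 2 = 1 ↔ MonoidHom.ofInjective hinj u ^ 2 = 1
    rw [← map_pow, map_eq_one_iff _ (MonoidHom.ofInjective hinj).injective]
  have := isTotallyComplex_of_two_pow k₀ (n := 3) (by lia)
  have h1 := IsTotallyComplex.finrank k₀
  have h2 : finrank ℚ k₀ = 4 := finrank_of_two_pow k₀ 2
  have h3 : Units.rank k₀ = 1 := by
    rw [Units.rank, InfinitePlace.card_eq_nrRealPlaces_add_nrComplexPlaces,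
      IsTotallyComplex.nrRealPlaces_eq_zero k₀]
    lia
  rw [e1, e2, Units.finrank_eq, h3] at h
  exact h

theorem not_isSquare_of_pow_half_ne_one {k₀ : Type*} [Field k₀] [NumberField k₀]
    [IsCyclotomicExtension {2 ^ 3} ℚ k₀] {l : ℕ} (hl : l.Prime) (hl9 : l % 16 = 9) {u : (𝓞 k₀)ˣ}
    (hu : ∀ p : Ideal (𝓞 k₀), p.IsPrime → (l : 𝓞 k₀) ∈ p →
      Ideal.Quotient.mk p (u : 𝓞 k₀) ^ (l / 2) = -1) :
    u ∉ (powMonoidHom 2 : (𝓞 k₀)ˣ →* (𝓞 k₀)ˣ).range := by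
  rintro ⟨v, rfl⟩
  have : Fact l.Prime := ⟨hl⟩
  have : IsCyclotomicExtension {2 ^ (0 + 3)} ℚ k₀ :=
    inferInstanceAs (IsCyclotomicExtension {2 ^ 3} ℚ k₀)
  have hne : {p : Ideal (𝓞 k₀) | p.IsPrime ∧ (l : 𝓞 k₀) ∈ p}.Nonempty := by
    refine Set.nonempty_of_ncard_ne_zero ?_
    rw [ncard_primes_of_mod_sixteen k₀ 0 hl hl9]
    decide
  obtain ⟨p, hp, hlp⟩ := hne
  have : CharP (𝓞 k₀ ⧸ p) l := charP_quotient_of_natCast_mem hl hp.ne_top hlp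
  have h := mk_sq_pow_half_eq_one (k₀ := k₀) 0 hl hl9 hp hlp v
  have h2 : Ideal.Quotient.mk p (v ^ 2 : (𝓞 k₀)ˣ) ^ (l / 2) = 1 := h
  have hd : Nontrivial (𝓞 k₀ ⧸ p) := Ideal.Quotient.nontrivial_iff.2 hp.ne_top
  have h3 := hu p hp hlp
  rw [powMonoidHom_apply, h2, eq_neg_iff_add_eq_zero, one_add_one_eq_two] at h3
  have h4 : l ∣ 2 := (CharP.cast_eq_zero_iff (𝓞 k₀ ⧸ p) l 2).1 (mod_cast h3)
  have := Nat.le_of_dvd two_pos h4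
  lia

variable {R : Type*} [CommRing R] {p : Ideal R} {l : ℕ}

theorem mk_pow_half_eq_neg_one (hp : p.IsMaximal) (hl9 : l % 16 = 9) (m : ℕ) {x : R}
    (hx : x ^ 2 ^ (m + 2) = -1) : Ideal.Quotient.mk p x ^ (l ^ 2 ^ m / 2) = -1 := by
  let _ := Ideal.Quotient.field p
  exact pow_half_eq_neg_one hl9 m (by rw [← map_pow, hx, map_neg, map_one])

theorem mk_one_add_add_sq_pow_half (hp : p.IsMaximal) (hl : l.Prime) (hlp : (l : R) ∈ p)
    (hl9 : l % 16 = 9) (m : ℕ) {x : R} (hx : x ^ 2 ^ (m + 2) = -1) :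
    Ideal.Quotient.mk p (1 + x + x ^ 2) ^ (l ^ 2 ^ m / 2) = 2 ^ ((l - 1) / 4) := by
  have : Fact l.Prime := ⟨hl⟩
  have := charP_quotient_of_natCast_mem hl hp.ne_top hlp
  let _ := Ideal.Quotient.field p
  rw [map_add, map_add, map_one, map_pow]
  exact one_add_add_sq_pow_half hl9 m (by rw [← map_pow, hx, map_neg, map_one])

theorem isMaximal_of_natCast_mem {K : Type*} [Field K] [NumberField K] {p : Ideal (𝓞 K)}
    (hp : p.IsPrime) (hl : l ≠ 0) (hlp : (l : 𝓞 K) ∈ p) : p.IsMaximal :=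
  hp.isMaximal fun h => hl (by rw [h] at hlp; exact_mod_cast (Ideal.mem_bot.1 hlp))

theorem exists_eq_sq_mul {k₀ : Type*} [Field k₀] [NumberField k₀]
    [IsCyclotomicExtension {2 ^ 3} ℚ k₀] {z η : (𝓞 k₀)ˣ} (hz : (z : 𝓞 k₀) ^ 4 = -1)
    (hη : (η : 𝓞 k₀) = 1 + z + z ^ 2) (w : (𝓞 k₀)ˣ) :
    ∃ v g : (𝓞 k₀)ˣ, w = v ^ 2 * g ∧ (g = 1 ∨ g = z ∨ g = η ∨ g = z * η) := by
  set S := (powMonoidHom 2 : (𝓞 k₀)ˣ →* (𝓞 k₀)ˣ).range with hS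
  have hp41 : Nat.Prime 41 := by norm_num
  have h41 : (2 : ZMod 41) ^ ((41 - 1) / 4) = -1 := by decide
  have h73 : (2 : ZMod 73) ^ ((73 - 1) / 4) = 1 := by decide
  have hp73 : Nat.Prime 73 := by norm_num
  have hchar (l : ℕ) (hl : l.Prime) (hl9 : l % 16 = 9) (p : Ideal (𝓞 k₀)) (hp : p.IsPrime)
      (hlp : (l : 𝓞 k₀) ∈ p) : Ideal.Quotient.mk p (z : 𝓞 k₀) ^ (l / 2) = -1 ∧
      Ideal.Quotient.mk p (η : 𝓞 k₀) ^ (l / 2) = 2 ^ ((l - 1) / 4) := by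
    have hm := isMaximal_of_natCast_mem hp hl.ne_zero hlp
    have h1 := mk_pow_half_eq_neg_one hm hl9 0 (x := (z : 𝓞 k₀)) (by simpa using hz)
    have h2 := mk_one_add_add_sq_pow_half hm hl hlp hl9 0 (x := (z : 𝓞 k₀)) (by simpa using hz)
    rw [← hη] at h2
    rw [pow_zero, pow_one] at h1 h2
    exact ⟨h1, h2⟩
  have h1 : z ∉ S := not_isSquare_of_pow_half_ne_one hp41 (by norm_num) fun p hp hlp =>
    (hchar 41 hp41 (by norm_num) p hp hlp).1
  have h2 : η ∉ S := not_isSquare_of_pow_half_ne_one hp41 (by norm_num) fun p hp hlp => by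
    have : Fact (Nat.Prime 41) := ⟨hp41⟩
    have := charP_quotient_of_natCast_mem hp41 hp.ne_top hlp
    have : Nontrivial (𝓞 k₀ ⧸ p) := Ideal.Quotient.nontrivial_iff.2 hp.ne_top
    rw [(hchar 41 hp41 (by norm_num) p hp hlp).2]
    exact (two_pow_quarter_eq_neg_one_iff _).2 h41
  have h3 : z * η ∉ S := not_isSquare_of_pow_half_ne_one hp73 (by norm_num) fun p hp hlp => by
    have : Fact (Nat.Prime 73) := ⟨hp73⟩
    have := charP_quotient_of_natCast_mem hp73 hp.ne_top hlp
    have : Nontrivial (𝓞 k₀ ⧸ p) := Ideal.Quotient.nontrivial_iff.2 hp.ne_top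
    have h := hchar 73 hp73 (by norm_num) p hp hlp
    rw [Units.val_mul, map_mul, mul_pow, h.1, h.2,
      (two_pow_quarter_eq_one_iff (l := 73) (𝓞 k₀ ⧸ p)).2 h73, mul_one]
  have hne (g : (𝓞 k₀)ˣ) (hg : g ∉ S) : (g : (𝓞 k₀)ˣ ⧸ S) ≠ 1 := fun h =>
    hg ((QuotientGroup.eq_one_iff g).1 h)
  have key := eq_or_eq_of_card_eq_four (hne z h1) (hne η h2) (hne _ h3)
    ((QuotientGroup.eq_one_iff (z ^ 2)).2 ⟨z, rfl⟩) (index_range_sq_units k₀) (w : (𝓞 k₀)ˣ ⧸ S)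
  have hex (g : (𝓞 k₀)ˣ) (hg : (w : (𝓞 k₀)ˣ ⧸ S) = g) : ∃ v : (𝓞 k₀)ˣ, w = v ^ 2 * g := by
    obtain ⟨v, hv⟩ := QuotientGroup.eq.1 hg.symm
    exact ⟨v, by rw [show v ^ 2 = g⁻¹ * w from hv, mul_comm, mul_inv_cancel_left]⟩
  rcases key with h | h | h | h
  · obtain ⟨v, hv⟩ := hex 1 h
    exact ⟨v, 1, hv, by simp⟩
  · obtain ⟨v, hv⟩ := hex z h
    exact ⟨v, z, hv, by simp⟩
  · obtain ⟨v, hv⟩ := hex η h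
    exact ⟨v, η, hv, by simp⟩
  · obtain ⟨v, hv⟩ := hex (z * η) h
    exact ⟨v, z * η, hv, by simp⟩

end UnitsModSquares

section UnitNormIndex

open Module Ideal

theorem exists_units_two_pow_root (k : Type*) [Field k] [NumberField k] (m : ℕ)
    [IsCyclotomicExtension {2 ^ (m + 3)} ℚ k] :
    ∃ x θ : (𝓞 k)ˣ, (x : 𝓞 k) ^ 2 ^ (m + 2) = -1 ∧ (θ : 𝓞 k) = 1 + x + x ^ 2 := by
  have hζ := (IsCyclotomicExtension.zeta_spec (2 ^ (m + 3)) ℚ k).toInteger_isPrimitiveRoot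
  have h2 : 2 ≤ 2 ^ (m + 3) := by
    rw [pow_succ]
    have := Nat.one_le_two_pow (n := m + 2)
    lia
  obtain ⟨x, hx⟩ := hζ.isUnit (by positivity)
  obtain ⟨θ, hθ⟩ := hζ.geom_sum_isUnit (j := 3) h2 (Nat.Coprime.pow_right _ (by norm_num))
  refine ⟨x, θ, ?_, ?_⟩
  · rw [hx]
    exact hζ.pow_two_pow_eq_neg_one
  · rw [hθ, hx]
    simp [Finset.sum_range_succ]

theorem exists_pow_half_eq_of_algebra (k₀ : Type*) {k : Type*} [Field k] [Field k₀] [NumberField k]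
    [NumberField k₀] [Algebra k₀ k] (m : ℕ) [IsCyclotomicExtension {2 ^ (m + 3)} ℚ k]
    [IsCyclotomicExtension {2 ^ 3} ℚ k₀] {x θ : (𝓞 k)ˣ} (hx : (x : 𝓞 k) ^ 2 ^ (m + 2) = -1)
    (hθ : (θ : 𝓞 k) = 1 + x + x ^ 2) (u : (𝓞 k)ˣ) :
    ∃ g : (𝓞 k)ˣ, (g = 1 ∨ g = x ∨ g = θ ∨ g = x * θ) ∧
      ∀ l : ℕ, l.Prime → l % 16 = 9 → ∀ p : Ideal (𝓞 k), p.IsPrime → (l : 𝓞 k) ∈ p →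
        Ideal.Quotient.mk p (u : 𝓞 k) ^ (l ^ 2 ^ m / 2) =
          Ideal.Quotient.mk p (g : 𝓞 k) ^ (l ^ 2 ^ m / 2) := by
  have : IsCyclotomicExtension {2 ^ (0 + 3)} ℚ k₀ :=
    inferInstanceAs (IsCyclotomicExtension {2 ^ 3} ℚ k₀)
  obtain ⟨z, η, hz, hη⟩ := exists_units_two_pow_root k₀ 0
  obtain ⟨v, g₀, hw, hg₀⟩ := exists_eq_sq_mul hz hη (Units.map (RingOfIntegers.norm k₀) u)
  have hu (l : ℕ) (hl : l.Prime) (hl9 : l % 16 = 9) (p : Ideal (𝓞 k)) (hp : p.IsPrime)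
      (hlp : (l : 𝓞 k) ∈ p) : Ideal.Quotient.mk p (u : 𝓞 k) ^ (l ^ 2 ^ m / 2) =
        Ideal.Quotient.mk p (algebraMap (𝓞 k₀) (𝓞 k) g₀) ^ (l / 2) := by
    have hw' : RingOfIntegers.norm k₀ (u : 𝓞 k) = (v ^ 2 : (𝓞 k₀)ˣ) * g₀ := by
      rw [← Units.val_mul, ← hw, Units.coe_map]
    rw [← geom_sum_mul_half (Nat.odd_iff.2 (by lia)), pow_mul,
      ← mk_norm_eq_pow (k₀ := k₀) m hl hl9 hp.ne_top hlp, hw', map_mul, map_mul, mul_pow,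
      mk_sq_pow_half_eq_one m hl hl9 hp hlp, one_mul]
  have hZ : algebraMap (𝓞 k₀) (𝓞 k) z ^ 2 ^ (0 + 2) = -1 := by
    rw [← map_pow, hz, map_neg, map_one]
  have hchar (l : ℕ) (hl : l.Prime) (hl9 : l % 16 = 9) (p : Ideal (𝓞 k)) (hp : p.IsPrime)
      (hlp : (l : 𝓞 k) ∈ p) :
      Ideal.Quotient.mk p (algebraMap (𝓞 k₀) (𝓞 k) z) ^ (l / 2) =
        Ideal.Quotient.mk p (x : 𝓞 k) ^ (l ^ 2 ^ m / 2) ∧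
      Ideal.Quotient.mk p (algebraMap (𝓞 k₀) (𝓞 k) η) ^ (l / 2) =
        Ideal.Quotient.mk p (θ : 𝓞 k) ^ (l ^ 2 ^ m / 2) := by
    have hm := isMaximal_of_natCast_mem hp hl.ne_zero hlp
    have h1 := mk_pow_half_eq_neg_one hm hl9 0 hZ
    have h2 := mk_one_add_add_sq_pow_half hm hl hlp hl9 0 hZ
    rw [pow_zero, pow_one] at h1 h2
    rw [mk_pow_half_eq_neg_one hm hl9 m hx, hθ, mk_one_add_add_sq_pow_half hm hl hlp hl9 m hx,
      h1, hη, map_add (algebraMap _ _), map_add (algebraMap _ _), map_pow, map_one, h2]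
    exact ⟨rfl, rfl⟩
  rcases hg₀ with rfl | rfl | rfl | rfl
  · exact ⟨1, by simp, fun l hl hl9 p hp hlp => by simp [hu l hl hl9 p hp hlp]⟩
  · exact ⟨x, by simp, fun l hl hl9 p hp hlp => by
      rw [hu l hl hl9 p hp hlp, (hchar l hl hl9 p hp hlp).1]⟩
  · exact ⟨θ, by simp, fun l hl hl9 p hp hlp => by
      rw [hu l hl hl9 p hp hlp, (hchar l hl hl9 p hp hlp).2]⟩
  · exact ⟨x * θ, by simp, fun l hl hl9 p hp hlp => by
      rw [hu l hl hl9 p hp hlp, Units.val_mul, Units.val_mul, map_mul, map_mul, map_mul, mul_pow,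
        mul_pow, (hchar l hl hl9 p hp hlp).1, (hchar l hl hl9 p hp hlp).2]⟩

variable {k : Type*} [Field k] [NumberField k]

theorem exists_pow_half_eq (m : ℕ) [IsCyclotomicExtension {2 ^ (m + 3)} ℚ k]
    {x θ : (𝓞 k)ˣ} (hx : (x : 𝓞 k) ^ 2 ^ (m + 2) = -1)
    (hθ : (θ : 𝓞 k) = 1 + x + x ^ 2) (u : (𝓞 k)ˣ) :
    ∃ g : (𝓞 k)ˣ, (g = 1 ∨ g = x ∨ g = θ ∨ g = x * θ) ∧
      ∀ l : ℕ, l.Prime → l % 16 = 9 → ∀ p : Ideal (𝓞 k), p.IsPrime → (l : 𝓞 k) ∈ p →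
        Ideal.Quotient.mk p (u : 𝓞 k) ^ (l ^ 2 ^ m / 2) =
          Ideal.Quotient.mk p (g : 𝓞 k) ^ (l ^ 2 ^ m / 2) := by
  have hζ := IsCyclotomicExtension.zeta_spec (2 ^ (m + 3)) ℚ k
  have hz := hζ.pow (a := 2 ^ m) (b := 2 ^ 3) (by positivity) (by rw [pow_add])
  let F : IntermediateField ℚ k := ℚ⟮IsCyclotomicExtension.zeta (2 ^ (m + 3)) ℚ k ^ 2 ^ m⟯
  have : IsCyclotomicExtension {2 ^ 3} ℚ F := hz.intermediateField_adjoin_isCyclotomicExtension ℚ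
  exact exists_pow_half_eq_of_algebra F m hx hθ u

theorem isSquare_mk_iff (m : ℕ) [IsCyclotomicExtension {2 ^ (m + 3)} ℚ k]
    {l : ℕ} (hl : l.Prime) (hl9 : l % 16 = 9) {p : Ideal (𝓞 k)}
    (hp : p.IsPrime) (hlp : (l : 𝓞 k) ∈ p) (u : (𝓞 k)ˣ) :
    (∃ c : 𝓞 k, (u : 𝓞 k) - c ^ 2 ∈ p) ↔ Ideal.Quotient.mk p (u : 𝓞 k) ^ (l ^ 2 ^ m / 2) = 1 := by
  have hm := isMaximal_of_natCast_mem hp hl.ne_zero hlp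
  have : Fact l.Prime := ⟨hl⟩
  have hchar := charP_quotient_of_natCast_mem hl hp.ne_top hlp
  let _ := Ideal.Quotient.field p
  have hcard := card_quotient_of_mod_sixteen m hl hl9 hp hlp
  have : Finite (𝓞 k ⧸ p) := Nat.finite_of_card_ne_zero (by
    rw [hcard]
    exact pow_ne_zero _ hl.ne_zero)
  let _ := Fintype.ofFinite (𝓞 k ⧸ p)
  rw [Nat.card_eq_fintype_card] at hcard
  have h := FiniteField.isSquare_iff (F := 𝓞 k ⧸ p) (a := Ideal.Quotient.mk p (u : 𝓞 k))
    (by rw [← CharP.eq (𝓞 k ⧸ p) hchar (ringChar.charP _)]; lia) (u.isUnit.map _).ne_zero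
  rw [hcard] at h
  rw [← h]
  constructor
  · rintro ⟨c, hc⟩
    exact ⟨Ideal.Quotient.mk p c, by rw [← map_mul, Ideal.Quotient.eq, ← sq]; exact hc⟩
  · rintro ⟨c, hc⟩
    obtain ⟨c, rfl⟩ := Ideal.Quotient.mk_surjective c
    exact ⟨c, by rwa [← map_mul, Ideal.Quotient.eq, ← sq] at hc⟩

variable {L : Type*} [Field L] [NumberField L] [Algebra k L] {d : ℕ}

theorem mem_unitNorms_iff_of_mod_sixteen (m : ℕ) [IsCyclotomicExtension {2 ^ (m + 3)} ℚ k]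
    (hdeg : finrank k L = 2) {s : L} (hs : s ^ 2 = (d : L))
    (hsf : Squarefree d) (hd1 : d ≠ 1) (hall : ∀ l : ℕ, l.Prime → l ∣ d → l % 16 = 9)
    (u : (𝓞 k)ˣ) :
    u ∈ unitNorms k L ↔ ∀ l : ℕ, l.Prime → l ∣ d → ∀ p : Ideal (𝓞 k), p.IsPrime → (l : 𝓞 k) ∈ p →
      Ideal.Quotient.mk p (u : 𝓞 k) ^ (l ^ 2 ^ m / 2) = 1 := by
  have := Algebra.IsQuadraticExtension.mk (R := k) (S := L) hdeg
  have hgal : IsGalois k L := inferInstance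
  have hs' : s ^ 2 = algebraMap k L ((d : 𝓞 k) : k) := by simp [hs]
  have hdsq : ¬ IsSquare ((d : 𝓞 k) : k) := not_isSquare_natCast k hsf hd1 m hall
  have hodd : Odd d := by
    by_contra h
    have := hall 2 Nat.prime_two (Nat.not_odd_iff_even.1 h).two_dvd
    lia
  constructor
  · intro hu l hl hld p hp hlp
    rw [← isSquare_mk_iff m hl (hall l hl hld) hp hlp]
    have hdp : (d : 𝓞 k) ∈ p := by
      obtain ⟨e, rfl⟩ := hld
      rw [Nat.cast_mul]
      exact p.mul_mem_right _ hlp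
    obtain ⟨σ, hσ1, hσ⟩ := exists_aut_apply_eq_neg hdeg hs' hdsq
    obtain ⟨P, hP, hPp⟩ := exists_mem_ramifiedPrimes_under_eq hdeg hs' hσ1 hσ hp hdp
      (natCast_notMem_sq k m hsf hall hp hdp)
    rw [← hPp]
    exact exists_sq_sub_mem_of_mem_unitNorms hdeg hP hu
  · intro h
    have : IsTotallyComplex k := isTotallyComplex_of_two_pow k (n := m + 3) (by lia)
    refine mem_unitNorms_of_forall_sq_sub_mem (odd_classNumber_of_two_pow (m + 1) k)
      (subsingleton_primes_over_two k (m + 2)) hdeg hs' hdsq fun p hp hdp => ⟨fun h2 => ?_, ?_⟩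
    · refine hp.ne_top (eq_top_of_coprime_natCast_mem (a := 2) (b := d) ?_ (mod_cast h2) hdp)
      exact hodd.coprime_two_left
    · obtain ⟨l, hl, hld, hlp⟩ := exists_prime_natCast_mem (hsf.ne_zero) hp hdp
      exact (isSquare_mk_iff m hl (hall l hl hld) hp hlp u).2 (h l hl hld p hp hlp)

theorem index_unitNorms (m : ℕ) [IsCyclotomicExtension {2 ^ (m + 3)} ℚ k]
    (hdeg : finrank k L = 2) {s : L} (hs : s ^ 2 = (d : L))
    (hsf : Squarefree d) (hd1 : d ≠ 1) (hall : ∀ l : ℕ, l.Prime → l ∣ d → l % 16 = 9) :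
    ((∃ p₁ p₂ : ℕ, p₁.Prime ∧ p₁ ∣ d ∧ p₂.Prime ∧ p₂ ∣ d ∧
        (2 : ZMod p₁) ^ ((p₁ - 1) / 4) = 1 ∧ (2 : ZMod p₂) ^ ((p₂ - 1) / 4) = -1) →
      (unitNorms k L).index = 4) ∧
    (¬ (∃ p₁ p₂ : ℕ, p₁.Prime ∧ p₁ ∣ d ∧ p₂.Prime ∧ p₂ ∣ d ∧
        (2 : ZMod p₁) ^ ((p₁ - 1) / 4) = 1 ∧ (2 : ZMod p₂) ^ ((p₂ - 1) / 4) = -1) →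
      (unitNorms k L).index = 2) := by
  obtain ⟨x, θ, hx, hθ⟩ := exists_units_two_pow_root k m
  set U := unitNorms k L with hU
  have hmem := mem_unitNorms_iff_of_mod_sixteen m hdeg hs hsf hd1 hall
  have hchar (l : ℕ) (hl : l.Prime) (hld : l ∣ d) (p : Ideal (𝓞 k)) (hp : p.IsPrime)
      (hlp : (l : 𝓞 k) ∈ p) : Ideal.Quotient.mk p (x : 𝓞 k) ^ (l ^ 2 ^ m / 2) = -1 ∧
      Ideal.Quotient.mk p (θ : 𝓞 k) ^ (l ^ 2 ^ m / 2) = 2 ^ ((l - 1) / 4) := by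
    have hm := isMaximal_of_natCast_mem hp hl.ne_zero hlp
    refine ⟨mk_pow_half_eq_neg_one hm (hall l hl hld) m hx, ?_⟩
    rw [hθ, mk_one_add_add_sq_pow_half hm hl hlp (hall l hl hld) m hx]
  have hnontriv (l : ℕ) (hl : l.Prime) (hld : l ∣ d) (p : Ideal (𝓞 k)) (hp : p.IsPrime)
      (hlp : (l : 𝓞 k) ∈ p) : (-1 : 𝓞 k ⧸ p) ≠ 1 := by
    have := charP_quotient_of_natCast_mem hl hp.ne_top hlp
    have : Nontrivial (𝓞 k ⧸ p) := Ideal.Quotient.nontrivial_iff.2 hp.ne_top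
    have : Fact (2 < l) := ⟨by have := hall l hl hld; lia⟩
    exact CharP.neg_one_ne_one (𝓞 k ⧸ p) l
  have hprime (l : ℕ) (hl : l.Prime) (hld : l ∣ d) :
      ∃ p : Ideal (𝓞 k), p.IsPrime ∧ (l : 𝓞 k) ∈ p := by
    have h : {p : Ideal (𝓞 k) | p.IsPrime ∧ (l : 𝓞 k) ∈ p}.Nonempty := by
      refine Set.nonempty_of_ncard_ne_zero ?_
      rw [ncard_primes_of_mod_sixteen k m hl (hall l hl hld)]
      decide
    exact h
  have hsymb (l : ℕ) (hl : l.Prime) (p : Ideal (𝓞 k)) (hp : p.IsPrime) (hlp : (l : 𝓞 k) ∈ p) :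
      ((2 : 𝓞 k ⧸ p) ^ ((l - 1) / 4) = 1 ↔ (2 : ZMod l) ^ ((l - 1) / 4) = 1) ∧
      ((2 : 𝓞 k ⧸ p) ^ ((l - 1) / 4) = -1 ↔ (2 : ZMod l) ^ ((l - 1) / 4) = -1) := by
    have : Fact l.Prime := ⟨hl⟩
    have := charP_quotient_of_natCast_mem hl hp.ne_top hlp
    have : Nontrivial (𝓞 k ⧸ p) := Ideal.Quotient.nontrivial_iff.2 hp.ne_top
    exact ⟨two_pow_quarter_eq_one_iff _, two_pow_quarter_eq_neg_one_iff _⟩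
  have hx1 : x ∉ U := by
    obtain ⟨l, hl, hld⟩ := Nat.exists_prime_and_dvd hd1
    obtain ⟨p, hp, hlp⟩ := hprime l hl hld
    intro h
    have h1 := (hmem x).1 h l hl hld p hp hlp
    rw [(hchar l hl hld p hp hlp).1] at h1
    exact hnontriv l hl hld p hp hlp h1
  have hsq (u : (𝓞 k)ˣ) : u ^ 2 ∈ U := by
    refine mem_unitNorms.2 ⟨algebraMap k L (u : 𝓞 k), ?_⟩
    rw [Algebra.norm_algebraMap, hdeg, Units.val_pow_eq_pow_val, map_pow]
  have hforall (g : (𝓞 k)ˣ ⧸ U) : g = 1 ∨ g = x ∨ g = θ ∨ g = x * θ := by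
    obtain ⟨u, rfl⟩ := QuotientGroup.mk_surjective g
    obtain ⟨g, hg, h⟩ := exists_pow_half_eq m hx hθ u
    have hug : (u : (𝓞 k)ˣ ⧸ U) = g := by
      refine QuotientGroup.eq.2 ((hmem _).2 fun l hl hld p hp hlp => ?_)
      have h1 := h l hl (hall l hl hld) p hp hlp
      rw [Units.val_mul, map_mul, mul_pow, ← h1, ← mul_pow, ← map_mul, Units.inv_mul, map_one,
        one_pow]
    rw [hug]
    rcases hg with rfl | rfl | rfl | rfl <;> simp
  have hne (g : (𝓞 k)ˣ) (hg : g ∉ U) : (g : (𝓞 k)ˣ ⧸ U) ≠ 1 := fun h =>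
    hg ((QuotientGroup.eq_one_iff g).1 h)
  refine ⟨?_, fun hex => ?_⟩
  · rintro ⟨p₁, p₂, hp₁, hpd₁, hp₂, hpd₂, h1, h2⟩
    refine card_eq_four_of_forall (hne x hx1) (hne θ ?_) (hne (x * θ) ?_)
      ((QuotientGroup.eq_one_iff (x ^ 2)).2 (hsq x)) hforall
    · intro h
      obtain ⟨p, hp, hlp⟩ := hprime p₂ hp₂ hpd₂
      have h3 := (hmem θ).1 h p₂ hp₂ hpd₂ p hp hlp
      rw [(hchar p₂ hp₂ hpd₂ p hp hlp).2, (hsymb p₂ hp₂ p hp hlp).2.2 h2] at h3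
      exact hnontriv p₂ hp₂ hpd₂ p hp hlp h3
    · intro h
      obtain ⟨p, hp, hlp⟩ := hprime p₁ hp₁ hpd₁
      have h3 := (hmem (x * θ)).1 h p₁ hp₁ hpd₁ p hp hlp
      have hc := hchar p₁ hp₁ hpd₁ p hp hlp
      rw [Units.val_mul, map_mul, mul_pow, hc.1, hc.2, (hsymb p₁ hp₁ p hp hlp).1.2 h1,
        mul_one] at h3
      exact hnontriv p₁ hp₁ hpd₁ p hp hlp h3
  · have hcases : θ ∈ U ∨ x * θ ∈ U := by
      have hpm (l : ℕ) (hl : l.Prime) (hld : l ∣ d) :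
          (2 : ZMod l) ^ ((l - 1) / 4) = 1 ∨ (2 : ZMod l) ^ ((l - 1) / 4) = -1 := by
        obtain ⟨p, hp, hlp⟩ := hprime l hl hld
        have hm := isMaximal_of_natCast_mem hp hl.ne_zero hlp
        have : Fact l.Prime := ⟨hl⟩
        have := charP_quotient_of_natCast_mem hl hp.ne_top hlp
        rw [← (hsymb l hl p hp hlp).1, ← (hsymb l hl p hp hlp).2]
        let _ := Ideal.Quotient.field p
        refine _root_.sq_eq_one_iff.1 ?_
        refine two_pow_quarter_sq (hall l hl hld)
          (z := Ideal.Quotient.mk p (x ^ 2 ^ m : (𝓞 k)ˣ)) ?_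
        rw [← map_pow, Units.val_pow_eq_pow_val, ← pow_mul, show 2 ^ m * 4 = 2 ^ (m + 2) by ring,
          hx, map_neg, map_one]
      by_cases hone : ∃ l : ℕ, l.Prime ∧ l ∣ d ∧ (2 : ZMod l) ^ ((l - 1) / 4) = 1
      · left
        obtain ⟨l₁, hl₁, hld₁, h1⟩ := hone
        refine (hmem θ).2 fun l hl hld p hp hlp => ?_
        rw [(hchar l hl hld p hp hlp).2]
        exact (hsymb l hl p hp hlp).1.2 ((hpm l hl hld).resolve_right fun h2 =>
          hex ⟨l₁, l, hl₁, hld₁, hl, hld, h1, h2⟩)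
      · right
        refine (hmem (x * θ)).2 fun l hl hld p hp hlp => ?_
        have hc := hchar l hl hld p hp hlp
        rw [Units.val_mul, map_mul, mul_pow, hc.1, hc.2, (hsymb l hl p hp hlp).2.2
          ((hpm l hl hld).resolve_left fun h1 => hone ⟨l, hl, hld, h1⟩), neg_one_mul, neg_neg]
    exact card_eq_two_of_forall (hne x hx1) ((QuotientGroup.eq_one_iff (x ^ 2)).2 (hsq x))
      (hcases.imp (QuotientGroup.eq_one_iff θ).2 (QuotientGroup.eq_one_iff (x * θ)).2) hforall

end UnitNormIndex

section Assembly

open Module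

theorem rank2_eq_of_card {K : Type*} [Field K] [NumberField K] {j : ℕ}
    (h : Nat.card {c : ClassGroup (𝓞 K) // c ^ 2 = 1} = 2 ^ j) : rank2 K = j := by
  set f : ClassGroup (𝓞 K) →* ClassGroup (𝓞 K) := powMonoidHom 2
  have h1 : Subgroup.closure {x : ClassGroup (𝓞 K) | ∃ y, x = y ^ 2} = f.range := by
    rw [← Subgroup.closure_eq f.range]
    congr 1
    ext x
    exact exists_congr fun y => eq_comm
  have h2 : f.range.index * Nat.card f.range = Nat.card f.ker * Nat.card f.range := by
    rw [Subgroup.index_mul_card, ← Subgroup.index_ker, Subgroup.card_mul_index]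
  have h3 : f.range.index = 2 ^ j := by
    rw [Nat.eq_of_mul_eq_mul_right Nat.card_pos h2, ← h]
    rfl
  rw [rank2, h1]
  change Nat.log 2 f.range.index = j
  rw [h3, Nat.log_pow one_lt_two]

theorem mod_eight_eq_one {d : ℕ} (hd : d ≠ 0) (hall : ∀ l : ℕ, l.Prime → l ∣ d → l % 16 = 9) :
    d % 8 = 1 := by
  induction d using induction_on_primes with
  | zero => exact absurd rfl hd
  | one => rfl
  | prime_mul p a hp ih =>
    have h1 := hall p hp (dvd_mul_right p a)
    have h2 := ih (right_ne_zero_of_mul hd) fun l hl h => hall l hl (h.mul_left p)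
    rw [Nat.mul_mod, h2, show p % 8 = 1 by lia]

theorem finrank_eq_two_of_adjoin_eq_top {k L : Type*} [Field k] [Field L] [Algebra k L] {s : L}
    {a : k} (hs : s ^ 2 = algebraMap k L a) (ha : ¬ IsSquare a) (htop : k⟮s⟯ = ⊤) :
    finrank k L = 2 := by
  have hirr : Irreducible (Polynomial.X ^ 2 - Polynomial.C a) :=
    X_pow_sub_C_irreducible_of_prime Nat.prime_two fun b hb => ha ⟨b, by rw [← hb, sq]⟩
  have hmonic := Polynomial.monic_X_pow_sub_C a two_ne_zero
  have hmin := minpoly.eq_of_irreducible_of_monic hirr (x := s) (by simp [hs]) hmonic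
  have hint : IsIntegral k s := ⟨_, hmonic, by simp [hs]⟩
  rw [← finrank_top', ← htop, adjoin.finrank hint, ← hmin, Polynomial.natDegree_X_pow_sub_C]

theorem rank2_of_cyclotomic {k L : Type*} [Field k] [NumberField k] [Field L] [NumberField L]
    [Algebra k L] (m : ℕ) [IsCyclotomicExtension {2 ^ (m + 3)} ℚ k] {d : ℕ} {s : L}
    (hs : s ^ 2 = (d : L)) (htop : k⟮s⟯ = ⊤) (hsf : Squarefree d) (hd1 : d ≠ 1)
    (hall : ∀ l : ℕ, l.Prime → l ∣ d → l % 16 = 9) :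
    ((∃ p₁ p₂ : ℕ, p₁.Prime ∧ p₁ ∣ d ∧ p₂.Prime ∧ p₂ ∣ d ∧
        (2 : ZMod p₁) ^ ((p₁ - 1) / 4) = 1 ∧ (2 : ZMod p₂) ^ ((p₂ - 1) / 4) = -1) →
      rank2 L = 4 * d.primeFactors.card - 3) ∧
    (¬ (∃ p₁ p₂ : ℕ, p₁.Prime ∧ p₁ ∣ d ∧ p₂.Prime ∧ p₂ ∣ d ∧
        (2 : ZMod p₁) ^ ((p₁ - 1) / 4) = 1 ∧ (2 : ZMod p₂) ^ ((p₂ - 1) / 4) = -1) →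
      rank2 L = 4 * d.primeFactors.card - 2) := by
  have hs' : s ^ 2 = algebraMap k L ((d : 𝓞 k) : k) := by simp [hs]
  have hdsq : ¬ IsSquare ((d : 𝓞 k) : k) := not_isSquare_natCast k hsf hd1 m hall
  have hdeg := finrank_eq_two_of_adjoin_eq_top hs' hdsq htop
  have := Algebra.IsQuadraticExtension.mk (R := k) (S := L) hdeg
  have hgal : IsGalois k L := inferInstance
  have : IsTotallyComplex k := isTotallyComplex_of_two_pow k (n := m + 3) (by lia)
  have hq : 0 < d.primeFactors.card := by
    rw [Finset.card_pos, Nat.nonempty_primeFactors]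
    have := Nat.pos_of_ne_zero hsf.ne_zero
    lia
  have hd8 := mod_eight_eq_one hsf.ne_zero hall
  have ht : (d : 𝓞 k) = 1 + 4 * ((d / 4 : ℕ) : 𝓞 k) := by
    have : d = 1 + 4 * (d / 4) := by lia
    exact_mod_cast congr((($this : ℕ) : 𝓞 k))
  have hcard : Nat.card (ramifiedPrimes k L) = 4 * d.primeFactors.card := by
    rw [card_ramifiedPrimes hdeg hs' hdsq ht fun p hp hdp =>
      natCast_notMem_sq k m hsf hall hp hdp]
    exact ncard_primes_natCast_mem k m hsf hall
  have : Finite (ramifiedPrimes k L) := Nat.finite_of_card_ne_zero (by lia)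
  have hmain := card_sq_eq_one_mul_index_unitNorms hdeg (odd_classNumber_of_two_pow (m + 1) k)
  rw [hcard] at hmain
  obtain ⟨h4, h2⟩ := index_unitNorms m hdeg hs hsf hd1 hall
  refine ⟨fun h => rank2_eq_of_card ?_, fun h => rank2_eq_of_card ?_⟩
  · rw [h4 h, show 4 * d.primeFactors.card = 4 * d.primeFactors.card - 3 + 3 by lia,
      pow_add] at hmain
    lia
  · rw [h2 h, show 4 * d.primeFactors.card = 4 * d.primeFactors.card - 2 + 2 by lia,
      pow_add] at hmain
    lia

end Assembly

/-- Theorem 3.1(4): for n ≥ 3 and d odd composite square-free with all q prime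
divisors ≡ 9 (mod 16): rank₂(Cl(Q(ζ_{2^n}, √d))) = 4q − 3 if there are prime
divisors p₁, p₂ of d with (2/p₁)₄ = 1 and (2/p₂)₄ = −1, and = 4q − 2 otherwise. -/
theorem stmt_18 (n : ℕ) (hn : 3 ≤ n) (d : ℕ) (hd : 1 < d) (hodd : Odd d)
    (hsf : Squarefree d) (hcomp : ¬ d.Prime)
    (hall : ∀ p : ℕ, p.Prime → p ∣ d → p % 16 = 9)
    (q : ℕ) (hq : q = {p : ℕ | p.Prime ∧ p ∣ d ∧ p % 16 = 9}.ncard)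
    (L : Type*) [Field L] [NumberField L] (ζ s : L)
    (hζ : IsPrimitiveRoot ζ (2 ^ n)) (hs : s ^ 2 = (d : L))
    (hL : IntermediateField.adjoin ℚ {ζ, s} = ⊤) :
    ((∃ p₁ p₂ : ℕ, p₁.Prime ∧ p₁ ∣ d ∧ p₂.Prime ∧ p₂ ∣ d ∧
        (2 : ZMod p₁) ^ ((p₁ - 1) / 4) = 1 ∧ (2 : ZMod p₂) ^ ((p₂ - 1) / 4) = -1) →
        rank2 L = 4 * q - 3) ∧
    (¬ (∃ p₁ p₂ : ℕ, p₁.Prime ∧ p₁ ∣ d ∧ p₂.Prime ∧ p₂ ∣ d ∧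
        (2 : ZMod p₁) ^ ((p₁ - 1) / 4) = 1 ∧ (2 : ZMod p₂) ^ ((p₂ - 1) / 4) = -1) →
        rank2 L = 4 * q - 2) := by
  obtain ⟨m, rfl⟩ : ∃ m, n = m + 3 := ⟨n - 3, by lia⟩
  have hq' : q = d.primeFactors.card := by
    rw [hq, ← Set.ncard_coe_finset]
    congr 1
    ext p
    simp only [Set.mem_ofPred_eq, Finset.mem_coe, Nat.mem_primeFactors]
    exact ⟨fun h => ⟨h.1, h.2.1, hsf.ne_zero⟩, fun h => ⟨h.1, h.2.1, hall p h.1 h.2.1⟩⟩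
  subst hq'
  let k : IntermediateField ℚ L := ℚ⟮ζ⟯
  have : IsCyclotomicExtension {2 ^ (m + 3)} ℚ k :=
    hζ.intermediateField_adjoin_isCyclotomicExtension ℚ
  have htop : k⟮s⟯ = ⊤ := by
    apply restrictScalars_injective ℚ
    rw [restrictScalars_top, ← hL]
    exact adjoin_adjoin_left ℚ {ζ} {s}
  exact rank2_of_cyclotomic (k := k) m hs htop hsf hd.ne' hall
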